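/- For every sufficiently small constant ε > 0, with probability tending to 1 as n → ∞ (over the random cost matrix C), the number of permutations π of [n] with π(i) ≠ i for all i whose cost Σ_{i=1}^n C(i,π(i)) is strictly less than Z_ATSP is at least d^d, where d = ⌈n^{ε/3}⌉. -/

import Mathlib

open MeasureTheory Finset

/-- The product measure on cost matrices: each entry independent uniform on `[0,1]`. -/
noncomputable def costMeasure (n : ℕ) : Measure (Fin n × Fin n → ℝ) :=
  Measure.pi fun _ => volume.restrict (Set.Icc 0 1)

/-- The cost of the permutation `π`: `∑ i, C (i, π i)`. -/
def permCost {n : ℕ} (C : Fin n × Fin n → ℝ) (π : Equiv.Perm (Fin n)) : ℝ :=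
  ∑ i, C (i, π i)

/-- A permutation avoiding the diagonal. -/
def IsDerangement {n : ℕ} (π : Equiv.Perm (Fin n)) : Prop := ∀ i, π i ≠ i

/-- A cyclic permutation: a single cycle through all `n` points. -/
def IsCyclicPerm {n : ℕ} (π : Equiv.Perm (Fin n)) : Prop := π.IsCycle ∧ ∀ i, π i ≠ i

/-- Optimal value of the assignment problem (diagonal forbidden). -/
noncomputable def ZAP (n : ℕ) (C : Fin n × Fin n → ℝ) : ℝ :=
  sInf {x | ∃ π : Equiv.Perm (Fin n), IsDerangement π ∧ x = permCost C π}

/-- Optimal value of the asymmetric TSP. -/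
noncomputable def ZATSP (n : ℕ) (C : Fin n × Fin n → ℝ) : ℝ :=
  sInf {x | ∃ π : Equiv.Perm (Fin n), IsCyclicPerm π ∧ x = permCost C π}

/-- The arcs in `F1` have in- and out-degree at most one and contain
no directed cycle of length `< n`. -/
def ValidArcs {n : ℕ} (F1 : Set (Fin n × Fin n)) : Prop :=
  (∀ e ∈ F1, ∀ e' ∈ F1, (e : Fin n × Fin n).1 = (e' : Fin n × Fin n).1 → e = e') ∧
  (∀ e ∈ F1, ∀ e' ∈ F1, (e : Fin n × Fin n).2 = (e' : Fin n × Fin n).2 → e = e') ∧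
  (∀ k : ℕ, 0 < k → k < n → ∀ f : ZMod k → Fin n,
    Function.Injective f → ¬ (∀ t, (f t, f (t + 1)) ∈ F1))

/-- `(F0, F1)` is a constraint pair. -/
def IsConstraint {n : ℕ} (F0 F1 : Finset (Fin n × Fin n)) : Prop :=
  Disjoint F0 F1 ∧ (∀ e ∈ F0 ∪ F1, (e : Fin n × Fin n).1 ≠ (e : Fin n × Fin n).2) ∧
    ValidArcs (F1 : Set (Fin n × Fin n))

/-- The inadmissible arcs: off-diagonal arcs not in `F1` whose addition to `F1`
violates the degree or short-cycle conditions. -/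
def Fhat0 {n : ℕ} (F1 : Finset (Fin n × Fin n)) : Set (Fin n × Fin n) :=
  {e | e.1 ≠ e.2 ∧ e ∉ F1 ∧ ¬ ValidArcs (insert e (F1 : Set (Fin n × Fin n)))}

/-- An arc not in `F0 ∪ F1 ∪ F̂0 ∪ D`. -/
def Admissible {n : ℕ} (F0 F1 : Finset (Fin n × Fin n)) (e : Fin n × Fin n) : Prop :=
  e.1 ≠ e.2 ∧ e ∉ F0 ∧ e ∉ F1 ∧ e ∉ Fhat0 F1

/-- `π` is feasible for `AP(F)`. -/
def FeasibleAP {n : ℕ} (F0 F1 : Finset (Fin n × Fin n)) (π : Equiv.Perm (Fin n)) : Prop :=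
  (∀ i, π i ≠ i) ∧ (∀ e ∈ F1, π (e : Fin n × Fin n).1 = (e : Fin n × Fin n).2) ∧
  (∀ i, (i, π i) ∉ F0 ∧ (i, π i) ∉ Fhat0 F1)

/-- Optimal value of the restricted assignment problem `AP(F)`. -/
noncomputable def ZAPF {n : ℕ} (C : Fin n × Fin n → ℝ) (F0 F1 : Finset (Fin n × Fin n)) : ℝ :=
  sInf {x | ∃ π : Equiv.Perm (Fin n), FeasibleAP F0 F1 π ∧ x = permCost C π}

/-- Condition (⋆): `|F1| ≤ n^{3ε/8}` and `|F0| ≤ n^{3ε/4}`. -/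
def StarCond {n : ℕ} (ε : ℝ) (F0 F1 : Finset (Fin n × Fin n)) : Prop :=
  (F1.card : ℝ) ≤ (n : ℝ) ^ (3 * ε / 8) ∧ (F0.card : ℝ) ≤ (n : ℝ) ^ (3 * ε / 4)

/-- `(a_i, b_j)` is an edge of `K_{A,B:F}`. -/
def EdgeKF {n : ℕ} (F0 F1 : Finset (Fin n × Fin n)) (i j : Fin n) : Prop :=
  i ≠ j ∧ (i, j) ∉ F0 ∧ (i, j) ∉ Fhat0 F1

/-- `b_j ∈ N_ζ(a_i)`: `(a_i,b_j)` is among the `ζ` cheapest edges of `K_{A,B:F}` at `a_i`. -/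
def Nout {n : ℕ} (C : Fin n × Fin n → ℝ) (F0 F1 : Finset (Fin n × Fin n)) (ζ : ℕ)
    (i : Fin n) : Set (Fin n) :=
  {j | EdgeKF F0 F1 i j ∧ {j' | EdgeKF F0 F1 i j' ∧ C (i, j') < C (i, j)}.ncard < ζ}

/-- `a_i ∈ N_ζ(b_j)`: `(a_i,b_j)` is among the `ζ` cheapest edges of `K_{A,B:F}` at `b_j`. -/
def Nin {n : ℕ} (C : Fin n × Fin n → ℝ) (F0 F1 : Finset (Fin n × Fin n)) (ζ : ℕ)
    (j : Fin n) : Set (Fin n) :=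
  {i | EdgeKF F0 F1 i j ∧ {i' | EdgeKF F0 F1 i' j ∧ C (i', j) < C (i, j)}.ncard < ζ}

/-- Forward arcs `(a_i, b_j)` of the digraph `D⃗_F(C,π)`. -/
def ForwardArc {n : ℕ} (C : Fin n × Fin n → ℝ) (F0 F1 : Finset (Fin n × Fin n)) (ζ : ℕ)
    (i j : Fin n) : Prop :=
  (i, j) ∉ F0 ∧ (i, j) ∉ F1 ∧ (i, j) ∉ Fhat0 F1 ∧ i ≠ j ∧
    (j ∈ Nout C F0 F1 ζ i ∨ i ∈ Nin C F0 F1 ζ j)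

/-- The bipartite graph on `A ⊕ B` whose edges `(a_i, b_j)` are given by a set of pairs. -/
def bipGraph {n : ℕ} (T : Finset (Fin n × Fin n)) : SimpleGraph (Fin n ⊕ Fin n) :=
  SimpleGraph.fromRel fun u v =>
    ∃ p ∈ T, u = Sum.inl (p : Fin n × Fin n).1 ∧ v = Sum.inr (p : Fin n × Fin n).2

/-- Arcs of the contraction `φ(T)`: an arc `(i₁, i₂)` for every non-matching
edge `(a_{i₁}, b_{π i₂})` of `T`. -/
def contractionArcs {n : ℕ} (π : Equiv.Perm (Fin n)) (T : Finset (Fin n × Fin n)) :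
    Set (Fin n × Fin n) :=
  {q | (q.1, π q.2) ∈ T ∧ q.1 ≠ q.2}

/-- The contraction `φ(T)` as an (undirected) graph on `[n]`: an edge `{i₁, i₂}` for
every non-matching edge `(a_{i₁}, b_{π i₂})` of `T`. -/
def contractGraph {n : ℕ} (π : Equiv.Perm (Fin n)) (T : Finset (Fin n × Fin n)) :
    SimpleGraph (Fin n) :=
  SimpleGraph.fromRel fun i₁ i₂ => (i₁, π i₂) ∈ T



/-- Uniform measure on `[0,1]`. -/
noncomputable def U1 : Measure ℝ := volume.restrict (Set.Icc 0 1)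

instance instU1Prob : IsProbabilityMeasure U1 := by
  constructor
  simp [U1]

theorem update_mp {ι : Type*} [Fintype ι] [DecidableEq ι] (μ : Measure ℝ)
    [IsProbabilityMeasure μ] (i : ι) :
    MeasurePreserving (fun q : ℝ × (ι → ℝ) => Function.update q.2 i q.1)
      (μ.prod (Measure.pi fun _ : ι => μ)) (Measure.pi fun _ : ι => μ) := by
  have hm : Measurable (fun q : ℝ × (ι → ℝ) => Function.update q.2 i q.1) := by
    rw [measurable_pi_iff]
    intro k
    by_cases h : k = i
    · subst h; simp only [Function.update_self]; exact measurable_fst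
    · simp only [Function.update_of_ne h]; fun_prop
  refine ⟨hm, ?_⟩
  symm
  refine Measure.pi_eq (fun s hs => ?_)
  rw [Measure.map_apply hm (MeasurableSet.univ_pi hs)]
  have : (fun q : ℝ × (ι → ℝ) => Function.update q.2 i q.1) ⁻¹' (Set.univ.pi s)
      = (s i) ×ˢ (Set.univ.pi (Function.update s i Set.univ)) := by
    ext q
    simp only [Set.mem_preimage, Set.mem_pi, Set.mem_univ, true_imp_iff, Set.mem_prod]
    constructor
    · intro h
      refine ⟨by simpa using h i, fun k => ?_⟩
      by_cases hk : k = i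
      · subst hk; simp
      · have := h k
        simpa [Function.update_of_ne hk] using this
    · rintro ⟨h1, h2⟩ k
      by_cases hk : k = i
      · subst hk; simpa using h1
      · have := h2 k
        simpa [Function.update_of_ne hk] using this
  rw [this, Measure.prod_prod, Measure.pi_pi]
  rw [← Finset.mul_prod_erase univ _ (Finset.mem_univ i),
    ← Finset.mul_prod_erase univ (fun k => μ (s k)) (Finset.mem_univ i)]
  simp only [Function.update_self, measure_univ, one_mul]
  congr 1
  refine Finset.prod_congr rfl fun k hk => ?_
  rw [Function.update_of_ne (Finset.ne_of_mem_erase hk)]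

theorem lintegral_update {ι : Type*} [Fintype ι] [DecidableEq ι] (μ : Measure ℝ)
    [IsProbabilityMeasure μ] (i : ι) (F : (ι → ℝ) → ENNReal) (hF : Measurable F) :
    ∫⁻ c, F c ∂(Measure.pi fun _ : ι => μ) =
      ∫⁻ c, ∫⁻ t, F (Function.update c i t) ∂μ ∂(Measure.pi fun _ : ι => μ) := by
  rw [← (update_mp μ i).lintegral_comp hF]
  rw [lintegral_prod_symm']
  exact hF.comp (update_mp μ i).measurable

theorem lintegral_update' {ι : Type*} [Fintype ι] [DecidableEq ι] (μ : Measure ℝ)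
    [IsProbabilityMeasure μ] (i : ι) (F : (ι → ℝ) → ENNReal) (hF : Measurable F) :
    ∫⁻ c, F c ∂(Measure.pi fun _ : ι => μ) =
      ∫⁻ t, ∫⁻ c, F (Function.update c i t) ∂(Measure.pi fun _ : ι => μ) ∂μ := by
  rw [← (update_mp μ i).lintegral_comp hF]
  rw [lintegral_prod]
  exact (hF.comp (update_mp μ i).measurable).aemeasurable

/-- One coordinate slices of small diameter imply small measure. -/
theorem slice_le {ι : Type*} [Fintype ι] [DecidableEq ι] (i : ι) (S : Set (ι → ℝ))
    (hS : MeasurableSet S) (δ : ℝ)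
    (h : ∀ c t1 t2, Function.update c i t1 ∈ S → Function.update c i t2 ∈ S → t2 - t1 ≤ δ) :
    (Measure.pi fun _ : ι => U1) S ≤ ENNReal.ofReal δ := by
  rw [← lintegral_indicator_one hS, lintegral_update U1 i _ (measurable_one.indicator hS)]
  calc _ ≤ ∫⁻ c, ENNReal.ofReal δ ∂(Measure.pi fun _ : ι => U1) := by
        refine lintegral_mono fun c => ?_
        have hm : MeasurableSet {t | Function.update c i t ∈ S} :=
          hS.preimage (measurable_update c)
        have : (fun t => S.indicator (1 : (ι → ℝ) → ENNReal) (Function.update c i t))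
            = Set.indicator {t | Function.update c i t ∈ S} 1 := by
          ext t; simp [Set.indicator]
        rw [this, lintegral_indicator_one hm]
        calc U1 {t | Function.update c i t ∈ S} ≤ volume {t | Function.update c i t ∈ S} :=
              Measure.restrict_apply_le _ _
          _ ≤ Metric.ediam {t | Function.update c i t ∈ S} := Real.volume_le_diam _
          _ ≤ ENNReal.ofReal δ := by
              refine Metric.ediam_le fun x hx y hy => ?_
              rw [edist_dist, Real.dist_eq]
              apply ENNReal.ofReal_le_ofReal
              rw [abs_le]
              have := h c x y hx hy
              have := h c y x hy hx
              constructor <;> linarith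
    _ = _ := by simp


/-- Near-optimal derangements. -/
def NearSet {n : ℕ} (δ : ℝ) (C : Fin n × Fin n → ℝ) : Set (Equiv.Perm (Fin n)) :=
  {π | IsDerangement π ∧ ∀ π', IsDerangement π' → permCost C π ≤ permCost C π' + δ}

def EvS {n : ℕ} (N : Set (Equiv.Perm (Fin n))) (i j : Fin n) : Prop :=
  (∃ π ∈ N, π i = j) ∧ ∃ π ∈ N, π i ≠ j

def XS {n : ℕ} (N : Set (Equiv.Perm (Fin n))) (i : Fin n) : Prop := ∃ j, EvS N i j

def VS {n : ℕ} (N : Set (Equiv.Perm (Fin n))) (a b : Fin n) (t : ℕ) : Prop :=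
  ∃ τ ∈ N, IsCyclicPerm τ ∧ τ^[t] a = b ∧ ∀ s ≤ t, ¬ XS N (τ^[s] a)

def YS {n : ℕ} (N : Set (Equiv.Perm (Fin n))) (L : ℕ) (a : Fin n) (t : ℕ) : Prop :=
  (∀ π ∈ N, Function.minimalPeriod π a = t) ∧
    ∃ π ∈ N, ∀ x, Function.minimalPeriod π x ≤ L → ∃ s < t, π^[s] a = x

theorem agree_of_not_XS {n : ℕ} {N : Set (Equiv.Perm (Fin n))} {i : Fin n} (h : ¬ XS N i)
    {π τ : Equiv.Perm (Fin n)} (hπ : π ∈ N) (hτ : τ ∈ N) : π i = τ i := by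
  by_contra hne
  exact h ⟨τ i, ⟨τ, hτ, rfl⟩, ⟨π, hπ, hne⟩⟩

theorem agree_iter {n : ℕ} {N : Set (Equiv.Perm (Fin n))} {a : Fin n} {t : ℕ}
    {τ : Equiv.Perm (Fin n)} (hτ : τ ∈ N) (h : ∀ s < t, ¬ XS N (τ^[s] a))
    {π : Equiv.Perm (Fin n)} (hπ : π ∈ N) : ∀ s ≤ t, π^[s] a = τ^[s] a := by
  intro s
  induction s with
  | zero => intro _; rfl
  | succ k ih =>
    intro hk
    rw [Function.iterate_succ_apply', Function.iterate_succ_apply', ih (by omega)]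
    exact agree_of_not_XS (h k (by omega)) hπ hτ

theorem cyc_inj {n : ℕ} {τ : Equiv.Perm (Fin n)} (hτ : IsCyclicPerm τ) (a : Fin n) {k l : ℕ}
    (hk : k < n) (hl : l < n) (h : τ^[k] a = τ^[l] a) : k = l := by
  have hsupp : τ.support = univ := by
    ext x; simp [hτ.2 x]
  have hord : orderOf τ = n := by rw [hτ.1.orderOf, hsupp]; simp
  wlog hkl : k ≤ l generalizing k l
  · exact (this hl hk h.symm (by omega)).symm
  have h1 : τ^[l - k] a = a := by
    have : τ^[k] (τ^[l-k] a) = τ^[k] a := by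
      rw [← Function.iterate_add_apply, show k + (l - k) = l by omega, h]
    exact (τ.injective.iterate k) this
  have h2 : τ ^ (l - k) = 1 := by
    rw [hτ.1.pow_eq_one_iff]
    refine ⟨a, hτ.2 a, ?_⟩
    rw [← Equiv.Perm.iterate_eq_pow]; exact h1
  have h3 := orderOf_dvd_of_pow_eq_one h2
  rw [hord] at h3
  have := Nat.eq_zero_of_dvd_of_lt h3 (by omega)
  omega

theorem cyc_surj {n : ℕ} {τ : Equiv.Perm (Fin n)} (hτ : IsCyclicPerm τ) (a x : Fin n) :
    ∃ k < n, τ^[k] a = x := by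
  have hsupp : τ.support = univ := by
    ext x; simp [hτ.2 x]
  have hord : orderOf τ = n := by rw [hτ.1.orderOf, hsupp]; simp
  obtain ⟨i, hi⟩ := hτ.1.exists_pow_eq (hτ.2 a) (hτ.2 x)
  have hn : 0 < n := a.pos
  refine ⟨i % n, Nat.mod_lt _ hn, ?_⟩
  rw [Equiv.Perm.iterate_eq_pow, ← hi]
  have h := pow_mod_orderOf τ i
  simp only [hord] at h
  rw [h]

theorem VS_unique {n : ℕ} {N : Set (Equiv.Perm (Fin n))} {a b : Fin n} {t t' : ℕ}
    (ht : t < n) (ht' : t' < n) (h : VS N a b t) (h' : VS N a b t') : t = t' := by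
  wlog hle : t' ≤ t generalizing t t'
  · exact (this ht' ht h' h (by omega)).symm
  obtain ⟨τ, hτN, hτ, hb, hX⟩ := h
  obtain ⟨σ, hσN, hσ, hb', hX'⟩ := h'
  have h1 : σ^[t'] a = τ^[t'] a :=
    agree_iter hτN (t := t) (fun s hs => hX s hs.le) hσN t' hle
  refine cyc_inj hτ a ht ht' ?_
  rw [hb, ← h1, hb']

theorem YS_of {n : ℕ} {N N' : Set (Equiv.Perm (Fin n))} {L : ℕ} {a b : Fin n} {t : ℕ}
    (h2 : 2 ≤ t) (htL : t ≤ L) (hL : 2 * L < n)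
    (hV : VS N a b t)
    (h1 : ∀ π ∈ N, Equiv.swap a b * π ∈ N') (h1' : ∀ π ∈ N', Equiv.swap a b * π ∈ N) :
    YS N' L a t := by
  obtain ⟨τ, hτN, hτ, hb, hX⟩ := hV
  -- iterates
  have key : ∀ π ∈ N, ∀ s < t, (Equiv.swap a b * π)^[s] a = τ^[s] a := by
    intro π hπ s
    induction s with
    | zero => intro _; rfl
    | succ k ih =>
      intro hk
      rw [Function.iterate_succ_apply', ih (by omega), Equiv.Perm.mul_apply,
        agree_of_not_XS (hX k (by omega)) hπ hτN, ← Function.iterate_succ_apply' τ]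
      apply Equiv.swap_apply_of_ne_of_ne
      · intro h
        have := cyc_inj hτ a (k := k+1) (l := 0) (by omega) (by omega) h
        omega
      · intro h
        rw [← hb] at h
        have := cyc_inj hτ a (k := k+1) (l := t) (by omega) (by omega) h
        omega
  have keyt : ∀ π ∈ N, (Equiv.swap a b * π)^[t] a = a := by
    intro π hπ
    obtain ⟨k, rfl⟩ : ∃ k, t = k + 1 := ⟨t - 1, by omega⟩
    rw [Function.iterate_succ_apply', key π hπ k (by omega), Equiv.Perm.mul_apply,
        agree_of_not_XS (hX k (by omega)) hπ hτN, ← Function.iterate_succ_apply' τ, hb]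
    exact Equiv.swap_apply_right a b
  have hper : ∀ π ∈ N, Function.minimalPeriod (Equiv.swap a b * π) a = t := by
    intro π hπ
    have hp : Function.IsPeriodicPt (Equiv.swap a b * π) t a := keyt π hπ
    apply le_antisymm (hp.minimalPeriod_le (by omega))
    by_contra hlt
    push Not at hlt
    have h0 := hp.minimalPeriod_pos (by omega)
    have h3 := Function.isPeriodicPt_minimalPeriod (Equiv.swap a b * π) a
    have h4 := key π hπ _ hlt
    rw [h3] at h4
    have := cyc_inj hτ a (k := 0) (by omega) (by omega) h4
    omega
  constructor
  · intro π hπ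
    have := hper _ (h1' π hπ)
    rwa [← mul_assoc, Equiv.swap_mul_self, one_mul] at this
  · refine ⟨_, h1 τ hτN, ?_⟩
    set ψ := Equiv.swap a b * τ with hψ
    have key2 : ∀ j, t + j < n → ψ^[j] b = τ^[t + j] a := by
      intro j
      induction j with
      | zero => intro _; simpa using hb.symm
      | succ k ih =>
        intro hk
        rw [Function.iterate_succ_apply', ih (by omega), hψ, Equiv.Perm.mul_apply,
          ← Function.iterate_succ_apply' τ]
        apply Equiv.swap_apply_of_ne_of_ne
        · intro h
          have := cyc_inj hτ a (k := t+k+1) (l := 0) (by omega) (by omega) h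
          omega
        · intro h
          rw [← hb] at h
          have := cyc_inj hτ a (k := t+k+1) (l := t) (by omega) (by omega) h
          omega
    have hbper : b ∈ Function.periodicPts ψ := by
      have := ψ.injective.mem_periodicPts b
      exact this
    have hbmin : L < Function.minimalPeriod ψ b := by
      by_contra hle
      push Not at hle
      have h0 := Function.minimalPeriod_pos_of_mem_periodicPts hbper
      have h3 := Function.isPeriodicPt_minimalPeriod ψ b
      have h4 := key2 (Function.minimalPeriod ψ b) (by omega)
      rw [h3, ← hb] at h4
      rw [hb] at h4
      have := cyc_inj hτ a (k := t) (l := t + Function.minimalPeriod ψ b)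
        (by omega) (by omega) (hb.trans h4)
      omega
    intro x hx
    obtain ⟨k, hk, rfl⟩ := cyc_surj hτ a x
    by_cases hkt : k < t
    · exact ⟨k, hkt, key τ hτN k hkt⟩
    · exfalso
      obtain ⟨j, rfl⟩ : ∃ j, k = t + j := ⟨k - t, by omega⟩
      rw [← key2 j hk, Function.minimalPeriod_apply_iterate hbper] at hx
      omega

/-- membership outside the pair -/
def DD {n : ℕ} (a b : Fin n) (π : Equiv.Perm (Fin n)) : Prop :=
  π a ≠ a ∧ π a ≠ b ∧ π b ≠ a ∧ π b ≠ b

def PhiSw {n : ℕ} (a b : Fin n) (C : Fin n × Fin n → ℝ) : Fin n × Fin n → ℝ :=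
  fun e => if e.1 = a ∨ e.1 = b then C e else C (e.1, Equiv.swap a b e.2)

theorem PhiSw_PhiSw {n : ℕ} (a b : Fin n) (C : Fin n × Fin n → ℝ) :
    PhiSw a b (PhiSw a b C) = C := by
  ext ⟨i, j⟩
  simp only [PhiSw]
  split_ifs <;> simp

theorem cost_PhiSw {n : ℕ} {a b : Fin n} (C : Fin n × Fin n → ℝ) {π : Equiv.Perm (Fin n)}
    (h : DD a b π) : permCost (PhiSw a b C) (Equiv.swap a b * π) = permCost C π := by
  unfold permCost
  refine Finset.sum_congr rfl fun i _ => ?_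
  obtain ⟨h1, h2, h3, h4⟩ := h
  simp only [PhiSw, Equiv.Perm.mul_apply]
  split_ifs with hi
  · rcases hi with rfl | rfl
    · rw [Equiv.swap_apply_of_ne_of_ne h1 h2]
    · rw [Equiv.swap_apply_of_ne_of_ne h3 h4]
  · simp

theorem DD_swap {n : ℕ} {a b : Fin n} {π : Equiv.Perm (Fin n)}
    (h : DD a b π) : DD a b (Equiv.swap a b * π) := by
  obtain ⟨h1, h2, h3, h4⟩ := h
  unfold DD
  simp only [Equiv.Perm.mul_apply]
  rw [Equiv.swap_apply_of_ne_of_ne h1 h2, Equiv.swap_apply_of_ne_of_ne h3 h4]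
  exact ⟨h1, h2, h3, h4⟩

theorem der_swap {n : ℕ} {a b : Fin n} {π : Equiv.Perm (Fin n)}
    (h : DD a b π) (hπ : IsDerangement π) : IsDerangement (Equiv.swap a b * π) := by
  obtain ⟨h1, h2, h3, h4⟩ := h
  intro i
  simp only [Equiv.Perm.mul_apply]
  by_cases ha : i = a
  · subst ha; rw [Equiv.swap_apply_of_ne_of_ne h1 h2]; exact h1
  by_cases hb : i = b
  · subst hb; rw [Equiv.swap_apply_of_ne_of_ne h3 h4]; exact h4
  intro h
  apply hπ i
  have := congrArg (Equiv.swap a b) h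
  rwa [Equiv.swap_apply_self, Equiv.swap_apply_of_ne_of_ne ha hb] at this

theorem exists_opt {n : ℕ} (C : Fin n × Fin n → ℝ) (hne : ∃ π : Equiv.Perm (Fin n), IsDerangement π) :
    ∃ π : Equiv.Perm (Fin n), IsDerangement π ∧ ∀ π', IsDerangement π' → permCost C π ≤ permCost C π' := by
  classical
  obtain ⟨π0, h0⟩ := hne
  obtain ⟨π, hπ, hmin⟩ := Finset.exists_min_image (univ.filter fun π : Equiv.Perm (Fin n) => IsDerangement π)
    (permCost C) ⟨π0, by simpa using h0⟩
  refine ⟨π, by simpa using hπ, fun π' h' => hmin π' (by simpa using h')⟩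

theorem near_swap {n : ℕ} {δ : ℝ} (hδ : 0 ≤ δ) {a b : Fin n} (C : Fin n × Fin n → ℝ)
    (h1 : ∀ π ∈ NearSet δ C, DD a b π) (h2 : ∀ π ∈ NearSet δ (PhiSw a b C), DD a b π) :
    ∀ π ∈ NearSet δ C, Equiv.swap a b * π ∈ NearSet δ (PhiSw a b C) := by
  intro π hπ
  have hD := h1 π hπ
  refine ⟨der_swap hD hπ.1, fun π'' hd => ?_⟩
  obtain ⟨ψ, hψ, hψmin⟩ := exists_opt (PhiSw a b C) ⟨π, hπ.1⟩
  have hψn : ψ ∈ NearSet δ (PhiSw a b C) := ⟨hψ, fun π' h' => by linarith [hψmin π' h']⟩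
  have hψD := h2 ψ hψn
  rw [cost_PhiSw C hD]
  have h3 := cost_PhiSw (PhiSw a b C) hψD
  rw [PhiSw_PhiSw] at h3
  have h4 := hπ.2 _ (der_swap hψD hψ)
  have h5 := hψmin π'' hd
  linarith

def UseS {n : ℕ} (N : Set (Equiv.Perm (Fin n))) (i j : Fin n) : Prop := ∃ π ∈ N, π i = j

theorem V_or {n : ℕ} {δ : ℝ} (hδ : 0 ≤ δ) {L : ℕ} {a b : Fin n} {t : ℕ}
    (h2 : 2 ≤ t) (htL : t ≤ L) (hL : 2 * L < n) (C : Fin n × Fin n → ℝ)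
    (hV : VS (NearSet δ (PhiSw a b C)) a b t) :
    UseS (NearSet δ C) a b ∨ UseS (NearSet δ C) b a ∨ YS (NearSet δ C) L a t := by
  by_cases hab : UseS (NearSet δ C) a b
  · exact Or.inl hab
  by_cases hba : UseS (NearSet δ C) b a
  · exact Or.inr (Or.inl hba)
  refine Or.inr (Or.inr ?_)
  have hD1 : ∀ π ∈ NearSet δ C, DD a b π := by
    intro π hπ
    exact ⟨hπ.1 a, fun h => hab ⟨π, hπ, h⟩, fun h => hba ⟨π, hπ, h⟩, hπ.1 b⟩
  have hD2 : ∀ π ∈ NearSet δ (PhiSw a b C), DD a b π := by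
    intro π hπ
    obtain ⟨τ, hτN, hτ, hb, hX⟩ := hV
    refine ⟨hπ.1 a, fun h => ?_, fun h => ?_, hπ.1 b⟩
    · have := agree_of_not_XS (hX 0 (by omega)) hπ hτN
      simp only [Function.iterate_zero, id] at this
      rw [h] at this
      have := cyc_inj hτ a (k := t) (l := 1) (by omega) (by omega) (by rw [hb]; exact this)
      omega
    · have := agree_of_not_XS (hX t (by omega)) hπ hτN
      rw [← Function.iterate_succ_apply' τ, hb, h] at this
      have := cyc_inj hτ a (k := 0) (l := t+1) (by omega) (by omega) this
      omega
  have g1 := near_swap hδ C hD1 hD2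
  have g2 := near_swap hδ (PhiSw a b C) hD2 (by rw [PhiSw_PhiSw]; exact hD1)
  rw [PhiSw_PhiSw] at g2
  exact YS_of h2 htL hL hV g2 g1


theorem measurable_permCost {n : ℕ} (π : Equiv.Perm (Fin n)) :
    Measurable (fun C : Fin n × Fin n → ℝ => permCost C π) := by
  unfold permCost; fun_prop

theorem measurableSet_near {n : ℕ} (δ : ℝ) (π : Equiv.Perm (Fin n)) :
    MeasurableSet {C : Fin n × Fin n → ℝ | π ∈ NearSet δ C} := by
  have : {C : Fin n × Fin n → ℝ | π ∈ NearSet δ C} =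
      {C | IsDerangement π} ∩ ⋂ π' : Equiv.Perm (Fin n),
        ({C | ¬ IsDerangement π'} ∪ {C | permCost C π ≤ permCost C π' + δ}) := by
    ext C
    simp only [NearSet, Set.mem_ofPred_eq, Set.mem_inter_iff, Set.mem_iInter, Set.mem_union]
    grind
  rw [this]
  refine (MeasurableSet.const _).inter (MeasurableSet.iInter fun π' => ?_)
  refine (MeasurableSet.const _).union ?_
  exact measurableSet_le (measurable_permCost π) ((measurable_permCost π').add_const δ)

theorem measurableSet_nearSet {n : ℕ} (δ : ℝ) (P : Set (Equiv.Perm (Fin n)) → Prop) :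
    MeasurableSet {C : Fin n × Fin n → ℝ | P (NearSet δ C)} := by
  have : {C : Fin n × Fin n → ℝ | P (NearSet δ C)} =
      ⋃ A : Set (Equiv.Perm (Fin n)), ({C | P A} ∩ ⋂ π : Equiv.Perm (Fin n),
        {C | π ∈ NearSet δ C ↔ π ∈ A}) := by
    ext C
    simp only [Set.mem_ofPred_eq, Set.mem_iUnion, Set.mem_inter_iff, Set.mem_iInter]
    constructor
    · intro h; exact ⟨_, h, fun _ => Iff.rfl⟩
    · rintro ⟨A, hA, h⟩
      have : NearSet δ C = A := Set.ext h
      rw [this]; exact hA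
  rw [this]
  refine MeasurableSet.iUnion fun A => (MeasurableSet.const _).inter
    (MeasurableSet.iInter fun π => ?_)
  by_cases h : π ∈ A
  · simpa [h] using measurableSet_near δ π
  · have h2 := (measurableSet_near δ π).compl
    have : {C : Fin n × Fin n → ℝ | π ∈ NearSet δ C ↔ π ∈ A} = {C | π ∈ NearSet δ C}ᶜ := by
      ext C; simp [h]
    rw [this]; exact h2

theorem permCost_update_of_ne {n : ℕ} (C : Fin n × Fin n → ℝ) (i j : Fin n) (t : ℝ)
    (π : Equiv.Perm (Fin n)) (h : π i ≠ j) :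
    permCost (Function.update C (i, j) t) π = permCost C π := by
  unfold permCost
  refine Finset.sum_congr rfl fun k _ => ?_
  rw [Function.update_of_ne]
  intro hk
  rw [Prod.mk.injEq] at hk
  apply h
  rw [← hk.1, hk.2]

theorem permCost_update_of_eq {n : ℕ} (C : Fin n × Fin n → ℝ) (i j : Fin n) (t : ℝ)
    (π : Equiv.Perm (Fin n)) (h : π i = j) :
    permCost (Function.update C (i, j) t) π = permCost C π - C (i, j) + t := by
  unfold permCost
  rw [← Finset.add_sum_erase univ _ (Finset.mem_univ i),
    ← Finset.add_sum_erase univ (fun k => C (k, π k)) (Finset.mem_univ i)]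
  have : ∑ k ∈ univ.erase i, Function.update C (i, j) t (k, π k)
      = ∑ k ∈ univ.erase i, C (k, π k) := by
    refine Finset.sum_congr rfl fun k hk => ?_
    rw [Function.update_of_ne]
    intro hk'
    rw [Prod.mk.injEq] at hk'
    exact Finset.ne_of_mem_erase hk hk'.1
  rw [this]
  simp only [h, Function.update_self]
  ring

theorem costMeasure_eq (n : ℕ) :
    costMeasure n = Measure.pi fun _ : Fin n × Fin n => U1 := rfl

instance instCostProb (n : ℕ) : IsProbabilityMeasure (costMeasure n) := by
  rw [costMeasure_eq]; infer_instance

theorem ev_measure {n : ℕ} (δ : ℝ) (i j : Fin n) :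
    costMeasure n {C | EvS (NearSet δ C) i j} ≤ ENNReal.ofReal (2 * δ) := by
  rw [costMeasure_eq]
  refine slice_le (i, j) _ (measurableSet_nearSet δ fun N => EvS N i j) _ ?_
  rintro c t1 t2 ⟨_, π', hπ', hne⟩ ⟨⟨π, hπ, heq⟩, _⟩
  have h1 := hπ'.2 π hπ.1
  have h2 := hπ.2 π' hπ'.1
  rw [permCost_update_of_eq c i j _ π heq, permCost_update_of_ne c i j _ π' hne] at h1 h2
  linarith

theorem PhiSw_mp {n : ℕ} (a b : Fin n) :
    MeasurePreserving (PhiSw a b) (costMeasure n) (costMeasure n) := by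
  have hm : Measurable (PhiSw (n := n) a b) := by
    rw [measurable_pi_iff]
    rintro ⟨i, j⟩
    simp only [PhiSw]
    split_ifs <;> fun_prop
  refine ⟨hm, ?_⟩
  symm
  rw [costMeasure_eq]
  -- the underlying index map
  let e : Fin n × Fin n → Fin n × Fin n :=
    fun q => if q.1 = a ∨ q.1 = b then q else (q.1, Equiv.swap a b q.2)
  have he : Function.Involutive e := by
    rintro ⟨i, j⟩
    simp only [e]
    split_ifs <;> simp_all
  have hPhi : ∀ C : Fin n × Fin n → ℝ, PhiSw a b C = fun q => C (e q) := by
    intro C; ext ⟨i, j⟩; simp only [PhiSw, e]; split_ifs <;> rfl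
  refine Measure.pi_eq (fun s hs => ?_)
  rw [Measure.map_apply hm (MeasurableSet.univ_pi hs)]
  have : PhiSw a b ⁻¹' (Set.univ.pi s) = Set.univ.pi (fun q => s (e q)) := by
    ext C
    simp only [Set.mem_preimage, Set.mem_pi, Set.mem_univ, true_imp_iff, hPhi]
    constructor
    · intro h q
      have := h (e q)
      rwa [he q] at this
    · intro h q
      have := h (e q)
      rwa [he q] at this
  rw [this, Measure.pi_pi]
  exact (Equiv.prod_comp (Function.Involutive.toPerm e he) fun q => U1 (s q))

open Classical in
theorem YS_sum {n : ℕ} (N : Set (Equiv.Perm (Fin n))) (L : ℕ) :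
    ∑ a : Fin n, ∑ t ∈ Finset.Icc 2 L, (if YS N L a t then ((t : ENNReal))⁻¹ else 0) ≤ 1 := by
  by_cases hex : ∃ a t, t ∈ Finset.Icc 2 L ∧ YS N L a t
  · obtain ⟨a, t, ht, hY⟩ := hex
    obtain ⟨h1, π, hπ, h2⟩ := hY
    have key : ∀ a' t', t' ∈ Finset.Icc 2 L → YS N L a' t' → t' = t ∧ ∃ s < t, π^[s] a = a' := by
      intro a' t' ht' hY'
      have h3 := hY'.1 π hπ
      obtain ⟨s, hs, hsa⟩ := h2 a' (by rw [h3]; exact (Finset.mem_Icc.1 ht').2)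
      refine ⟨?_, s, hs, hsa⟩
      have := Function.minimalPeriod_apply_iterate (f := π) (x := a)
        (π.injective.mem_periodicPts a) s
      rw [hsa, h3, h1 π hπ] at this
      exact this
    have hin : ∀ a', ∑ t' ∈ Finset.Icc 2 L, (if YS N L a' t' then ((t' : ENNReal))⁻¹ else 0)
        ≤ if a' ∈ (Finset.range t).image (fun s => π^[s] a) then ((t : ENNReal))⁻¹ else 0 := by
      intro a'
      calc _ ≤ ∑ t' ∈ Finset.Icc 2 L, (if t' = t then
            (if a' ∈ (Finset.range t).image (fun s => π^[s] a) then ((t : ENNReal))⁻¹ else 0)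
            else 0) := by
            refine Finset.sum_le_sum fun t' ht' => ?_
            by_cases hh : YS N L a' t'
            · obtain ⟨rfl, s, hs, hsa⟩ := key a' t' ht' hh
              have : a' ∈ (Finset.range t').image (fun s => π^[s] a) :=
                Finset.mem_image.2 ⟨s, Finset.mem_range.2 hs, hsa⟩
              simp [hh, this]
            · simp [hh]
        _ ≤ _ := by
            rw [Finset.sum_ite_eq' (Finset.Icc 2 L) t]
            split_ifs <;> simp
    calc _ ≤ ∑ a' : Fin n, (if a' ∈ (Finset.range t).image (fun s => π^[s] a)
            then ((t : ENNReal))⁻¹ else 0) := Finset.sum_le_sum fun a' _ => hin a'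
      _ = ((Finset.range t).image (fun s => π^[s] a)).card * ((t : ENNReal))⁻¹ := by
          rw [Finset.sum_ite_mem, Finset.univ_inter, Finset.sum_const, nsmul_eq_mul]
      _ ≤ (t : ENNReal) * ((t : ENNReal))⁻¹ := by
          gcongr
          exact Finset.card_image_le.trans (by simp)
      _ ≤ 1 := ENNReal.mul_inv_le_one _
  · push Not at hex
    have : ∑ a : Fin n, ∑ t ∈ Finset.Icc 2 L, (if YS N L a t then ((t : ENNReal))⁻¹ else 0) = 0 := by
      refine Finset.sum_eq_zero fun a _ => Finset.sum_eq_zero fun t ht => ?_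
      rw [if_neg (hex a t ht)]
    rw [this]; exact zero_le_one

open Classical in
/-- number of undetermined entries -/
noncomputable def evN {n : ℕ} (N : Set (Equiv.Perm (Fin n))) : ℕ :=
  (univ.filter fun q : Fin n × Fin n => EvS N q.1 q.2).card

open Classical in
theorem use_card {n : ℕ} (N : Set (Equiv.Perm (Fin n))) :
    (univ.filter fun q : Fin n × Fin n => UseS N q.1 q.2).card ≤ n + evN N := by
  by_cases hN : ∃ π, π ∈ N
  · obtain ⟨π, hπ⟩ := hN
    have hsub : (univ.filter fun q : Fin n × Fin n => UseS N q.1 q.2) ⊆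
        (univ.image fun i : Fin n => (i, π i)) ∪
          (univ.filter fun q : Fin n × Fin n => EvS N q.1 q.2) := by
      rintro ⟨i, j⟩ hq
      simp only [Finset.mem_filter, Finset.mem_univ, true_and, Finset.mem_union,
        Finset.mem_image, Prod.mk.injEq, exists_eq_left] at hq ⊢
      by_cases h : π i = j
      · exact Or.inl h
      · exact Or.inr ⟨hq, π, hπ, h⟩
    refine (Finset.card_le_card hsub).trans ((Finset.card_union_le _ _).trans ?_)
    refine Nat.add_le_add (Finset.card_image_le.trans (by simp)) le_rfl
  · have : (univ.filter fun q : Fin n × Fin n => UseS N q.1 q.2) = ∅ := by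
      rw [Finset.filter_eq_empty_iff]
      rintro q _ ⟨π, hπ, _⟩
      exact hN ⟨π, hπ⟩
    rw [this]; simp

open Classical in
theorem X_card {n : ℕ} (N : Set (Equiv.Perm (Fin n))) :
    (univ.filter fun i : Fin n => XS N i).card ≤ evN N := by
  have : (univ.filter fun i : Fin n => XS N i) ⊆
      (univ.filter fun q : Fin n × Fin n => EvS N q.1 q.2).image Prod.fst := by
    intro i hi
    simp only [Finset.mem_filter, Finset.mem_univ, true_and, Finset.mem_image, Prod.exists,
      exists_and_right, exists_eq_right] at hi ⊢
    exact hi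
  exact (Finset.card_le_card this).trans Finset.card_image_le

open Classical in
theorem V_lower {n : ℕ} (N : Set (Equiv.Perm (Fin n))) (L : ℕ)
    (τ : Equiv.Perm (Fin n)) (hτN : τ ∈ N) (hτ : IsCyclicPerm τ) :
    (n : ENNReal) * ∑ t ∈ Finset.Icc 2 L, ((t : ENNReal))⁻¹ ≤
      (∑ a : Fin n, ∑ b : Fin n, ∑ t ∈ Finset.Icc 2 L,
        (if VS N a b t then ((t : ENNReal))⁻¹ else 0)) + 2 * L * evN N := by
  have hcount : ∀ t, n ≤ (univ.filter fun a : Fin n => VS N a (τ^[t] a) t).card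
      + (t + 1) * evN N := by
    intro t
    have hsub : (univ : Finset (Fin n)) ⊆ (univ.filter fun a : Fin n => VS N a (τ^[t] a) t) ∪
        (Finset.range (t+1)).biUnion (fun s => univ.filter fun a : Fin n => XS N (τ^[s] a)) := by
      intro a _
      by_cases h : ∀ s ≤ t, ¬ XS N (τ^[s] a)
      · exact Finset.mem_union_left _ (by simpa using ⟨τ, hτN, hτ, rfl, h⟩)
      · push Not at h
        obtain ⟨s, hs, hx⟩ := h
        refine Finset.mem_union_right _ ?_
        simp only [Finset.mem_biUnion, Finset.mem_range, Finset.mem_filter, Finset.mem_univ,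
          true_and]
        exact ⟨s, by omega, hx⟩
    have h1 := Finset.card_le_card hsub
    rw [Finset.card_univ, Fintype.card_fin] at h1
    refine h1.trans ((Finset.card_union_le _ _).trans (Nat.add_le_add le_rfl ?_))
    refine (Finset.card_biUnion_le).trans ?_
    calc _ ≤ ∑ s ∈ Finset.range (t+1), evN N := by
          refine Finset.sum_le_sum fun s _ => ?_
          refine le_trans ?_ (X_card N)
          refine Finset.card_le_card_of_injOn (fun a => τ^[s] a) ?_ ?_
          · intro a ha; simpa using ha
          · intro a _ b _ h; exact (τ.injective.iterate s) h
      _ = _ := by simp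
  have hVt : ∀ t, ((univ.filter fun a : Fin n => VS N a (τ^[t] a) t).card : ENNReal) * (t : ENNReal)⁻¹
      ≤ ∑ a : Fin n, ∑ b : Fin n, (if VS N a b t then ((t : ENNReal))⁻¹ else 0) := by
    intro t
    calc _ = ∑ a : Fin n, (if VS N a (τ^[t] a) t then ((t : ENNReal))⁻¹ else 0) := by
          rw [← Finset.sum_filter, Finset.sum_const, nsmul_eq_mul]
      _ ≤ _ := Finset.sum_le_sum fun a _ =>
          Finset.single_le_sum (f := fun b => if VS N a b t then ((t : ENNReal))⁻¹ else 0)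
            (fun _ _ => zero_le) (Finset.mem_univ (τ^[t] a))
  have hswap : (∑ a : Fin n, ∑ b : Fin n, ∑ t ∈ Finset.Icc 2 L,
        (if VS N a b t then ((t : ENNReal))⁻¹ else 0)) =
      ∑ t ∈ Finset.Icc 2 L, ∑ a : Fin n, ∑ b : Fin n,
        (if VS N a b t then ((t : ENNReal))⁻¹ else 0) := by
    rw [Finset.sum_congr rfl (fun a _ => Finset.sum_comm), Finset.sum_comm]
  rw [hswap, Finset.mul_sum]
  calc _ ≤ ∑ t ∈ Finset.Icc 2 L, ((∑ a : Fin n, ∑ b : Fin n,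
        (if VS N a b t then ((t : ENNReal))⁻¹ else 0)) + 2 * evN N) := by
        refine Finset.sum_le_sum fun t ht => ?_
        have ht2 := (Finset.mem_Icc.1 ht).1
        have h1 : (n : ENNReal) ≤ ((univ.filter fun a : Fin n => VS N a (τ^[t] a) t).card : ENNReal)
            + (t + 1) * evN N := by exact_mod_cast hcount t
        have ht0 : (t : ENNReal) ≠ 0 := by exact_mod_cast (by omega : t ≠ 0)
        calc (n : ENNReal) * (t : ENNReal)⁻¹ ≤
            (((univ.filter fun a : Fin n => VS N a (τ^[t] a) t).card : ENNReal)
            + (t + 1) * evN N) * (t : ENNReal)⁻¹ := by gcongr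
          _ = ((univ.filter fun a : Fin n => VS N a (τ^[t] a) t).card : ENNReal) * (t : ENNReal)⁻¹
              + ((t + 1) * (t : ENNReal)⁻¹) * evN N := by ring
          _ ≤ _ := by
              gcongr
              · exact hVt t
              · have h1 : ((t : ENNReal) + 1) ≤ 2 * t := by
                  exact_mod_cast (by omega : t + 1 ≤ 2 * t)
                calc ((t : ENNReal) + 1) * (t : ENNReal)⁻¹ ≤ 2 * t * (t : ENNReal)⁻¹ := by gcongr
                  _ = 2 := by rw [mul_assoc, ENNReal.mul_inv_cancel ht0 (by simp), mul_one]
    _ ≤ _ := by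
        rw [Finset.sum_add_distrib]
        gcongr
        rw [Finset.sum_const, nsmul_eq_mul, Nat.card_Icc]
        have : ((L + 1 - 2 : ℕ) : ENNReal) ≤ L := by exact_mod_cast (by omega : L + 1 - 2 ≤ L)
        calc ((L + 1 - 2 : ℕ) : ENNReal) * (2 * evN N) ≤ L * (2 * evN N) := by gcongr
          _ = _ := by ring

open Classical in
theorem V_upper {n : ℕ} {δ : ℝ} (hδ : 0 ≤ δ) {L : ℕ} (hL : 2 * L < n) (C : Fin n × Fin n → ℝ) :
    (∑ a : Fin n, ∑ b : Fin n, ∑ t ∈ Finset.Icc 2 L,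
        (if VS (NearSet δ (PhiSw a b C)) a b t then ((t : ENNReal))⁻¹ else 0)) ≤
      n + 2 * (n + evN (NearSet δ C)) := by
  set N := NearSet δ C with hN
  have step : ∀ a b : Fin n, ∑ t ∈ Finset.Icc 2 L,
        (if VS (NearSet δ (PhiSw a b C)) a b t then ((t : ENNReal))⁻¹ else 0) ≤
      (∑ t ∈ Finset.Icc 2 L, (if YS N L a t then ((t : ENNReal))⁻¹ else 0)) +
      ((if UseS N a b then 1 else 0) + (if UseS N b a then 1 else 0)) := by
    intro a b
    by_cases hU : UseS N a b ∨ UseS N b a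
    · have h1 : (1 : ENNReal) ≤ ((if UseS N a b then 1 else 0) + (if UseS N b a then 1 else 0)) := by
        rcases hU with h | h <;> simp [h]
      refine le_trans ?_ (h1.trans le_add_self)
      by_cases hex : ∃ t ∈ Finset.Icc 2 L, VS (NearSet δ (PhiSw a b C)) a b t
      · obtain ⟨t, ht, hV⟩ := hex
        rw [Finset.sum_eq_single_of_mem t ht]
        · rw [if_pos hV, ENNReal.inv_le_one]
          exact_mod_cast (by have := (Finset.mem_Icc.1 ht).1; omega : 1 ≤ t)
        · intro t' ht' hne
          rw [if_neg]
          intro hV'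
          rw [Finset.mem_Icc] at ht ht'
          exact hne (VS_unique (by omega) (by omega) hV' hV)
      · push Not at hex
        rw [Finset.sum_eq_zero]
        · exact zero_le_one
        · intro t ht; rw [if_neg (hex t ht)]
    · push Not at hU
      refine le_trans ?_ le_self_add
      refine Finset.sum_le_sum fun t ht => ?_
      rw [Finset.mem_Icc] at ht
      split_ifs with h1 h2
      · exact le_rfl
      · exfalso
        rcases V_or hδ ht.1 ht.2 hL C h1 with h | h | h
        · exact hU.1 h
        · exact hU.2 h
        · exact h2 h
      · exact zero_le
      · exact le_rfl
  have hUse : ∑ a : Fin n, ∑ b : Fin n, (if UseS N a b then (1 : ENNReal) else 0) ≤ n + evN N := by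
    rw [← Finset.sum_product', ← Finset.sum_filter, Finset.sum_const, nsmul_eq_mul, mul_one]
    have := use_card N
    exact_mod_cast this
  calc _ ≤ ∑ a : Fin n, ∑ b : Fin n, ((∑ t ∈ Finset.Icc 2 L,
        (if YS N L a t then ((t : ENNReal))⁻¹ else 0)) +
      ((if UseS N a b then 1 else 0) + (if UseS N b a then 1 else 0))) :=
        Finset.sum_le_sum fun a _ => Finset.sum_le_sum fun b _ => step a b
    _ = n * (∑ a : Fin n, ∑ t ∈ Finset.Icc 2 L, (if YS N L a t then ((t : ENNReal))⁻¹ else 0))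
        + (∑ a : Fin n, ∑ b : Fin n, (if UseS N a b then (1 : ENNReal) else 0)
        + ∑ a : Fin n, ∑ b : Fin n, (if UseS N a b then (1 : ENNReal) else 0)) := by
        simp only [Finset.sum_add_distrib, Finset.sum_const, Finset.card_univ, Fintype.card_fin,
          nsmul_eq_mul, ← Finset.mul_sum]
        congr 2
        rw [Finset.sum_comm]
    _ ≤ n * 1 + ((n + evN N) + (n + evN N)) := by
        gcongr
        exact YS_sum N L
    _ = _ := by ring

open Classical in
theorem evN_lintegral {n : ℕ} (δ : ℝ) :
    ∫⁻ C, (evN (NearSet δ C) : ENNReal) ∂(costMeasure n) ≤ (n : ENNReal) ^ 2 * ENNReal.ofReal (2 * δ) := by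
  have h : ∀ C : Fin n × Fin n → ℝ, (evN (NearSet δ C) : ENNReal) =
      ∑ q : Fin n × Fin n, Set.indicator {C | EvS (NearSet δ C) q.1 q.2} 1 C := by
    intro C
    unfold evN
    rw [Finset.card_filter]
    push_cast
    refine Finset.sum_congr rfl fun q _ => ?_
    simp [Set.indicator]
  simp_rw [h]
  rw [lintegral_finsetSum _ (fun q _ => measurable_one.indicator
    (measurableSet_nearSet δ fun N => EvS N q.1 q.2))]
  calc _ ≤ ∑ q : Fin n × Fin n, ENNReal.ofReal (2 * δ) := by
        refine Finset.sum_le_sum fun q _ => ?_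
        rw [lintegral_indicator_one (measurableSet_nearSet δ fun N => EvS N q.1 q.2)]
        exact ev_measure δ q.1 q.2
    _ = _ := by
        rw [Finset.sum_const, nsmul_eq_mul, Finset.card_univ, Fintype.card_prod, Fintype.card_fin]
        push_cast; ring

theorem measurable_evN {n : ℕ} (δ : ℝ) :
    Measurable (fun C : Fin n × Fin n → ℝ => (evN (NearSet δ C) : ENNReal)) := by
  intro s _
  exact measurableSet_nearSet δ fun N => (evN N : ENNReal) ∈ s

/-- The first bad event. -/
def Bad1 (n : ℕ) (δ : ℝ) : Set (Fin n × Fin n → ℝ) :=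
  {C | ∃ τ ∈ NearSet δ C, IsCyclicPerm τ}

open Classical in
theorem bad1_bound {n : ℕ} {δ : ℝ} (hδ : 0 ≤ δ) {L : ℕ} (hL : 2 * L < n) :
    costMeasure n (Bad1 n δ) * ((n : ENNReal) * ∑ t ∈ Finset.Icc 2 L, ((t : ENNReal))⁻¹) ≤
      3 * n + (2 + 2 * L) * ((n : ENNReal) ^ 2 * ENNReal.ofReal (2 * δ)) := by
  have hB : MeasurableSet (Bad1 n δ) :=
    measurableSet_nearSet δ fun N => ∃ τ ∈ N, IsCyclicPerm τ
  set W : ENNReal := (n : ENNReal) * ∑ t ∈ Finset.Icc 2 L, ((t : ENNReal))⁻¹ with hW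
  have hVm : ∀ a b t, MeasurableSet {C : Fin n × Fin n → ℝ | VS (NearSet δ C) a b t} :=
    fun a b t => measurableSet_nearSet δ fun N => VS N a b t
  have hFm : ∀ a b : Fin n, Measurable (fun C : Fin n × Fin n → ℝ => ∑ t ∈ Finset.Icc 2 L,
        (if VS (NearSet δ C) a b t then ((t : ENNReal))⁻¹ else 0)) := by
    intro a b
    refine Finset.measurable_sum _ fun t _ => ?_
    exact Measurable.ite (hVm a b t) measurable_const measurable_const
  calc costMeasure n (Bad1 n δ) * W = ∫⁻ C, (Bad1 n δ).indicator (fun _ => W) C ∂(costMeasure n) := by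
        rw [lintegral_indicator_const hB, mul_comm]
    _ ≤ ∫⁻ C, ((∑ a : Fin n, ∑ b : Fin n, ∑ t ∈ Finset.Icc 2 L,
        (if VS (NearSet δ C) a b t then ((t : ENNReal))⁻¹ else 0))
          + 2 * L * evN (NearSet δ C)) ∂(costMeasure n) := by
        refine lintegral_mono fun C => ?_
        by_cases h : C ∈ Bad1 n δ
        · rw [Set.indicator_of_mem h]
          obtain ⟨τ, hτN, hτ⟩ := h
          exact V_lower _ L τ hτN hτ
        · rw [Set.indicator_of_notMem h]; exact zero_le
    _ = (∑ a : Fin n, ∑ b : Fin n, ∫⁻ C, ∑ t ∈ Finset.Icc 2 L,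
        (if VS (NearSet δ C) a b t then ((t : ENNReal))⁻¹ else 0) ∂(costMeasure n))
          + 2 * L * ∫⁻ C, (evN (NearSet δ C) : ENNReal) ∂(costMeasure n) := by
        rw [lintegral_add_right _ ((measurable_evN δ).const_mul _),
          lintegral_const_mul _ (measurable_evN δ)]
        congr 1
        rw [lintegral_finsetSum _ fun a _ => Finset.measurable_sum _ fun b _ => hFm a b]
        refine Finset.sum_congr rfl fun a _ => ?_
        rw [lintegral_finsetSum _ fun b _ => hFm a b]
    _ = (∑ a : Fin n, ∑ b : Fin n, ∫⁻ C, ∑ t ∈ Finset.Icc 2 L,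
        (if VS (NearSet δ (PhiSw a b C)) a b t then ((t : ENNReal))⁻¹ else 0) ∂(costMeasure n))
          + 2 * L * ∫⁻ C, (evN (NearSet δ C) : ENNReal) ∂(costMeasure n) := by
        congr 1
        refine Finset.sum_congr rfl fun a _ => Finset.sum_congr rfl fun b _ => ?_
        rw [← (PhiSw_mp a b).lintegral_comp (hFm a b)]
    _ = (∫⁻ C, ∑ a : Fin n, ∑ b : Fin n, ∑ t ∈ Finset.Icc 2 L,
        (if VS (NearSet δ (PhiSw a b C)) a b t then ((t : ENNReal))⁻¹ else 0) ∂(costMeasure n))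
          + 2 * L * ∫⁻ C, (evN (NearSet δ C) : ENNReal) ∂(costMeasure n) := by
        congr 1
        have hFm' : ∀ a b : Fin n, Measurable (fun C : Fin n × Fin n → ℝ => ∑ t ∈ Finset.Icc 2 L,
            (if VS (NearSet δ (PhiSw a b C)) a b t then ((t : ENNReal))⁻¹ else 0)) :=
          fun a b => (hFm a b).comp (PhiSw_mp a b).measurable
        symm
        rw [lintegral_finsetSum _ fun a _ => Finset.measurable_sum _ fun b _ => hFm' a b]
        refine Finset.sum_congr rfl fun a _ => ?_
        rw [lintegral_finsetSum _ fun b _ => hFm' a b]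
    _ ≤ (∫⁻ C, ((n : ENNReal) + 2 * (n + evN (NearSet δ C))) ∂(costMeasure n))
          + 2 * L * ∫⁻ C, (evN (NearSet δ C) : ENNReal) ∂(costMeasure n) := by
        gcongr with C
        exact V_upper hδ hL C
    _ = 3 * n + (2 + 2 * L) * ∫⁻ C, (evN (NearSet δ C) : ENNReal) ∂(costMeasure n) := by
        rw [lintegral_add_left measurable_const, lintegral_const_mul _ (by
          exact measurable_const.add (measurable_evN δ)), lintegral_add_left measurable_const]
        simp only [lintegral_const, measure_univ, mul_one]
        ring
    _ ≤ _ := by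
        gcongr
        exact evN_lintegral δ


/-- Rotation along a family of disjoint paths of the map `f`. -/
theorem exists_rotation {ι κ : Type*} [Fintype ι] [DecidableEq ι] (f : ι → ι) (P : κ → ι)
    (T : κ → ℕ)
    (hinj : ∀ c, ∀ s ≤ T c, ∀ s' ≤ T c, f^[s] (P c) = f^[s'] (P c) → s = s')
    (hdis : ∀ c c', c ≠ c' → ∀ s ≤ T c, ∀ s' ≤ T c', f^[s] (P c) ≠ f^[s'] (P c'))
    (A : Finset κ) :
    ∃ θ : Equiv.Perm ι, (∀ c ∈ A, ∀ s < T c, θ (f^[s] (P c)) = f^[s+1] (P c)) ∧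
      (∀ c ∈ A, θ (f^[T c] (P c)) = P c) ∧
      (∀ v, (∀ c ∈ A, ∀ s ≤ T c, v ≠ f^[s] (P c)) → θ v = v) := by
  classical
  have huniq : ∀ c c' s s', s ≤ T c → s' ≤ T c' → f^[s] (P c) = f^[s'] (P c') → c = c' ∧ s = s' := by
    intro c c' s s' hs hs' h
    have hc : c = c' := by
      by_contra hne
      exact hdis c c' hne s hs s' hs' h
    subst hc
    exact ⟨rfl, hinj c s hs s' hs' h⟩
  let θ0 : ι → ι := fun v =>
    if h : ∃ c ∈ A, v = f^[T c] (P c) then P h.choose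
    else if ∃ c ∈ A, ∃ s ≤ T c, v = f^[s] (P c) then f v else v
  have h1 : ∀ c ∈ A, ∀ s < T c, θ0 (f^[s] (P c)) = f^[s+1] (P c) := by
    intro c hc s hs
    have hno : ¬ ∃ c' ∈ A, f^[s] (P c) = f^[T c'] (P c') := by
      rintro ⟨c', _, h⟩
      obtain ⟨rfl, h2⟩ := huniq c c' s (T c') hs.le le_rfl h
      omega
    have hyes : ∃ c' ∈ A, ∃ s' ≤ T c', f^[s] (P c) = f^[s'] (P c') := ⟨c, hc, s, hs.le, rfl⟩
    simp only [θ0]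
    rw [dif_neg hno, if_pos hyes, Function.iterate_succ_apply']
  have h2 : ∀ c ∈ A, θ0 (f^[T c] (P c)) = P c := by
    intro c hc
    have hyes : ∃ c' ∈ A, f^[T c] (P c) = f^[T c'] (P c') := ⟨c, hc, rfl⟩
    simp only [θ0]
    rw [dif_pos hyes]
    have := huniq c _ (T c) _ le_rfl le_rfl hyes.choose_spec.2
    rw [← this.1]
  have h3 : ∀ v, (∀ c ∈ A, ∀ s ≤ T c, v ≠ f^[s] (P c)) → θ0 v = v := by
    intro v hv
    simp only [θ0]
    rw [dif_neg, if_neg]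
    · rintro ⟨c, hc, s, hs, h⟩; exact hv c hc s hs h
    · rintro ⟨c, hc, h⟩; exact hv c hc _ le_rfl h
  have hsurj : Function.Surjective θ0 := by
    intro u
    by_cases hu : ∀ c ∈ A, ∀ s ≤ T c, u ≠ f^[s] (P c)
    · exact ⟨u, h3 u hu⟩
    · push Not at hu
      obtain ⟨c, hc, s, hs, rfl⟩ := hu
      cases s with
      | zero => exact ⟨_, h2 c hc⟩
      | succ k => exact ⟨_, h1 c hc k (by omega)⟩
  refine ⟨Equiv.ofBijective θ0 (Finite.surjective_iff_bijective.1 hsurj), h1, h2, h3⟩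

theorem rotation_sum {ι κ : Type*} [Fintype ι] [DecidableEq ι] (f : ι → ι) (P : κ → ι)
    (T : κ → ℕ)
    (hinj : ∀ c, ∀ s ≤ T c, ∀ s' ≤ T c, f^[s] (P c) = f^[s'] (P c) → s = s')
    (hdis : ∀ c c', c ≠ c' → ∀ s ≤ T c, ∀ s' ≤ T c', f^[s] (P c) ≠ f^[s'] (P c'))
    (A : Finset κ) (θ : Equiv.Perm ι)
    (h1 : ∀ c ∈ A, ∀ s < T c, θ (f^[s] (P c)) = f^[s+1] (P c))
    (h2 : ∀ c ∈ A, θ (f^[T c] (P c)) = P c)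
    (h3 : ∀ v, (∀ c ∈ A, ∀ s ≤ T c, v ≠ f^[s] (P c)) → θ v = v)
    (w : ι → ι → ℝ) (hw : ∀ v, w v v = 0) (hf : ∀ v, w v (f v) = 0) :
    ∑ v, w v (θ v) = ∑ c ∈ A, w (f^[T c] (P c)) (P c) := by
  classical
  have huniq : ∀ c c' s s', s ≤ T c → s' ≤ T c' → f^[s] (P c) = f^[s'] (P c') → c = c' ∧ s = s' := by
    intro c c' s s' hs hs' h
    have hc : c = c' := by
      by_contra hne
      exact hdis c c' hne s hs s' hs' h
    subst hc
    exact ⟨rfl, hinj c s hs s' hs' h⟩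
  have hv : ∀ v, w v (θ v) = ∑ c ∈ A, if v = f^[T c] (P c) then w v (P c) else 0 := by
    intro v
    by_cases hu : ∀ c ∈ A, ∀ s ≤ T c, v ≠ f^[s] (P c)
    · rw [h3 v hu, hw, Finset.sum_eq_zero]
      intro c hc
      rw [if_neg (hu c hc _ le_rfl)]
    · push Not at hu
      obtain ⟨c, hc, s, hs, rfl⟩ := hu
      by_cases hsT : s < T c
      · rw [h1 c hc s hsT, Function.iterate_succ_apply', hf, Finset.sum_eq_zero]
        intro c' hc'
        rw [if_neg]
        intro h
        obtain ⟨rfl, h2⟩ := huniq c c' s (T c') hs le_rfl h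
        omega
      · obtain rfl : s = T c := by omega
        rw [h2 c hc, Finset.sum_eq_single_of_mem c hc, if_pos rfl]
        intro c' hc' hne
        rw [if_neg]
        intro h
        exact hne (huniq c c' _ (T c') le_rfl le_rfl h).1.symm
  simp_rw [hv]
  rw [Finset.sum_comm]
  refine Finset.sum_congr rfl fun c _ => ?_
  rw [Finset.sum_ite_eq' univ, if_pos (Finset.mem_univ _)]

/-- `f` is a tree map rooted at `ρ`. -/
def IsTreeMap {ι : Type*} (ρ : ι) (f : ι → ι) : Prop :=
  f ρ = ρ ∧ ∀ i, ∃ t : ℕ, f^[t] i = ρ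

theorem tree_iter_root {ι : Type*} {ρ : ι} {f : ι → ι} (hf : f ρ = ρ) (t : ℕ) :
    f^[t] ρ = ρ := Function.iterate_fixed hf t

/-- paths in a tree before reaching the root are injective -/
theorem tree_inj {ι : Type*} {ρ : ι} {f : ι → ι} (hf : IsTreeMap ρ f) (p : ι) (t : ℕ)
    (h : ∀ s ≤ t, f^[s] p ≠ ρ) : ∀ s ≤ t + 1, ∀ s' ≤ t + 1, f^[s] p = f^[s'] p → s = s' := by
  intro s hs s' hs' heq
  wlog hle : s ≤ s' generalizing s s'
  · exact (this s' hs' s hs heq.symm (by omega)).symm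
  by_contra hne
  have hlt : s < s' := by omega
  obtain ⟨r, hr⟩ : ∃ r, s' = r + s := ⟨s' - s, by omega⟩
  subst hr
  rw [Function.iterate_add_apply] at heq
  -- periodic point
  set v := f^[s] p with hv
  have hper : ∀ k, f^[k * r] v = v := by
    intro k
    induction k with
    | zero => simp
    | succ k ih => rw [Nat.add_mul, one_mul, Function.iterate_add_apply, ← heq, ih]
  obtain ⟨T, hT⟩ := hf.2 v
  have h1 := hper T
  have h2 : f^[T * r] v = ρ := by
    obtain ⟨q, hq⟩ : ∃ q, T * r = q + T :=
      ⟨T * r - T, by have : T ≤ T * r := Nat.le_mul_of_pos_right _ (by omega)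
                     omega⟩
    rw [hq, Function.iterate_add_apply, hT, tree_iter_root hf.1]
  apply h s (by omega)
  rw [← hv, ← h1, h2]

theorem exists_dist {ι : Type*} [Fintype ι] [DecidableEq ι] {ρ : ι} {f : ι → ι}
    (hf : IsTreeMap ρ f) (a : ι → ι → ℝ) (x0 : ℝ) :
    ∃ d : ι → ℝ, d ρ = x0 ∧ ∀ i, i ≠ ρ → d i = a i (f i) + d (f i) := by
  classical
  choose τ hτ using hf.2
  let T := ∑ i, τ i
  have hT : ∀ i, f^[T] i = ρ := by
    intro i
    have hle : τ i ≤ T := Finset.single_le_sum (f := τ) (fun _ _ => Nat.zero_le _) (Finset.mem_univ i)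
    obtain ⟨q, hq⟩ : ∃ q, T = q + τ i := ⟨T - τ i, by omega⟩
    rw [hq, Function.iterate_add_apply, hτ, tree_iter_root hf.1]
  let b : ι → ℝ := fun i => if i = ρ then 0 else a i (f i)
  refine ⟨fun i => x0 + ∑ s ∈ Finset.range T, b (f^[s] i), ?_, ?_⟩
  · simp only [tree_iter_root hf.1]
    simp [b]
  · intro i hi
    have h1 := Finset.sum_range_succ (fun s => b (f^[s] i)) T
    have h2 := Finset.sum_range_succ' (fun s => b (f^[s] i)) T
    rw [h1] at h2
    simp only [hT, Function.iterate_succ_apply, Function.iterate_zero, id] at h2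
    have h3 : b ρ = 0 := by simp [b]
    have h4 : b i = a i (f i) := by simp [b, hi]
    rw [h3, h4] at h2
    linarith

theorem exists_sp_tree {ι : Type*} [Fintype ι] [DecidableEq ι] (ρ : ι) (K : ι → ι → Prop)
    (hK : ∀ i, ¬ K i i) (a : ι → ι → ℝ) (haa : ∀ i, a i i = 0) (x0 : ℝ)
    (hneg : ∀ θ : Equiv.Perm ι, (∀ v, θ v = v ∨ K v (θ v)) → 0 ≤ ∑ v, a v (θ v))
    (hex : ∃ f, IsTreeMap ρ f ∧ ∀ i, i ≠ ρ → K i (f i)) :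
    ∃ (f : ι → ι) (d : ι → ℝ), IsTreeMap ρ f ∧ (∀ i, i ≠ ρ → K i (f i)) ∧ d ρ = x0 ∧
      (∀ i, i ≠ ρ → d i = a i (f i) + d (f i)) ∧ ∀ i k, K i k → d i ≤ a i k + d k := by
  classical
  have hD : ∀ f : ι → ι, ∃ d : ι → ℝ, IsTreeMap ρ f →
      d ρ = x0 ∧ ∀ i, i ≠ ρ → d i = a i (f i) + d (f i) := by
    intro f
    by_cases hf : IsTreeMap ρ f
    · obtain ⟨d, hd⟩ := exists_dist hf a x0
      exact ⟨d, fun _ => hd⟩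
    · exact ⟨0, fun h => absurd h hf⟩
  choose D hD using hD
  obtain ⟨f0, hf0⟩ := hex
  obtain ⟨f, hfm, hmin⟩ := Finset.exists_min_image
    (univ.filter fun f : ι → ι => IsTreeMap ρ f ∧ ∀ i, i ≠ ρ → K i (f i))
    (fun f => ∑ i, D f i) ⟨f0, by simpa using hf0⟩
  simp only [Finset.mem_filter, Finset.mem_univ, true_and] at hfm hmin
  obtain ⟨hft, hfK⟩ := hfm
  obtain ⟨hd0, hd⟩ := hD f hft
  refine ⟨f, D f, hft, hfK, hd0, hd, ?_⟩
  by_contra hcon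
  push Not at hcon
  obtain ⟨i, k, hik, hlt⟩ := hcon
  by_cases hpath : ∃ t, f^[t] k = i
  · -- negative cycle
    let t := Nat.find hpath
    have ht : f^[t] k = i := Nat.find_spec hpath
    have htmin : ∀ s < t, f^[s] k ≠ i := fun s hs => Nat.find_min hpath hs
    have hnr : ∀ s < t, f^[s] k ≠ ρ := by
      intro s hs h
      have : f^[t] k = ρ := by
        obtain ⟨q, hq⟩ : ∃ q, t = q + s := ⟨t - s, by omega⟩
        rw [hq, Function.iterate_add_apply, h, tree_iter_root hft.1]
      exact htmin s hs (by rw [h, ← this, ht])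
    have hinj : ∀ s ≤ t, ∀ s' ≤ t, f^[s] k = f^[s'] k → s = s' := by
      by_cases h0 : t = 0
      · intro s hs s' hs' _; omega
      · intro s hs s' hs' h
        exact tree_inj hft k (t-1) (fun r hr => hnr r (by omega)) s (by omega) s' (by omega) h
    obtain ⟨θ, h1, h2, h3⟩ := exists_rotation f (fun _ : Unit => k) (fun _ => t)
      (fun _ => hinj) (fun c c' hc => absurd (Subsingleton.elim c c') hc) univ
    have hsum := rotation_sum f (fun _ : Unit => k) (fun _ => t)
      (fun _ => hinj) (fun c c' hc => absurd (Subsingleton.elim c c') hc) univ θ h1 h2 h3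
      (fun v u => if u = v then 0 else a v u + D f u - D f v) (by simp) (by
        intro v
        by_cases hv : v = ρ
        · subst hv; simp [hft.1]
        · split_ifs
          · rfl
          · rw [hd v hv]; ring)
    have hki : k ≠ i := fun h => hK i (by rw [← h] at hik ⊢; exact hik)
    simp only [Finset.univ_unique, Finset.sum_singleton, ht, if_neg hki] at hsum
    have hθ : ∀ v, θ v = v ∨ K v (θ v) := by
      intro v
      by_cases hu : ∀ c ∈ (univ : Finset Unit), ∀ s ≤ t, v ≠ f^[s] k
      · exact Or.inl (h3 v hu)
      · push Not at hu
        obtain ⟨c, hc, s, hs, rfl⟩ := hu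
        right
        by_cases hst : s < t
        · rw [h1 c hc s hst, Function.iterate_succ_apply']
          exact hfK _ (hnr s hst)
        · obtain rfl : s = t := by omega
          have := h2 c hc
          simp only [ht] at this ⊢
          rw [this]; exact hik
    have h5 := hneg θ hθ
    have h6 : ∑ v, (if θ v = v then 0 else a v (θ v) + D f (θ v) - D f v) = ∑ v, a v (θ v) := by
      have h7 : ∀ v, (if θ v = v then 0 else a v (θ v) + D f (θ v) - D f v)
          = a v (θ v) + (D f (θ v) - D f v) := by
        intro v
        split_ifs with h
        · rw [h, haa]; ring
        · ring
      simp_rw [h7]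
      rw [Finset.sum_add_distrib, Finset.sum_sub_distrib, Equiv.sum_comp θ (D f)]
      ring
    rw [h6] at hsum
    linarith
  · push Not at hpath
    have hiρ : i ≠ ρ := by
      rintro rfl
      obtain ⟨t, ht⟩ := hft.2 k
      exact hpath t ht
    let f' := Function.update f i k
    have hf'ρ : f' ρ = ρ := by
      simp only [f']
      rw [Function.update_of_ne (Ne.symm hiρ)]; exact hft.1
    have hk1 : ∀ t, f'^[t] k = f^[t] k := by
      intro t
      induction t with
      | zero => rfl
      | succ t ih =>
        rw [Function.iterate_succ_apply', Function.iterate_succ_apply', ih]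
        simp only [f']
        rw [Function.update_of_ne (hpath t)]
    have hreach : ∀ t v, f^[t] v = ρ → ∃ t', f'^[t'] v = ρ := by
      intro t
      induction t with
      | zero => intro v hv; exact ⟨0, hv⟩
      | succ t ih =>
        intro v hv
        by_cases hvi : v = i
        · obtain ⟨T, hT⟩ := hft.2 k
          refine ⟨T + 1, ?_⟩
          rw [Function.iterate_succ_apply]
          have : f' v = k := by simp only [f', hvi, Function.update_self]
          rw [this, hk1, hT]
        · have : f' v = f v := by simp only [f']; rw [Function.update_of_ne hvi]
          obtain ⟨t', ht'⟩ := ih (f v) hv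
          refine ⟨t' + 1, ?_⟩
          rw [Function.iterate_succ_apply, this, ht']
    have hf't : IsTreeMap ρ f' := by
      refine ⟨hf'ρ, fun v => ?_⟩
      obtain ⟨t, ht⟩ := hft.2 v
      exact hreach t v ht
    have hf'K : ∀ v, v ≠ ρ → K v (f' v) := by
      intro v hv
      by_cases hvi : v = i
      · subst hvi; simp only [f', Function.update_self]; exact hik
      · simp only [f']; rw [Function.update_of_ne hvi]; exact hfK v hv
    obtain ⟨hd0', hd'⟩ := hD f' hf't
    have hle : ∀ t v, f'^[t] v = ρ → D f' v ≤ D f v := by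
      intro t
      induction t with
      | zero => intro v hv; simp only [Function.iterate_zero, id] at hv; rw [hv, hd0', hd0]
      | succ t ih =>
        intro v hv
        by_cases hvρ : v = ρ
        · rw [hvρ, hd0', hd0]
        have h1 := ih (f' v) hv
        rw [hd' v hvρ]
        by_cases hvi : v = i
        · subst hvi
          have : f' v = k := by simp only [f', Function.update_self]
          rw [this] at h1 ⊢
          linarith
        · have : f' v = f v := by simp only [f']; rw [Function.update_of_ne hvi]
          rw [this] at h1 ⊢
          rw [hd v hvρ]
          linarith
    have hall : ∀ v, D f' v ≤ D f v := by
      intro v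
      obtain ⟨t, ht⟩ := hf't.2 v
      exact hle t v ht
    have hstrict : D f' i < D f i := by
      rw [hd' i hiρ]
      have : f' i = k := by simp only [f', Function.update_self]
      rw [this]
      have := hall k
      linarith
    have := hmin f' ⟨hf't, hf'K⟩
    have h9 := Finset.sum_lt_sum (fun v _ => hall v) ⟨i, Finset.mem_univ i, hstrict⟩
    linarith


/-- allowed arcs relative to `π` -/
def Al {n : ℕ} (π : Equiv.Perm (Fin n)) (i k : Fin n) : Prop := k ≠ i ∧ π k ≠ i

theorem der_mul {n : ℕ} {π : Equiv.Perm (Fin n)} (hπ : IsDerangement π) (θ : Equiv.Perm (Fin n))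
    (h : ∀ v, θ v = v ∨ Al π v (θ v)) : IsDerangement (π * θ) := by
  intro v
  rw [Equiv.Perm.mul_apply]
  rcases h v with h | h
  · rw [h]; exact hπ v
  · exact h.2

theorem exists_start_tree {n : ℕ} (hn : 3 ≤ n) (ρ : Fin n) {π : Equiv.Perm (Fin n)}
    (hπ : IsDerangement π) : ∃ f, IsTreeMap ρ f ∧ ∀ i, i ≠ ρ → Al π i (f i) := by
  obtain ⟨j, hj1, hj2⟩ : ∃ j : Fin n, j ≠ ρ ∧ j ≠ π ρ := by
    have : (({ρ, π ρ} : Finset (Fin n))ᶜ).Nonempty := by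
      rw [← Finset.card_pos, Finset.card_compl, Fintype.card_fin]
      have : ({ρ, π ρ} : Finset (Fin n)).card ≤ 2 := Finset.card_le_two
      omega
    obtain ⟨j, hj⟩ := this
    simp only [Finset.mem_compl, Finset.mem_insert, Finset.mem_singleton, not_or] at hj
    exact ⟨j, hj.1, hj.2⟩
  let f : Fin n → Fin n := fun i => if i = π ρ then j else ρ
  have hfj : f j = ρ := by simp [f, hj2]
  refine ⟨f, ⟨?_, fun i => ?_⟩, fun i hi => ?_⟩
  · simp [f, (hπ ρ).symm]
  · by_cases h : i = π ρ
    · refine ⟨2, ?_⟩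
      have : f i = j := by simp [f, h]
      simp [this, hfj]
    · refine ⟨1, ?_⟩
      simp [f, h]
  · by_cases h : i = π ρ
    · have h1 : f i = j := by simp [f, h]
      rw [h1]
      refine ⟨by rw [h]; exact hj2, fun h2 => ?_⟩
      rw [h] at h2
      exact hj1 (π.injective h2)
    · have h1 : f i = ρ := by simp [f, h]
      rw [h1]
      exact ⟨hi.symm, fun h2 => h h2.symm⟩

theorem lemmaE {n : ℕ} (hn : 3 ≤ n) (ρ : Fin n) (C : Fin n × Fin n → ℝ)
    {π : Equiv.Perm (Fin n)} (hπ : IsDerangement π)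
    (hopt : ∀ π', IsDerangement π' → permCost C π ≤ permCost C π') :
    ∃ (f : Fin n → Fin n) (d : Fin n → ℝ), IsTreeMap ρ f ∧ (∀ i, i ≠ ρ → Al π i (f i)) ∧
      d ρ = C (ρ, π ρ) ∧ (∀ i, i ≠ ρ → C (i, π i) + d i = C (i, π (f i)) + d (f i)) ∧
      ∀ i k, Al π i k → C (i, π i) + d i ≤ C (i, π k) + d k := by
  obtain ⟨f, d, h1, h2, h3, h4, h5⟩ := exists_sp_tree ρ (Al π) (fun i h => h.1 rfl)
    (fun i k => C (i, π k) - C (i, π i)) (fun i => sub_self _) (C (ρ, π ρ)) (by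
      intro θ hθ
      have := hopt _ (der_mul hπ θ hθ)
      unfold permCost at this
      simp only [Equiv.Perm.mul_apply] at this
      rw [Finset.sum_sub_distrib]
      linarith) (exists_start_tree hn ρ hπ)
  refine ⟨f, d, h1, h2, h3, fun i hi => ?_, fun i k hik => ?_⟩
  · have := h4 i hi; linarith
  · have := h5 i k hik; linarith

/-- a path `p, f p, …, f^[t] p` avoiding the root that can be closed cheaply -/
def Succ {n : ℕ} (ρ : Fin n) (C : Fin n × Fin n → ℝ) (π : Equiv.Perm (Fin n)) (f : Fin n → Fin n)
    (d : Fin n → ℝ) (δ' : ℝ) (p : Fin n) (t : ℕ) : Prop :=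
  1 ≤ t ∧ (∀ s ≤ t, f^[s] p ≠ ρ) ∧ π p ≠ f^[t] p ∧
    C (f^[t] p, π p) + d p ≤ C (f^[t] p, π (f^[t] p)) + d (f^[t] p) + δ'

theorem lemmaG {n : ℕ} {ρ : Fin n} {C : Fin n × Fin n → ℝ}
    {π : Equiv.Perm (Fin n)} (hπ : IsDerangement π)
    (hopt : ∀ π', IsDerangement π' → permCost C π ≤ permCost C π')
    {f : Fin n → Fin n} {d : Fin n → ℝ} (hf : IsTreeMap ρ f) (hfA : ∀ i, i ≠ ρ → Al π i (f i))
    (hfe : ∀ i, i ≠ ρ → C (i, π i) + d i = C (i, π (f i)) + d (f i))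
    {δ' : ℝ} (hδ : 0 ≤ δ') {m : ℕ} (P : Fin m → Fin n) (T : Fin m → ℕ)
    (hs : ∀ c, Succ ρ C π f d δ' (P c) (T c))
    (hdis : ∀ c c', c ≠ c' → ∀ s ≤ T c, ∀ s' ≤ T c', f^[s] (P c) ≠ f^[s'] (P c')) :
    2 ^ m ≤ (NearSet (m * δ') C).ncard := by
  classical
  have hinj : ∀ c, ∀ s ≤ T c, ∀ s' ≤ T c, f^[s] (P c) = f^[s'] (P c) → s = s' := by
    intro c s h1 s' h2
    exact tree_inj hf (P c) (T c) (hs c).2.1 s (by omega) s' (by omega)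
  choose θ h1 h2 h3 using fun A => exists_rotation f P T hinj hdis A
  have hne : ∀ c, P c ≠ f^[T c] (P c) := by
    intro c h
    have := hinj c 0 (by omega) (T c) le_rfl h
    have := (hs c).1
    omega
  have hmem : ∀ A : Finset (Fin m), π * θ A ∈ NearSet (m * δ') C := by
    intro A
    have hθ : ∀ v, θ A v = v ∨ Al π v (θ A v) := by
      intro v
      by_cases hu : ∀ c ∈ A, ∀ s ≤ T c, v ≠ f^[s] (P c)
      · exact Or.inl (h3 A v hu)
      · push Not at hu
        obtain ⟨c, hc, s, hsT, rfl⟩ := hu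
        right
        by_cases hst : s < T c
        · rw [h1 A c hc s hst, Function.iterate_succ_apply']
          exact hfA _ ((hs c).2.1 s hsT)
        · obtain rfl : s = T c := by omega
          rw [h2 A c hc]
          exact ⟨hne c, (hs c).2.2.1⟩
    refine ⟨der_mul hπ _ hθ, fun π' hπ' => ?_⟩
    have hsum := rotation_sum f P T hinj hdis A (θ A) (h1 A) (h2 A) (h3 A)
      (fun v u => if v = ρ ∧ u = ρ then 0 else C (v, π u) + d u - C (v, π v) - d v)
      (by intro v; split_ifs
          · rfl
          · ring)
      (by
        intro v
        by_cases hv : v = ρ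
        · subst hv; simp [hf.1]
        · simp only [hv, false_and, if_false]
          rw [← hfe v hv]; ring)
    have hle : ∑ c ∈ A, (fun v u => if v = ρ ∧ u = ρ then 0
        else C (v, π u) + d u - C (v, π v) - d v) (f^[T c] (P c)) (P c) ≤ m * δ' := by
      calc _ ≤ ∑ c ∈ A, δ' := by
            refine Finset.sum_le_sum fun c _ => ?_
            simp only [(hs c).2.1 (T c) le_rfl, false_and, if_false]
            linarith [(hs c).2.2.2]
        _ ≤ _ := by
            rw [Finset.sum_const, nsmul_eq_mul]
            gcongr
            exact (Finset.card_le_univ A).trans (by simp)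
    rw [← hsum] at hle
    have h6 : ∑ v, (fun v u => if v = ρ ∧ u = ρ then 0
        else C (v, π u) + d u - C (v, π v) - d v) v (θ A v) = permCost C (π * θ A) - permCost C π := by
      have h7 : ∀ v, (fun v u => if v = ρ ∧ u = ρ then 0
        else C (v, π u) + d u - C (v, π v) - d v) v (θ A v)
          = (C (v, π (θ A v)) - C (v, π v)) + (d (θ A v) - d v) := by
        intro v
        simp only
        split_ifs with h
        · rw [h.2, h.1]; ring
        · ring
      simp_rw [h7]
      rw [Finset.sum_add_distrib, Finset.sum_sub_distrib, Finset.sum_sub_distrib,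
        Equiv.sum_comp (θ A) d]
      simp [permCost, Equiv.Perm.mul_apply]
    rw [h6] at hle
    linarith [hopt π' hπ']
  have hθinj : Function.Injective (fun A => π * θ A) := by
    intro A B hAB
    have hAB' : θ A = θ B := mul_left_cancel hAB
    have hsub : ∀ A B : Finset (Fin m), θ A = θ B → A ⊆ B := by
      intro A B hAB c hc
      by_contra hcB
      have e1 := h2 A c hc
      have e2 := h3 B (f^[T c] (P c)) (by
        intro c' hc' s' hs'
        exact hdis c c' (by rintro rfl; exact hcB hc') _ le_rfl s' hs')
      rw [hAB, e2] at e1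
      exact hne c e1.symm
    exact Finset.Subset.antisymm (hsub A B hAB') (hsub B A hAB'.symm)
  calc 2 ^ m = (Set.range (fun A : Finset (Fin m) => π * θ A)).ncard := by
        rw [← Set.image_univ, Set.ncard_image_of_injective _ hθinj, Set.ncard_univ]
        simp
    _ ≤ _ := by
        apply Set.ncard_le_ncard
        · rintro _ ⟨A, rfl⟩; exact hmem A
        · exact Set.toFinite _

theorem lemmaMax {n : ℕ} {ρ : Fin n} {C : Fin n × Fin n → ℝ}
    {π : Equiv.Perm (Fin n)} (hπ : IsDerangement π)
    (hopt : ∀ π', IsDerangement π' → permCost C π ≤ permCost C π')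
    {f : Fin n → Fin n} {d : Fin n → ℝ} (hf : IsTreeMap ρ f) (hfA : ∀ i, i ≠ ρ → Al π i (f i))
    (hfe : ∀ i, i ≠ ρ → C (i, π i) + d i = C (i, π (f i)) + d (f i))
    {δ' : ℝ} (hδ : 0 ≤ δ') {m : ℕ} (ℓ : ℕ)
    (hfew : (NearSet (m * δ') C).ncard < 2 ^ m) :
    ∃ G : Fin m → Fin n × Fin (ℓ + 1), ∀ p t, t ≤ ℓ →
      (∀ c, ∀ s ≤ ((G c).2 : ℕ), ∀ s' ≤ t, f^[s] (G c).1 ≠ f^[s'] p) →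
      ¬ Succ ρ C π f d δ' p t := by
  classical
  by_contra hcon
  push Not at hcon
  have step : ∀ k ≤ m, ∃ Q : ℕ → Fin n × Fin (ℓ + 1),
      (∀ c < k, Succ ρ C π f d δ' (Q c).1 (Q c).2) ∧
      (∀ c < k, ∀ c' < k, c ≠ c' → ∀ s ≤ ((Q c).2 : ℕ), ∀ s' ≤ ((Q c').2 : ℕ),
        f^[s] (Q c).1 ≠ f^[s'] (Q c').1) := by
    intro k
    induction k with
    | zero => intro _; exact ⟨fun _ => (ρ, 0), by simp, by simp⟩
    | succ k ih =>
      intro hk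
      obtain ⟨Q, hQ1, hQ2⟩ := ih (by omega)
      obtain ⟨p, t, ht, hd, hsucc⟩ := hcon (fun c => if (c : ℕ) < k then Q c else (ρ, 0))
      have hd' : ∀ c < k, ∀ s ≤ ((Q c).2 : ℕ), ∀ s' ≤ t, f^[s] (Q c).1 ≠ f^[s'] p := by
        intro c hc s hs s' hs'
        have := hd ⟨c, by omega⟩ s (by simpa [hc] using hs) s' hs'
        simpa [hc] using this
      refine ⟨Function.update Q k (p, ⟨t, by omega⟩), ?_, ?_⟩
      · intro c hc
        by_cases hck : c = k
        · subst hck; simpa using hsucc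
        · rw [Function.update_of_ne hck]; exact hQ1 c (by omega)
      · intro c hc c' hc' hne
        by_cases hck : c = k
        · subst hck
          rw [Function.update_self, Function.update_of_ne (Ne.symm hne)]
          intro s hs s' hs' h
          exact hd' c' (by omega) s' hs' s hs h.symm
        · rw [Function.update_of_ne hck]
          by_cases hck' : c' = k
          · subst hck'
            rw [Function.update_self]
            exact hd' c (by omega)
          · rw [Function.update_of_ne hck']
            exact hQ2 c (by omega) c' (by omega) hne
  obtain ⟨Q, hQ1, hQ2⟩ := step m le_rfl
  have := lemmaG hπ hopt hf hfA hfe hδ (fun c : Fin m => (Q c).1) (fun c => ((Q c).2 : ℕ))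
    (fun c => hQ1 c c.2) (fun c c' hne => hQ2 c c.2 c' c'.2 (fun h => hne (Fin.ext h)))
  omega


/-- expectation for a random map with independent values -/
noncomputable def EE {ι : Type*} [Fintype ι] [DecidableEq ι] (p : ι → ι → ENNReal)
    (Φ : (ι → ι) → ENNReal) : ENNReal :=
  ∑ f : ι → ι, (∏ i, p i (f i)) * Φ f

theorem EE_mono {ι : Type*} [Fintype ι] [DecidableEq ι] (p : ι → ι → ENNReal)
    {Φ Ψ : (ι → ι) → ENNReal} (h : ∀ f, Φ f ≤ Ψ f) : EE p Φ ≤ EE p Ψ := by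
  unfold EE; gcongr with f; exact h f

theorem EE_add {ι : Type*} [Fintype ι] [DecidableEq ι] (p : ι → ι → ENNReal)
    (Φ Ψ : (ι → ι) → ENNReal) : EE p (fun f => Φ f + Ψ f) = EE p Φ + EE p Ψ := by
  unfold EE; rw [← Finset.sum_add_distrib]
  exact Finset.sum_congr rfl fun f _ => mul_add _ _ _

theorem EE_sum {ι κ : Type*} [Fintype ι] [DecidableEq ι] (p : ι → ι → ENNReal)
    (s : Finset κ) (Φ : κ → (ι → ι) → ENNReal) :
    EE p (fun f => ∑ k ∈ s, Φ k f) = ∑ k ∈ s, EE p (Φ k) := by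
  unfold EE; rw [Finset.sum_comm]
  exact Finset.sum_congr rfl fun f _ => Finset.mul_sum _ _ _

theorem EE_mul {ι : Type*} [Fintype ι] [DecidableEq ι] (p : ι → ι → ENNReal)
    (c : ENNReal) (Φ : (ι → ι) → ENNReal) : EE p (fun f => c * Φ f) = c * EE p Φ := by
  unfold EE; rw [Finset.mul_sum]
  exact Finset.sum_congr rfl fun f _ => by ring

theorem EE_one {ι : Type*} [Fintype ι] [DecidableEq ι] (p : ι → ι → ENNReal)
    (hp : ∀ i, ∑ j, p i j = 1) : EE p (fun _ => 1) = 1 := by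
  unfold EE
  simp only [mul_one]
  have := (Finset.prod_univ_sum (fun _ : ι => (univ : Finset ι)) p)
  rw [Fintype.piFinset_univ] at this
  rw [← this]
  simp [hp]

theorem EE_resample {ι : Type*} [Fintype ι] [DecidableEq ι] (p : ι → ι → ENNReal)
    (hp : ∀ i, ∑ j, p i j = 1) (x : ι) (Φ : (ι → ι) → ENNReal) :
    EE p Φ = ∑ j, p x j * EE p (fun f => Φ (Function.update f x j)) := by
  let e : (ι → ι) × ι → (ι → ι) × ι := fun q => (Function.update q.1 x q.2, q.1 x)
  have he : Function.Involutive e := by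
    rintro ⟨f, j⟩
    simp [e]
  have hw : ∀ (f : ι → ι) (j : ι), (∏ i, p i (f i)) * p x j =
      (∏ i, p i (Function.update f x j i)) * p x (f x) := by
    intro f j
    rw [← Finset.mul_prod_erase univ _ (Finset.mem_univ x),
      ← Finset.mul_prod_erase univ (fun i => p i (Function.update f x j i)) (Finset.mem_univ x)]
    have : ∏ i ∈ univ.erase x, p i (Function.update f x j i) = ∏ i ∈ univ.erase x, p i (f i) :=
      Finset.prod_congr rfl fun i hi => by
        rw [Function.update_of_ne (Finset.ne_of_mem_erase hi)]
    rw [this, Function.update_self]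
    ring
  have h1 : ∑ j, p x j * EE p (fun f => Φ (Function.update f x j)) =
      ∑ q : (ι → ι) × ι, ((∏ i, p i ((e q).1 i)) * p x (e q).2) * Φ (e q).1 := by
    rw [Fintype.sum_prod_type, Finset.sum_comm]
    refine Finset.sum_congr rfl fun j _ => ?_
    unfold EE
    rw [Finset.mul_sum]
    refine Finset.sum_congr rfl fun f _ => ?_
    simp only [e]
    rw [← hw f j]
    ring
  have h2 := Equiv.sum_comp (Function.Involutive.toPerm e he)
    (fun q : (ι → ι) × ι => ((∏ i, p i (q.1 i)) * p x q.2) * Φ q.1)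
  refine Eq.trans ?_ (h1.trans h2).symm
  rw [Fintype.sum_prod_type]
  unfold EE
  refine Finset.sum_congr rfl fun f _ => ?_
  simp only
  rw [← Finset.sum_mul, ← Finset.mul_sum, hp, mul_one]

def Hit {ι : Type*} (f : ι → ι) (V : Finset ι) (t : ℕ) (x : ι) : Prop := ∃ s ≤ t, f^[s] x ∈ V

def HB {ι : Type*} [DecidableEq ι] (f : ι → ι) (V : Finset ι) : ℕ → Finset ι → ι → Prop
  | 0, _, _ => False
  | s + 1, B, x => f x ∈ V ∨ (f x ∉ insert x B ∧ HB f V s (insert x B) (f x))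

theorem hit_zero {ι : Type*} (f : ι → ι) (V : Finset ι) (x : ι) : Hit f V 0 x ↔ x ∈ V := by
  constructor
  · rintro ⟨s, hs, h⟩
    obtain rfl : s = 0 := by omega
    exact h
  · intro h; exact ⟨0, le_rfl, h⟩

theorem hit_succ {ι : Type*} (f : ι → ι) (V : Finset ι) (t : ℕ) (x : ι) :
    Hit f V (t+1) x ↔ x ∈ V ∨ Hit f V t (f x) := by
  constructor
  · rintro ⟨s, hs, h⟩
    cases s with
    | zero => exact Or.inl h
    | succ s => exact Or.inr ⟨s, by omega, h⟩
  · rintro (h | ⟨s, hs, h⟩)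
    · exact ⟨0, by omega, h⟩
    · exact ⟨s + 1, by omega, h⟩

theorem hit_update {ι : Type*} [DecidableEq ι] (f : ι → ι) (V : Finset ι) (x j : ι) (hx : x ∈ V) :
    ∀ (t : ℕ) (y : ι), Hit (Function.update f x j) V t y ↔ Hit f V t y := by
  intro t
  induction t with
  | zero => intro y; rw [hit_zero, hit_zero]
  | succ t ih =>
    intro y
    rw [hit_succ, hit_succ]
    by_cases hy : y ∈ V
    · simp [hy]
    · rw [ih, Function.update_of_ne (by rintro rfl; exact hy hx)]

theorem HB_update {ι : Type*} [DecidableEq ι] (f : ι → ι) (V : Finset ι) (x j : ι) :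
    ∀ (t : ℕ) (B : Finset ι) (y : ι), x ∈ B → y ∉ B →
      (HB (Function.update f x j) V t B y ↔ HB f V t B y) := by
  intro t
  induction t with
  | zero => intro B y _ _; exact Iff.rfl
  | succ t ih =>
    intro B y hx hy
    have hyx : y ≠ x := by rintro rfl; exact hy hx
    simp only [HB]
    rw [Function.update_of_ne hyx]
    by_cases h : f y ∈ insert y B
    · simp [h]
    · rw [ih (insert y B) (f y) (Finset.mem_insert_of_mem hx) h]

theorem HB_of_path {ι : Type*} [DecidableEq ι] (f : ι → ι) (V : Finset ι) :
    ∀ (s k : ℕ) (B : Finset ι) (x : ι), V ⊆ B → 1 ≤ k → k ≤ s → f^[k] x ∈ V →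
      (∀ j < k, f^[j] x ∉ B) → HB f V s B x := by
  intro s
  induction s with
  | zero => intro k B x _ h1 h2; omega
  | succ s ih =>
    intro k B x hVB h1 h2 hk hB
    by_cases hfx : f x ∈ V
    · exact Or.inl hfx
    right
    have hk2 : 2 ≤ k := by
      by_contra h
      obtain rfl : k = 1 := by omega
      exact hfx hk
    have hdist : ∀ j, 1 ≤ j → j < k → f^[j] x ≠ x := by
      intro j hj1 hj2 h
      apply hB (k - j) (by omega)
      apply hVB
      have : f^[k] x = f^[k - j] x := by
        conv_lhs => rw [show k = (k - j) + j by omega, Function.iterate_add_apply, h]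
      rw [← this]; exact hk
    have hni : ∀ j < k - 1, f^[j] (f x) ∉ insert x B := by
      intro j hj h
      rw [← Function.iterate_succ_apply] at h
      rcases Finset.mem_insert.1 h with h | h
      · exact hdist (j+1) (by omega) (by omega) h
      · exact hB (j+1) (by omega) h
    refine ⟨hni 0 (by omega), ih (k-1) (insert x B) (f x)
      (hVB.trans (Finset.subset_insert _ _)) (by omega) (by omega) ?_ hni⟩
    rw [← Function.iterate_succ_apply, show (k - 1).succ = k by omega]
    exact hk

theorem HB_of_hit {ι : Type*} [DecidableEq ι] (f : ι → ι) (V : Finset ι) (s : ℕ) (x : ι)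
    (hx : x ∉ V) (h : Hit f V s x) : HB f V s V x := by
  have h' : ∃ k, f^[k] x ∈ V := by obtain ⟨k, _, hk⟩ := h; exact ⟨k, hk⟩
  classical
  obtain ⟨k0, hk0, hk0V⟩ := h
  refine HB_of_path f V s (Nat.find h') V x (Finset.Subset.refl _) ?_
    ((Nat.find_min' h' hk0V).trans hk0) (Nat.find_spec h') (fun j hj => Nat.find_min h' hj)
  by_contra hlt
  have h0 : Nat.find h' = 0 := by omega
  have := Nat.find_spec h'
  rw [h0] at this
  exact hx this

open Classical in
noncomputable def NN {ι : Type*} [Fintype ι] (f : ι → ι) (V : Finset ι) (ℓ : ℕ) : ℕ :=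
  (univ.filter fun x => Hit f V ℓ x).card

theorem NN_mono {ι : Type*} [Fintype ι] (f : ι → ι) {V B : Finset ι} (h : V ⊆ B) (ℓ : ℕ) :
    NN f V ℓ ≤ NN f B ℓ := by
  classical
  refine Finset.card_le_card fun x hx => ?_
  simp only [Finset.mem_filter, Finset.mem_univ, true_and] at hx ⊢
  obtain ⟨s, hs, hV⟩ := hx
  exact ⟨s, hs, h hV⟩

theorem NN_update {ι : Type*} [Fintype ι] [DecidableEq ι] (f : ι → ι) (V : Finset ι) (ℓ : ℕ)
    (x j : ι) (hx : x ∈ V) : NN (Function.update f x j) V ℓ = NN f V ℓ := by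
  classical
  unfold NN
  congr 1
  ext y
  simp only [Finset.mem_filter, Finset.mem_univ, true_and]
  exact hit_update f V x j hx ℓ y

open Classical in
theorem path_bound {ι : Type*} [Fintype ι] [DecidableEq ι] (p : ι → ι → ENNReal)
    (hp : ∀ i, ∑ j, p i j = 1) (ρ : ι) (q : ENNReal) (hq : ∀ i, i ≠ ρ → ∀ j, p i j ≤ q)
    (V : Finset ι) (hρ : ρ ∈ V) (ℓ r : ℕ) (K : ℕ) (M : ENNReal)
    (hM : ∀ B : Finset ι, V ⊆ B → B.card ≤ K → EE p (fun f => (NN f B ℓ : ENNReal) ^ r) ≤ M) :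
    ∀ (s : ℕ) (B : Finset ι) (x : ι), V ⊆ B → x ∉ B → B.card + s ≤ K →
      EE p (fun f => (if HB f V s B x then 1 else 0) * (NN f B ℓ : ENNReal) ^ r) ≤ s * q * V.card * M := by
  intro s
  induction s with
  | zero =>
    intro B x _ _ _
    unfold EE
    simp [HB]
  | succ s ih =>
    intro B x hVB hx hK
    set B' := insert x B with hB'
    have hxB' : x ∈ B' := Finset.mem_insert_self x B
    have hcard : B'.card = B.card + 1 := Finset.card_insert_of_notMem hx
    have hVB' : V ⊆ B' := hVB.trans (Finset.subset_insert _ _)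
    have hxρ : x ≠ ρ := by rintro rfl; exact hx (hVB hρ)
    calc _ ≤ EE p (fun f => (if f x ∈ V then 1 else 0) * (NN f B' ℓ : ENNReal) ^ r +
          (if f x ∉ B' ∧ HB f V s B' (f x) then 1 else 0) * (NN f B' ℓ : ENNReal) ^ r) := by
          refine EE_mono p fun f => ?_
          rw [← add_mul]
          gcongr
          · by_cases h1 : f x ∈ V
            · simp only [h1, if_true]
              split_ifs <;> simp
            · by_cases h2 : f x ∉ B' ∧ HB f V s B' (f x)
              · rw [if_pos h2]
                split_ifs <;> simp
              · have h3 : ¬ HB f V (s+1) B x := by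
                  rintro (h | h)
                  · exact h1 h
                  · exact h2 h
                rw [if_neg h3]
                exact zero_le
          · exact NN_mono f (Finset.subset_insert _ _) ℓ
      _ = ∑ j, p x j * ((if j ∈ V then 1 else 0) * EE p (fun f => (NN f B' ℓ : ENNReal) ^ r) +
          (if j ∉ B' then EE p (fun f => (if HB f V s B' j then 1 else 0) * (NN f B' ℓ : ENNReal) ^ r)
            else 0)) := by
          rw [EE_resample p hp x]
          refine Finset.sum_congr rfl fun j _ => ?_
          congr 1
          rw [← EE_mul]
          by_cases hj : j ∈ B'
          · simp only [Function.update_self, hj, not_true, false_and, if_false, zero_mul, add_zero]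
            congr 1; ext f
            rw [NN_update f B' ℓ x j hxB']
          · simp only [Function.update_self, hj, not_false_eq_true, true_and, if_true]
            rw [← EE_add]
            congr 1; ext f
            rw [NN_update f B' ℓ x j hxB']
            congr 3
            exact propext (HB_update f V x j s B' j hxB' hj)
      _ ≤ ∑ j, ((if j ∈ V then q * M else 0) + p x j * (s * q * V.card * M)) := by
          refine Finset.sum_le_sum fun j _ => ?_
          rw [mul_add]
          gcongr
          · by_cases hj : j ∈ V
            · simp only [hj, if_true, one_mul]
              gcongr
              · exact hq x hxρ j
              · exact hM B' hVB' (by omega)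
            · simp [hj]
          · by_cases hj : j ∈ B'
            · simp [hj]
            · simp only [hj, not_false_eq_true, if_true]
              exact ih B' j hVB' hj (by omega)
      _ = _ := by
          rw [Finset.sum_add_distrib, ← Finset.sum_mul, hp, Finset.sum_ite_mem, Finset.univ_inter,
            Finset.sum_const, nsmul_eq_mul]
          push_cast
          ring

open Classical in
theorem moment_bound {ι : Type*} [Fintype ι] [DecidableEq ι] (p : ι → ι → ENNReal)
    (hp : ∀ i, ∑ j, p i j = 1) (ρ : ι) (q : ENNReal) (hq : ∀ i, i ≠ ρ → ∀ j, p i j ≤ q)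
    (ℓ : ℕ) : ∀ (r : ℕ) (V : Finset ι), ρ ∈ V →
      EE p (fun f => (NN f V ℓ : ENNReal) ^ r) ≤
        (((V.card + r * ℓ : ℕ) : ENNReal) * (1 + Fintype.card ι * ℓ * q)) ^ r := by
  intro r
  induction r with
  | zero => intro V _; simp [EE_one p hp]
  | succ r ih =>
    intro V hρ
    set A : ENNReal := 1 + Fintype.card ι * ℓ * q with hA
    set M : ENNReal := (((V.card + (r+1) * ℓ : ℕ) : ENNReal) * A) ^ r with hM
    have hMB : ∀ B : Finset ι, V ⊆ B → B.card ≤ V.card + ℓ →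
        EE p (fun f => (NN f B ℓ : ENNReal) ^ r) ≤ M := by
      intro B hVB hB
      refine (ih B (hVB hρ)).trans ?_
      rw [hM]
      have : B.card + r * ℓ ≤ V.card + (r+1) * ℓ := by rw [add_mul]; omega
      exact pow_le_pow_left' (mul_le_mul' (by exact_mod_cast this) le_rfl) r
    have hsplit : ∀ f : ι → ι, (NN f V ℓ : ENNReal) ^ (r+1) ≤
        ∑ x, ((if x ∈ V then 1 else 0) * (NN f V ℓ : ENNReal) ^ r +
          (if x ∉ V ∧ HB f V ℓ V x then 1 else 0) * (NN f V ℓ : ENNReal) ^ r) := by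
      intro f
      simp_rw [← add_mul]
      rw [← Finset.sum_mul, pow_succ']
      gcongr
      conv_lhs => unfold NN
      rw [Finset.card_filter]
      push_cast
      refine Finset.sum_le_sum fun x _ => ?_
      by_cases hx : x ∈ V
      · simp only [hx, if_true]
        split_ifs <;> simp
      · by_cases hh : Hit f V ℓ x
        · simp [hx, hh, HB_of_hit f V ℓ x hx hh]
        · simp [hh]
    calc _ ≤ EE p (fun f => ∑ x, ((if x ∈ V then 1 else 0) * (NN f V ℓ : ENNReal) ^ r +
          (if x ∉ V ∧ HB f V ℓ V x then 1 else 0) * (NN f V ℓ : ENNReal) ^ r)) := EE_mono p hsplit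
      _ = ∑ x, ((if x ∈ V then 1 else 0) * EE p (fun f => (NN f V ℓ : ENNReal) ^ r) +
          (if x ∉ V then EE p (fun f => (if HB f V ℓ V x then 1 else 0) * (NN f V ℓ : ENNReal) ^ r)
            else 0)) := by
          rw [EE_sum]
          refine Finset.sum_congr rfl fun x _ => ?_
          rw [EE_add, EE_mul]
          congr 1
          by_cases hx : x ∈ V
          · simp [hx, EE]
          · simp [hx]
      _ ≤ ∑ x, ((if x ∈ V then M else 0) + ℓ * q * V.card * M) := by
          refine Finset.sum_le_sum fun x _ => ?_
          gcongr
          · by_cases hx : x ∈ V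
            · simp only [hx, if_true, one_mul]
              exact hMB V (Finset.Subset.refl _) (by omega)
            · simp [hx]
          · by_cases hx : x ∈ V
            · simp [hx]
            · simp only [hx, not_false_eq_true, if_true]
              exact path_bound p hp ρ q hq V hρ ℓ r (V.card + ℓ) M hMB ℓ V x
                (Finset.Subset.refl _) hx le_rfl
      _ = V.card * A * M := by
          rw [Finset.sum_add_distrib, Finset.sum_ite_mem, Finset.univ_inter,
            Finset.sum_const, Finset.sum_const, nsmul_eq_mul, nsmul_eq_mul, Finset.card_univ, hA]
          ring
      _ ≤ (((V.card + (r+1) * ℓ : ℕ) : ENNReal) * A) * M := by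
          gcongr
          omega
      _ = _ := by rw [hM, pow_succ']


noncomputable def phi (x : ℝ) : ENNReal := U1 (Set.Ici x)

theorem phi_eq (x : ℝ) : phi x = ENNReal.ofReal (1 - max x 0) := by
  unfold phi U1
  rw [Measure.restrict_apply measurableSet_Ici]
  have : Set.Ici x ∩ Set.Icc (0:ℝ) 1 = Set.Icc (max x 0) 1 := by
    ext t; simp only [Set.mem_inter_iff, Set.mem_Ici, Set.mem_Icc, max_le_iff]; tauto
  rw [this, Real.volume_Icc]

theorem phi_le_one (x : ℝ) : phi x ≤ 1 := prob_le_one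

theorem phi_anti {x y : ℝ} (h : x ≤ y) : phi y ≤ phi x :=
  measure_mono (Set.Ici_subset_Ici.2 h)

theorem measurable_phi : Measurable phi := by
  have : phi = fun x => ENNReal.ofReal (1 - max x 0) := funext phi_eq
  rw [this]; fun_prop

/-- row event: `j` minimises (with offsets `e`) and exceeds `a` -/
def RowE {ι : Type*} [DecidableEq ι] (K : Finset ι) (d : ι → ℝ) (a : ℝ) (j : ι) (e : ι → ℝ) :
    Set (ι → ℝ) :=
  {c | a ≤ c j + d j ∧ ∀ k ∈ K.erase j, c j + d j + e k ≤ c k + d k}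

theorem measurableSet_RowE {ι : Type*} [DecidableEq ι] (K : Finset ι) (d : ι → ℝ)
    (a : ℝ) (j : ι) (e : ι → ℝ) : MeasurableSet (RowE K d a j e) := by
  have : RowE K d a j e = {c | a ≤ c j + d j} ∩
      ⋂ k ∈ K.erase j, {c | c j + d j + e k ≤ c k + d k} := by
    ext c; simp [RowE]
  rw [this]
  refine MeasurableSet.inter (measurableSet_le (by fun_prop) (by fun_prop)) ?_
  exact Finset.measurableSet_biInter _ fun k _ => measurableSet_le (by fun_prop) (by fun_prop)

/-- density of the row event -/
noncomputable def Hd {ι : Type*} [DecidableEq ι] (K : Finset ι) (d : ι → ℝ) (j : ι) (e : ι → ℝ)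
    (t : ℝ) : ENNReal := ∏ k ∈ K.erase j, phi (t + d j + e k - d k)

theorem measurable_Hd {ι : Type*} [DecidableEq ι] (K : Finset ι) (d : ι → ℝ) (j : ι)
    (e : ι → ℝ) : Measurable (Hd K d j e) := by
  unfold Hd
  exact Finset.measurable_prod _ fun k _ => measurable_phi.comp (by fun_prop)

theorem rowE_measure {ι : Type*} [Fintype ι] [DecidableEq ι] (K : Finset ι) (d : ι → ℝ)
    (a : ℝ) (j : ι) (e : ι → ℝ) :
    (Measure.pi fun _ : ι => U1) (RowE K d a j e) =
      ∫⁻ t, (Set.Ici (a - d j)).indicator (Hd K d j e) t ∂U1 := by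
  rw [← lintegral_indicator_one (measurableSet_RowE K d a j e),
    lintegral_update' U1 j _ (measurable_one.indicator (measurableSet_RowE K d a j e))]
  refine lintegral_congr fun t => ?_
  have hpre : ∀ c : ι → ℝ, Function.update c j t ∈ RowE K d a j e ↔
      (a ≤ t + d j ∧ ∀ k ∈ K.erase j, t + d j + e k - d k ≤ c k) := by
    intro c
    simp only [RowE, Set.mem_ofPred_eq, Function.update_self]
    refine and_congr_right fun _ => forall₂_congr fun k hk => ?_
    rw [Function.update_of_ne (Finset.ne_of_mem_erase hk)]
    constructor <;> intro h <;> linarith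
  by_cases ha : a ≤ t + d j
  · rw [Set.indicator_of_mem (by simp only [Set.mem_Ici]; linarith)]
    have hS : {c : ι → ℝ | Function.update c j t ∈ RowE K d a j e} =
        Set.univ.pi (fun k => if k ∈ K.erase j then Set.Ici (t + d j + e k - d k) else Set.univ) := by
      ext c
      rw [Set.mem_ofPred_eq, hpre c]
      simp only [ha, true_and, Set.mem_pi, Set.mem_univ, true_imp_iff]
      refine forall_congr' fun k => ?_
      by_cases hk : k ∈ K.erase j
      · simp [hk]
      · simp [hk]
    have : (fun c => (RowE K d a j e).indicator (1 : (ι → ℝ) → ENNReal) (Function.update c j t))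
        = Set.indicator {c : ι → ℝ | Function.update c j t ∈ RowE K d a j e} 1 := by
      ext c; simp [Set.indicator]
    rw [this, hS, lintegral_indicator_one, Measure.pi_pi]
    · unfold Hd
      rw [← Finset.prod_subset (Finset.subset_univ (K.erase j))]
      · refine Finset.prod_congr rfl fun k hk => ?_
        simp [hk, phi]
      · intro k _ hk
        simp [hk]
    · refine MeasurableSet.univ_pi fun k => ?_
      split_ifs
      · exact measurableSet_Ici
      · exact MeasurableSet.univ
  · rw [Set.indicator_of_notMem (by simp only [Set.mem_Ici]; linarith)]
    have : ∀ c, (RowE K d a j e).indicator (1 : (ι → ℝ) → ENNReal) (Function.update c j t) = 0 := by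
      intro c
      apply Set.indicator_of_notMem
      rw [hpre c]; tauto
    simp [this]

/-- `Ψ` -/
noncomputable def Psi {ι : Type*} (K : Finset ι) (d : ι → ℝ) (a : ℝ) : ENNReal :=
  ∏ k ∈ K, phi (a - d k)

theorem Psi_measure {ι : Type*} [Fintype ι] [DecidableEq ι] (K : Finset ι) (d : ι → ℝ) (a : ℝ) :
    (Measure.pi fun _ : ι => U1) {c | ∀ k ∈ K, a ≤ c k + d k} = Psi K d a := by
  have hS : {c : ι → ℝ | ∀ k ∈ K, a ≤ c k + d k} =
        Set.univ.pi (fun k => if k ∈ K then Set.Ici (a - d k) else Set.univ) := by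
      ext c
      simp only [Set.mem_pi, Set.mem_univ, true_imp_iff, Set.mem_ofPred_eq]
      refine forall_congr' fun k => ?_
      by_cases hk : k ∈ K
      · simp [hk]
      · simp [hk]
  rw [hS, Measure.pi_pi]
  unfold Psi
  rw [← Finset.prod_subset (Finset.subset_univ K)]
  · refine Finset.prod_congr rfl fun k hk => ?_
    simp [hk, phi]
  · intro k _ hk
    simp [hk]

/-- R1 -/
theorem row_sum {ι : Type*} [Fintype ι] [DecidableEq ι] (K : Finset ι) (hK : K.Nonempty)
    (d : ι → ℝ) (a : ℝ) :
    ∑ j ∈ K, (Measure.pi fun _ : ι => U1) (RowE K d a j 0) = Psi K d a := by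
  rw [← measure_biUnion_finset₀, ← Psi_measure]
  · congr 1
    ext c
    simp only [Set.mem_iUnion, Set.mem_ofPred_eq, RowE, Pi.zero_apply, add_zero, exists_prop]
    constructor
    · rintro ⟨j, hj, h1, h2⟩ k hk
      by_cases hkj : k = j
      · subst hkj; exact h1
      · exact h1.trans (h2 k (Finset.mem_erase.2 ⟨hkj, hk⟩))
    · intro h
      obtain ⟨j, hj, hmin⟩ := Finset.exists_min_image K (fun k => c k + d k) hK
      exact ⟨j, hj, h j hj, fun k hk => hmin k (Finset.mem_of_mem_erase hk)⟩
  · intro j hj k hk hjk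
    have hm : MeasurableSet {c : ι → ℝ | c j + d j = c k + d k} :=
      measurableSet_eq_fun (by fun_prop) (by fun_prop)
    have h0 : (Measure.pi fun _ : ι => U1) {c : ι → ℝ | c j + d j = c k + d k} ≤ ENNReal.ofReal 0 := by
      refine slice_le j _ hm 0 ?_
      intro c t1 t2 h1 h2
      simp only [Set.mem_ofPred_eq, Function.update_self, Function.update_of_ne (Ne.symm hjk)] at h1 h2
      linarith
    rw [ENNReal.ofReal_zero] at h0
    refine measure_mono_null ?_ (le_antisymm h0 zero_le)
    rintro c ⟨h1, h2⟩
    simp only [RowE, Set.mem_ofPred_eq, Pi.zero_apply, add_zero] at h1 h2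
    have := h1.2 k (Finset.mem_erase.2 ⟨Ne.symm hjk, hk⟩)
    have := h2.2 j (Finset.mem_erase.2 ⟨hjk, hj⟩)
    simp only [Set.mem_ofPred_eq]
    linarith
  · intro j _
    exact (measurableSet_RowE K d a j 0).nullMeasurableSet

/-- upper bound for a product of `Ψ` type -/
theorem Psi_le {ι : Type*} (K : Finset ι) (d : ι → ℝ) (a : ℝ) :
    Psi K d a ≤ ENNReal.ofReal (Real.exp (-∑ k ∈ K, max (a - d k) 0)) := by
  unfold Psi
  rw [← Finset.sum_neg_distrib, Real.exp_sum, ENNReal.ofReal_prod_of_nonneg fun _ _ => (Real.exp_pos _).le]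
  refine Finset.prod_le_prod' fun k _ => ?_
  rw [phi_eq]
  apply ENNReal.ofReal_le_ofReal
  have := Real.add_one_le_exp (-max (a - d k) 0)
  linarith


/-- R2: no single parent is too likely -/
theorem row_q {ι : Type*} [Fintype ι] [DecidableEq ι] (K : Finset ι) (d : ι → ℝ) (a : ℝ)
    (t0 y0 : ℝ) (ht0' : 0 ≤ t0) (ht0 : t0 ≤ 1/2) (hy0 : 0 ≤ y0) (hy1 : y0 ≤ 1)
    (hr : ∀ k ∈ K, |a - d k| ≤ t0) (j : ι) (hj : j ∈ K) :
    (Measure.pi fun _ : ι => U1) (RowE K d a j 0) ≤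
      ENNReal.ofReal (2 * (t0 + y0 + (1 - y0) ^ (K.card - 1))) * Psi K d a := by
  set P' : ENNReal := ∏ k ∈ K.erase j, phi (a - d k) with hP'
  have hP2 : P' ≤ 2 * Psi K d a := by
    have h1 : Psi K d a = phi (a - d j) * P' := by
      unfold Psi; rw [hP', Finset.mul_prod_erase K (fun k => phi (a - d k)) hj]
    have h2 : (2:ENNReal)⁻¹ ≤ phi (a - d j) := by
      have e : (2:ENNReal)⁻¹ = ENNReal.ofReal (1/2) := by
        rw [one_div, ENNReal.ofReal_inv_of_pos (by norm_num)]; norm_num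
      rw [e, phi_eq]
      apply ENNReal.ofReal_le_ofReal
      have : max (a - d j) 0 ≤ 1/2 := max_le ((le_abs_self _).trans ((hr j hj).trans ht0)) (by norm_num)
      linarith
    calc P' = 2 * (2⁻¹ * P') := by
          rw [← mul_assoc, ENNReal.mul_inv_cancel (by norm_num) (by norm_num), one_mul]
      _ ≤ 2 * (phi (a - d j) * P') := by gcongr
      _ = _ := by rw [h1]
  have hpt : ∀ t, (Set.Ici (a - d j)).indicator (Hd K d j 0) t ≤
      (Set.Icc (a - d j) (a - d j + (t0 + y0))).indicator (fun _ => P') t +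
        ENNReal.ofReal ((1 - y0) ^ (K.card - 1)) * P' := by
    intro t
    by_cases h1 : a - d j ≤ t
    · rw [Set.indicator_of_mem (Set.mem_Ici.2 h1)]
      by_cases h2 : t ≤ a - d j + (t0 + y0)
      · rw [Set.indicator_of_mem (Set.mem_Icc.2 ⟨h1, h2⟩)]
        refine le_add_right ?_
        unfold Hd
        refine Finset.prod_le_prod' fun k _ => phi_anti ?_
        simp only [Pi.zero_apply]
        linarith
      · refine le_add_left ?_
        unfold Hd
        rw [← Finset.card_erase_of_mem hj, ENNReal.ofReal_pow (by linarith), ← Finset.prod_const,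
          hP', ← Finset.prod_mul_distrib]
        refine Finset.prod_le_prod' fun k hk => ?_
        rw [phi_eq, phi_eq, ← ENNReal.ofReal_mul (by linarith)]
        by_cases hpos : 1 - max (t + d j + (0 : ι → ℝ) k - d k) 0 ≤ 0
        · rw [ENNReal.ofReal_of_nonpos hpos]; exact zero_le
        apply ENNReal.ofReal_le_ofReal
        have hb := abs_le.1 (hr k (Finset.mem_of_mem_erase hk))
        simp only [Pi.zero_apply]
        have h3 : t + d j + 0 - d k ≤ max (t + d j + 0 - d k) 0 := le_max_left _ _
        have h4 : max (a - d k) 0 ≤ a - d k + t0 := max_le (by linarith) (by linarith [hb.1])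
        have h5 : 0 ≤ max (a - d k) 0 := le_max_right _ _
        nlinarith [mul_nonneg hy0 h5]
    · rw [Set.indicator_of_notMem (by simpa using h1)]
      exact zero_le
  rw [rowE_measure]
  calc _ ≤ ∫⁻ t, ((Set.Icc (a - d j) (a - d j + (t0 + y0))).indicator (fun _ => P') t +
        ENNReal.ofReal ((1 - y0) ^ (K.card - 1)) * P') ∂U1 := lintegral_mono hpt
    _ = P' * U1 (Set.Icc (a - d j) (a - d j + (t0 + y0))) +
        ENNReal.ofReal ((1 - y0) ^ (K.card - 1)) * P' := by
        rw [lintegral_add_right _ measurable_const, lintegral_indicator_const measurableSet_Icc,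
          lintegral_const, measure_univ, mul_one]
    _ ≤ P' * ENNReal.ofReal (t0 + y0) + ENNReal.ofReal ((1 - y0) ^ (K.card - 1)) * P' := by
        gcongr
        refine (Measure.restrict_apply_le _ _).trans ?_
        rw [Real.volume_Icc]
        apply ENNReal.ofReal_le_ofReal; linarith
    _ = ENNReal.ofReal (t0 + y0 + (1 - y0) ^ (K.card - 1)) * P' := by
        have h7 : 0 ≤ (1 - y0) ^ (K.card - 1) := pow_nonneg (by linarith) _
        have h8 : 0 ≤ t0 + y0 := by linarith
        rw [ENNReal.ofReal_add h8 h7]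
        ring
    _ ≤ ENNReal.ofReal (t0 + y0 + (1 - y0) ^ (K.card - 1)) * (2 * Psi K d a) := by gcongr
    _ = _ := by
        rw [ENNReal.ofReal_mul (by norm_num)]
        simp only [ENNReal.ofReal_ofNat]
        ring

theorem one_sub_sum_le {ι : Type*} (s : Finset ι) (w : ι → ℝ) (h0 : ∀ k ∈ s, 0 ≤ w k)
    (h1 : ∀ k ∈ s, w k ≤ 1) : 1 - ∑ k ∈ s, w k ≤ ∏ k ∈ s, (1 - w k) := by
  classical
  induction s using Finset.induction_on with
  | empty => simp
  | insert a s ha ih =>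
    rw [Finset.sum_insert ha, Finset.prod_insert ha]
    have i1 := ih (fun k hk => h0 k (Finset.mem_insert_of_mem hk))
      (fun k hk => h1 k (Finset.mem_insert_of_mem hk))
    have a0 := h0 a (Finset.mem_insert_self _ _)
    have a1 := h1 a (Finset.mem_insert_self _ _)
    have s0 : 0 ≤ ∑ k ∈ s, w k := Finset.sum_nonneg fun k hk => h0 k (Finset.mem_insert_of_mem hk)
    nlinarith [mul_le_mul_of_nonneg_left i1 (sub_nonneg.2 a1)]

theorem pow_one_sub_le (x : ℝ) (hx0 : 0 ≤ x) (hx1 : x ≤ 1) (k : ℕ) (hk : x * k ≤ 1) :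
    (1 - x) ^ k ≤ 1 - x * k / 2 := by
  have h1 : (1 - x) ^ k ≤ Real.exp (-(x * k)) := by
    have : 1 - x ≤ Real.exp (-x) := by have := Real.add_one_le_exp (-x); linarith
    calc (1 - x) ^ k ≤ (Real.exp (-x)) ^ k := by
          apply pow_le_pow_left₀ (by linarith) this
      _ = _ := by rw [← Real.exp_nat_mul]; congr 1; ring
  have h2 : Real.exp (-(x * k)) ≤ 1 - x * k / 2 := by
    set z := x * k
    have hz : 0 ≤ z := by positivity
    rw [Real.exp_neg, inv_le_comm₀ (Real.exp_pos _) (by linarith)]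
    have := Real.quadratic_le_exp_of_nonneg hz
    refine le_trans ?_ this
    rw [inv_le_iff_one_le_mul₀ (by linarith)]
    nlinarith [mul_nonneg hz (sub_nonneg.2 hk), mul_nonneg (mul_nonneg hz hz) (sub_nonneg.2 hk), sq_nonneg z]
  exact h1.trans h2

/-- R3: avoiding near ties from `S` costs an exponential factor -/
theorem row_S {ι : Type*} [Fintype ι] [DecidableEq ι] (K : Finset ι) (d : ι → ℝ) (a : ℝ)
    (t0 τ δ' : ℝ) (N : ℕ) (hN : 1 ≤ N) (hKN : K.card ≤ N) (ht0 : 0 ≤ t0) (ht1 : t0 ≤ 1/2)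
    (hτa : τ - a ≤ t0) (hτ : ∀ k, τ - d k ≤ t0) (Ls : Finset ι)
    (hLs' : ∀ k ∉ Ls, τ ≤ d k) (hLc : (Ls.card : ℝ) * t0 ≤ 1/4)
    (j : ι) (S : Finset ι) (hS : S ⊆ K.erase j) (hSL : ∀ k ∈ S, d k ≤ τ)
    (hδ0 : 0 ≤ δ') (hδ1 : δ' ≤ 1) (hδS : δ' * S.card ≤ 1) :
    (Measure.pi fun _ : ι => U1) (RowE K d a j (fun k => if k ∈ S then δ' else 0)) ≤
      ENNReal.ofReal (Real.exp (-(δ' / (2 * (8 * N * t0 + 1)) * S.card))) *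
        (Measure.pi fun _ : ι => U1) (RowE K d a j 0) := by
  set e : ι → ℝ := fun k => if k ∈ S then δ' else 0 with he
  have hN' : (1:ℝ) ≤ N := by exact_mod_cast hN
  set T : Set ℝ := Set.Iio (τ - d j) with hT
  have hTm : MeasurableSet T := measurableSet_Iio
  set g0 := (Set.Ici (a - d j)).indicator (Hd K d j 0) with hg0
  set ge := (Set.Ici (a - d j)).indicator (Hd K d j e) with hge
  set A := ∫⁻ t in T, g0 t ∂U1 with hA
  set B := ∫⁻ t in Tᶜ, g0 t ∂U1 with hB
  have hAB : (Measure.pi fun _ : ι => U1) (RowE K d a j 0) = A + B := by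
    rw [rowE_measure, hA, hB, lintegral_add_compl _ hTm]
  have hle : ∀ t, ge t ≤ g0 t := by
    intro t
    refine Set.indicator_le_indicator ?_
    unfold Hd
    refine Finset.prod_le_prod' fun k _ => phi_anti ?_
    have : 0 ≤ e k := by simp only [he]; split_ifs <;> linarith
    simp only [Pi.zero_apply]
    linarith
  have hle2 : ∀ t ∈ Tᶜ, ge t ≤ ENNReal.ofReal ((1 - δ') ^ S.card) * g0 t := by
    intro t ht
    have ht' : τ - d j ≤ t := by simpa [hT] using ht
    by_cases h1 : a - d j ≤ t
    · rw [hge, hg0, Set.indicator_of_mem (Set.mem_Ici.2 h1), Set.indicator_of_mem (Set.mem_Ici.2 h1)]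
      unfold Hd
      rw [ENNReal.ofReal_pow (by linarith), ← Finset.prod_const]
      have hfil : ∏ k ∈ S, ENNReal.ofReal (1 - δ') =
          ∏ k ∈ K.erase j, (if k ∈ S then ENNReal.ofReal (1 - δ') else 1) := by
        rw [Finset.prod_ite_mem, Finset.inter_eq_right.2 hS]
      rw [hfil, ← Finset.prod_mul_distrib]
      refine Finset.prod_le_prod' fun k hk => ?_
      by_cases hkS : k ∈ S
      · simp only [hkS, if_true, he, Pi.zero_apply]
        rw [phi_eq, phi_eq, ← ENNReal.ofReal_mul (by linarith)]
        have hd := hSL k hkS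
        have x0 : 0 ≤ t + d j + 0 - d k := by linarith
        rw [max_eq_left x0, max_eq_left (by linarith)]
        apply ENNReal.ofReal_le_ofReal
        nlinarith
      · simp only [hkS, if_false, he, Pi.zero_apply, one_mul]; exact le_rfl
    · rw [hge, Set.indicator_of_notMem (by simpa using h1)]
      exact zero_le
  have hZ : (Measure.pi fun _ : ι => U1) (RowE K d a j e) ≤
      A + ENNReal.ofReal ((1 - δ') ^ S.card) * B := by
    rw [rowE_measure, ← lintegral_add_compl _ hTm]
    gcongr
    · exact lintegral_mono hle
    · rw [hB, ← lintegral_const_mul' _ _ ENNReal.ofReal_ne_top]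
      exact setLIntegral_mono' hTm.compl hle2
  have hg1 : ∀ t, g0 t ≤ 1 := by
    intro t
    refine Set.indicator_apply_le' (fun _ => ?_) (fun _ => zero_le)
    exact Finset.prod_le_one' fun k _ => phi_le_one _
  have hAle : A ≤ ENNReal.ofReal (τ - max a (d j)) := by
    calc A ≤ ∫⁻ t in T, (Set.Ici (a - d j)).indicator 1 t ∂U1 := by
          refine lintegral_mono fun t => ?_
          by_cases h1 : a - d j ≤ t
          · rw [Set.indicator_of_mem (Set.mem_Ici.2 h1)]; exact hg1 t
          · rw [hg0, Set.indicator_of_notMem (by simpa using h1)]; exact zero_le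
      _ = U1 (Set.Ici (a - d j) ∩ T) := by
          rw [lintegral_indicator_one measurableSet_Ici, Measure.restrict_apply measurableSet_Ici]
      _ ≤ volume (Set.Ico (max (a - d j) 0) (τ - d j)) := by
          unfold U1
          rw [Measure.restrict_apply (measurableSet_Ici.inter hTm)]
          refine measure_mono ?_
          rintro t ⟨⟨h1, h2⟩, h3, h4⟩
          simp only [Set.mem_Ici, hT, Set.mem_Iio] at h1 h2
          exact ⟨max_le h1 h3, h2⟩
      _ ≤ _ := by
          rw [Real.volume_Ico]
          apply ENNReal.ofReal_le_ofReal
          have : max a (d j) ≤ max (a - d j) 0 + d j := by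
            apply max_le
            · have := le_max_left (a - d j) 0; linarith
            · have := le_max_right (a - d j) 0; linarith
          linarith
  have hABM : A ≤ ENNReal.ofReal (8 * N * t0) * B := by
    by_cases hc : τ ≤ max a (d j)
    · have : A = 0 := le_antisymm (hAle.trans (by rw [ENNReal.ofReal_of_nonpos (by linarith)])) zero_le
      rw [this]; exact zero_le
    · push Not at hc
      have ha : a < τ := (le_max_left _ _).trans_lt hc
      have hdj : d j < τ := (le_max_right _ _).trans_lt hc
      have hinv : 1 / (4 * (N:ℝ)) ≤ 1/4 := by
        apply one_div_le_one_div_of_le <;> linarith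
      have hinv0 : 0 < 1 / (4 * (N:ℝ)) := by positivity
      have hA' : A ≤ ENNReal.ofReal t0 := hAle.trans (ENNReal.ofReal_le_ofReal (by
        have := le_max_left a (d j); linarith))
      set J := Set.Icc (τ - d j) (τ - d j + 1 / (4 * N)) with hJ
      have hB' : ENNReal.ofReal (1 / (8 * N)) ≤ B := by
        have hH : ∀ t ∈ J, ENNReal.ofReal (1/2) ≤ g0 t := by
          rintro t ⟨h1, h2⟩
          rw [hg0, Set.indicator_of_mem (Set.mem_Ici.2 (by linarith))]
          unfold Hd
          simp only [phi_eq]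
          have hw1 : ∀ k, max (t + d j + (0 : ι → ℝ) k - d k) 0 ≤ (if k ∈ Ls then t0 else 0) + 1 / (4 * N) := by
            intro k
            have := hτ k
            simp only [Pi.zero_apply]
            split_ifs with hk
            · exact max_le (by linarith) (by linarith)
            · have := hLs' k hk
              exact max_le (by linarith) (by linarith)
          have hw2 : ∀ k, max (t + d j + (0 : ι → ℝ) k - d k) 0 ≤ 1 := by
            intro k
            refine (hw1 k).trans ?_
            split_ifs <;> linarith
          rw [← ENNReal.ofReal_prod_of_nonneg (fun k _ => by have := hw2 k; linarith)]
          apply ENNReal.ofReal_le_ofReal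
          refine le_trans ?_ (one_sub_sum_le _ _ (fun k _ => le_max_right _ _) (fun k _ => hw2 k))
          have hsum : ∑ k ∈ K.erase j, max (t + d j + (0 : ι → ℝ) k - d k) 0 ≤ 1/2 := by
            calc _ ≤ ∑ k ∈ K.erase j, ((if k ∈ Ls then t0 else 0) + 1 / (4 * (N:ℝ))) :=
                  Finset.sum_le_sum fun k _ => hw1 k
              _ = ((K.erase j) ∩ Ls).card * t0 + (K.erase j).card * (1 / (4 * (N:ℝ))) := by
                  rw [Finset.sum_add_distrib, Finset.sum_ite_mem, Finset.sum_const, Finset.sum_const,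
                    nsmul_eq_mul, nsmul_eq_mul]
              _ ≤ Ls.card * t0 + N * (1 / (4 * (N:ℝ))) := by
                  gcongr
                  · exact Finset.inter_subset_right
                  · exact (Finset.card_le_card (Finset.erase_subset _ _)).trans hKN
              _ ≤ 1/4 + 1/4 := by
                  gcongr
                  apply le_of_eq; field_simp
              _ = 1/2 := by norm_num
          linarith
        have hJT : J ⊆ Tᶜ := by
          rintro t ⟨h1, _⟩
          simpa [hT] using h1
        calc ENNReal.ofReal (1 / (8 * N)) = ENNReal.ofReal (1/2) * U1 J := by
              unfold U1
              rw [Measure.restrict_apply measurableSet_Icc, Set.inter_eq_left.2, Real.volume_Icc,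
                ← ENNReal.ofReal_mul (by norm_num)]
              · congr 1; field_simp; ring
              · refine Set.Icc_subset_Icc (by linarith) ?_
                have := hτ j
                linarith
          _ = ∫⁻ t in J, ENNReal.ofReal (1/2) ∂U1 := by rw [setLIntegral_const]
          _ ≤ ∫⁻ t in J, g0 t ∂U1 := setLIntegral_mono' measurableSet_Icc hH
          _ ≤ B := lintegral_mono_set hJT
      calc A ≤ ENNReal.ofReal t0 := hA'
        _ = ENNReal.ofReal (8 * N * t0) * ENNReal.ofReal (1 / (8 * N)) := by
            rw [← ENNReal.ofReal_mul (by positivity)]; congr 1; field_simp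
        _ ≤ _ := by gcongr
  have hA1 : A ≠ ⊤ := (hAle.trans_lt ENNReal.ofReal_lt_top).ne
  have hB1 : B ≠ ⊤ := by
    have : A + B ≤ 1 := by rw [← hAB]; exact prob_le_one
    exact ((le_add_self).trans this |>.trans_lt ENNReal.one_lt_top).ne
  rw [hAB]
  refine hZ.trans ?_
  have p1 : (0:ℝ) ≤ (1 - δ') ^ S.card := by have : 0 ≤ 1 - δ' := by linarith
                                            positivity
  obtain ⟨α, hα⟩ : ∃ α : NNReal, A = α := ⟨A.toNNReal, (ENNReal.coe_toNNReal hA1).symm⟩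
  obtain ⟨β, hβ⟩ : ∃ β : NNReal, B = β := ⟨B.toNNReal, (ENNReal.coe_toNNReal hB1).symm⟩
  rw [hα, hβ] at hABM ⊢
  rw [← ENNReal.ofReal_coe_nnreal, ← ENNReal.ofReal_coe_nnreal, ← ENNReal.ofReal_mul (by positivity)] at hABM
  rw [ENNReal.ofReal_le_ofReal_iff (by positivity)] at hABM
  have hα0 : (0:ℝ) ≤ α := α.2
  have hβ0 : (0:ℝ) ≤ β := β.2
  rw [← ENNReal.ofReal_coe_nnreal, ← ENNReal.ofReal_coe_nnreal, ← ENNReal.ofReal_mul p1,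
    ← ENNReal.ofReal_add hα0 (by positivity), ← ENNReal.ofReal_add hα0 hβ0,
    ← ENNReal.ofReal_mul (Real.exp_pos _).le]
  apply ENNReal.ofReal_le_ofReal
  have hpow := pow_one_sub_le δ' hδ0 hδ1 S.card hδS
  have hx0 : 0 ≤ δ' * S.card := by positivity
  set x := δ' * S.card / 2 with hx
  set M := 8 * (N:ℝ) * t0 with hM
  have hM0 : 0 ≤ M := by positivity
  have e1 : δ' / (2 * (M + 1)) * S.card = x / (M + 1) := by rw [hx]; field_simp
  rw [e1]
  have hexp := Real.add_one_le_exp (-(x / (M+1)))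
  calc (α:ℝ) + (1 - δ') ^ S.card * β ≤ α + (1 - x) * β := by gcongr
    _ ≤ (-(x / (M+1)) + 1) * (α + β) := by
        have : x / (M+1) * (α + β) ≤ x * β := by
          rw [div_mul_eq_mul_div, div_le_iff₀ (by positivity)]
          have : 0 ≤ x := by positivity
          nlinarith
        nlinarith
    _ ≤ _ := by gcongr


theorem mp_of_det {ι : Type*} [Fintype ι] [DecidableEq ι] (M : Matrix ι ι ℝ) (h : |M.det| = 1) :
    MeasurePreserving (fun x : ι → ℝ => M.mulVec x) volume volume := by
  have h0 : M.det ≠ 0 := by rintro h0; rw [h0] at h; simp at h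
  have := Real.map_matrix_volume_pi_eq_smul_volume_pi h0
  refine ⟨?_, ?_⟩
  · exact (LinearMap.continuous_of_finiteDimensional (Matrix.toLin' M)).measurable
  · have e : (fun x : ι → ℝ => M.mulVec x) = (Matrix.toLin' M) := by ext x; simp
    rw [e, this, abs_inv, h]; simp

theorem lint_exp (γ a : ℝ) (hγ : 0 < γ) :
    ∫⁻ t, (Set.Ici a).indicator (fun t => ENNReal.ofReal (Real.exp (-(γ * (t - a))))) t =
      ENNReal.ofReal (1 / γ) := by
  rw [lintegral_indicator measurableSet_Ici, setLIntegral_congr Ioi_ae_eq_Ici.symm]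
  have e : ∀ t, Real.exp (-(γ * (t - a))) = Real.exp (γ * a) * Real.exp (-γ * t) := by
    intro t; rw [← Real.exp_add]; congr 1; ring
  simp_rw [e]
  rw [← ofReal_integral_eq_lintegral_ofReal]
  · congr 1
    rw [integral_const_mul, integral_exp_mul_Ioi (by linarith)]
    rw [neg_div_neg_eq, mul_div_assoc', ← Real.exp_add]
    simp
  · exact (integrableOn_exp_mul_Ioi (by linarith) a).const_mul _
  · exact Filter.Eventually.of_forall fun t => by positivity

def Wch (N : ℕ) : Set (Fin (N+1) → ℝ) :=
  {b | b 0 ∈ Set.Icc (0:ℝ) 1 ∧ ∀ m : Fin N, b m.castSucc ≤ b m.succ}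

theorem measurableSet_Wch (N : ℕ) : MeasurableSet (Wch N) := by
  have : Wch N = {b | b 0 ∈ Set.Icc (0:ℝ) 1} ∩ ⋂ m : Fin N, {b | b m.castSucc ≤ b m.succ} := by
    ext b; simp [Wch]
  rw [this]
  refine MeasurableSet.inter (measurableSet_Icc.preimage (measurable_pi_apply 0)) ?_
  exact MeasurableSet.iInter fun m => measurableSet_le (measurable_pi_apply _) (measurable_pi_apply _)

noncomputable def Qch (N : ℕ) (γ : ℕ → ℝ) (b : Fin (N+1) → ℝ) : ℝ :=
  ∑ m : Fin N, γ m * (b m.succ - b m.castSucc)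

theorem measurable_Qch (N : ℕ) (γ : ℕ → ℝ) : Measurable (Qch N γ) := by
  unfold Qch; fun_prop

noncomputable def Gch (N : ℕ) (γ : ℕ → ℝ) (b : Fin (N+1) → ℝ) : ENNReal :=
  (Wch N).indicator (fun b => ENNReal.ofReal (Real.exp (-(Qch N γ b)))) b

theorem measurable_Gch (N : ℕ) (γ : ℕ → ℝ) : Measurable (Gch N γ) := by
  refine Measurable.indicator ?_ (measurableSet_Wch N)
  have := measurable_Qch N γ
  fun_prop

theorem chain_lint (γ : ℕ → ℝ) : ∀ N : ℕ, (∀ m < N, 0 < γ m) →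
    ∫⁻ b, Gch N γ b = ∏ m ∈ range N, ENNReal.ofReal (1 / γ m) := by
  intro N
  induction N with
  | zero =>
    intro _
    simp only [Finset.range_zero, Finset.prod_empty]
    have e : Gch 0 γ = (Set.univ.pi fun _ : Fin 1 => Set.Icc (0:ℝ) 1).indicator 1 := by
      ext b
      unfold Gch Qch
      have : Wch 0 = Set.univ.pi fun _ : Fin 1 => Set.Icc (0:ℝ) 1 := by
        ext b
        simp only [Wch, Set.mem_ofPred_eq, Set.mem_pi, Set.mem_univ, true_imp_iff]
        constructor
        · rintro ⟨h, _⟩ i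
          rw [Fin.fin_one_eq_zero i]; exact h
        · intro h; exact ⟨h 0, fun m => m.elim0⟩
      rw [this]
      simp [Set.indicator]
    rw [e, lintegral_indicator_one (MeasurableSet.univ_pi fun _ => measurableSet_Icc), volume_pi,
      Measure.pi_pi]
    simp
  | succ N ih =>
    intro hγ
    have ih' := ih (fun m hm => hγ m (by omega))
    have mp := (volume_preserving_piFinSuccAbove (fun _ : Fin (N+2) => ℝ) (Fin.last (N+1))).symm
    rw [← mp.lintegral_comp (measurable_Gch (N+1) γ)]
    refine (lintegral_prod_symm' (μ := (volume : Measure ℝ)) (ν := (volume : Measure (Fin (N+1) → ℝ)))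
      _ ((measurable_Gch (N+1) γ).comp mp.measurable)).trans ?_
    rw [Finset.prod_range_succ, ← ih', ← lintegral_mul_const _ (measurable_Gch N γ)]
    refine lintegral_congr fun b => ?_
    rw [← lint_exp (γ N) (b (Fin.last N)) (hγ N (by omega)), ← lintegral_const_mul']
    swap
    · unfold Gch
      refine ne_of_lt (lt_of_le_of_lt (Set.indicator_apply_le' (fun _ => le_rfl) (fun _ => zero_le)) ENNReal.ofReal_lt_top)
    refine lintegral_congr fun t => ?_
    have hs : (MeasurableEquiv.piFinSuccAbove (fun _ : Fin (N+2) => ℝ) (Fin.last (N+1))).symm (t, b)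
        = (Fin.snoc b t : Fin (N+2) → ℝ) := by
      simp [MeasurableEquiv.piFinSuccAbove, Fin.insertNthEquiv, Fin.insertNth_last']
    rw [Function.comp_apply, hs]
    set b' : Fin (N+2) → ℝ := Fin.snoc b t with hb'
    have hc : ∀ i : Fin (N+1), b' i.castSucc = b i := fun i => by rw [hb', Fin.snoc_castSucc]
    have hl : b' (Fin.last (N+1)) = t := by rw [hb', Fin.snoc_last]
    have h0 : b' 0 = b 0 := by rw [← hc 0]; rfl
    have hW : b' ∈ Wch (N+1) ↔ b ∈ Wch N ∧ t ∈ Set.Ici (b (Fin.last N)) := by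
      simp only [Wch, Set.mem_ofPred_eq, h0, Set.mem_Ici]
      rw [Fin.forall_fin_succ']
      simp only [hc, Fin.succ_last, hl]
      have : ∀ m : Fin N, b' m.castSucc.succ = b m.succ := fun m => by
        rw [Fin.succ_castSucc, hc]
      simp only [this]
      tauto
    have hQ : Qch (N+1) γ b' = Qch N γ b + γ N * (t - b (Fin.last N)) := by
      unfold Qch
      rw [Fin.sum_univ_castSucc]
      simp only [hc, Fin.succ_last, hl, Fin.val_last, Fin.val_castSucc]
      have : ∀ m : Fin N, b' m.castSucc.succ = b m.succ := fun m => by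
        rw [Fin.succ_castSucc, hc]
      simp only [this]
    unfold Gch
    by_cases h1 : b ∈ Wch N
    · by_cases h2 : t ∈ Set.Ici (b (Fin.last N))
      · rw [Set.indicator_of_mem (hW.2 ⟨h1, h2⟩), Set.indicator_of_mem h1, Set.indicator_of_mem h2,
          hQ, ← ENNReal.ofReal_mul (Real.exp_pos _).le, ← Real.exp_add]
        congr 2; ring
      · rw [Set.indicator_of_notMem (fun h => h2 (hW.1 h).2), Set.indicator_of_notMem h2, mul_zero]
    · rw [Set.indicator_of_notMem (fun h => h1 (hW.1 h).1), Set.indicator_of_notMem h1, zero_mul]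

/-- the chamber integral -/
theorem chamber_lint (γ : ℕ → ℝ) (N : ℕ) (hγ : ∀ m < N, 0 < γ m) (σ : Equiv.Perm (Fin (N+1)))
    (ρ : Fin (N+1)) :
    ∫⁻ d : Fin (N+1) → ℝ, {d : Fin (N+1) → ℝ | d ρ ∈ Set.Icc (0:ℝ) 1 ∧
        ∀ m : Fin N, d (σ m.castSucc) ≤ d (σ m.succ)}.indicator
      (fun d => ENNReal.ofReal (Real.exp (-(Qch N γ (d ∘ σ))))) d =
      ∏ m ∈ range N, ENNReal.ofReal (1 / γ m) := by
  rw [← chain_lint γ N hγ]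
  set r := σ.symm ρ with hr
  let v : Fin (N+1) → ℝ := Pi.single 0 1 - Pi.single r 1
  let M : Matrix (Fin (N+1)) (Fin (N+1)) ℝ :=
    1 + Matrix.replicateCol Unit (fun _ => (1:ℝ)) * Matrix.replicateRow Unit v
  have hdet : |M.det| = 1 := by
    rw [Matrix.det_one_add_replicateCol_mul_replicateRow]
    simp [v, dotProduct, Finset.sum_sub_distrib]
  have hM : ∀ b i, M.mulVec b i = b i + (b 0 - b r) := by
    intro b i
    simp only [M, Matrix.add_mulVec, Matrix.one_mulVec, Pi.add_apply]
    congr 1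
    simp only [Matrix.mulVec, dotProduct, Matrix.mul_apply, Matrix.replicateCol_apply,
      Matrix.replicateRow_apply, Finset.univ_unique, Finset.sum_singleton, one_mul]
    simp [v, sub_mul, Finset.sum_sub_distrib, Pi.single_apply]
  have mp1 := mp_of_det M hdet
  have mp2 := volume_measurePreserving_piCongrLeft (fun _ : Fin (N+1) => ℝ) σ
  have mp := mp2.comp mp1
  set F := {d : Fin (N+1) → ℝ | d ρ ∈ Set.Icc (0:ℝ) 1 ∧
        ∀ m : Fin N, d (σ m.castSucc) ≤ d (σ m.succ)}.indicator
      (fun d => ENNReal.ofReal (Real.exp (-(Qch N γ (d ∘ σ))))) with hF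
  have hFm : Measurable F := by
    refine Measurable.indicator ?_ ?_
    · unfold Qch; simp only [Function.comp]; fun_prop
    · have : {d : Fin (N+1) → ℝ | d ρ ∈ Set.Icc (0:ℝ) 1 ∧
        ∀ m : Fin N, d (σ m.castSucc) ≤ d (σ m.succ)} = {d | d ρ ∈ Set.Icc (0:ℝ) 1} ∩
          ⋂ m : Fin N, {d | d (σ m.castSucc) ≤ d (σ m.succ)} := by
        ext b; simp
      rw [this]
      refine MeasurableSet.inter (measurableSet_Icc.preimage (measurable_pi_apply ρ)) ?_
      exact MeasurableSet.iInter fun m => measurableSet_le (measurable_pi_apply _) (measurable_pi_apply _)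
  rw [← mp.lintegral_comp hFm]
  refine lintegral_congr fun b => ?_
  set d := ((MeasurableEquiv.piCongrLeft (fun _ : Fin (N+1) => ℝ) σ) ∘ fun x => M.mulVec x) b with hd
  have hdσ : ∀ i, d (σ i) = b i + (b 0 - b r) := by
    intro i
    rw [hd, ← hM]
    exact Equiv.piCongrLeft_apply_apply (fun _ : Fin (N+1) => ℝ) σ _ i
  have hdρ : d ρ = b 0 := by
    have := hdσ r
    rw [hr, Equiv.apply_symm_apply] at this
    rw [this]; ring
  rw [hF]
  unfold Gch
  have hmem : d ∈ {d : Fin (N+1) → ℝ | d ρ ∈ Set.Icc (0:ℝ) 1 ∧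
        ∀ m : Fin N, d (σ m.castSucc) ≤ d (σ m.succ)} ↔ b ∈ Wch N := by
    simp only [Wch, Set.mem_ofPred_eq, hdρ, hdσ, add_le_add_iff_right]
  have hQ : Qch N γ (d ∘ σ) = Qch N γ b := by
    unfold Qch
    simp only [Function.comp, hdσ, add_sub_add_right_eq_sub]
  by_cases h : b ∈ Wch N
  · rw [Set.indicator_of_mem (hmem.2 h), Set.indicator_of_mem h, hQ]
  · rw [Set.indicator_of_notMem (fun h' => h (hmem.1 h')), Set.indicator_of_notMem h]


theorem chain_identity1 (b : ℕ → ℝ) (N : ℕ) :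
    ∑ k ∈ range (N+1), (b N - b k) = ∑ m ∈ range N, ((m:ℝ)+1) * (b (m+1) - b m) := by
  induction N with
  | zero => simp
  | succ N ih =>
    rw [Finset.sum_range_succ (n := N), ← ih, Finset.sum_range_succ, sub_self, add_zero]
    have : ∀ k ∈ range (N+1), b (N+1) - b k = (b N - b k) + (b (N+1) - b N) := fun k _ => by ring
    rw [Finset.sum_congr rfl this, Finset.sum_add_distrib, Finset.sum_const, card_range, nsmul_eq_mul]
    push_cast; ring

theorem chain_identity (b : ℕ → ℝ) (N : ℕ) (hb : ∀ i j, i ≤ j → j ≤ N → b i ≤ b j) :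
    ∑ i ∈ range (N+1), ∑ k ∈ range (N+1), max (b i - b k) 0 =
      ∑ m ∈ range N, ((m:ℝ)+1) * (N - m) * (b (m+1) - b m) := by
  induction N with
  | zero => simp
  | succ N ih =>
    have ih' := ih (fun i j h1 h2 => hb i j h1 (by omega))
    rw [Finset.sum_range_succ]
    have h1 : ∀ i ∈ range (N+1), ∑ k ∈ range (N+1+1), max (b i - b k) 0 =
        ∑ k ∈ range (N+1), max (b i - b k) 0 := by
      intro i hi
      rw [Finset.sum_range_succ, max_eq_right, add_zero]
      have := hb i (N+1) (by have := mem_range.1 hi; omega) le_rfl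
      linarith
    have h2 : ∑ k ∈ range (N+1+1), max (b (N+1) - b k) 0 = ∑ k ∈ range (N+1+1), (b (N+1) - b k) := by
      refine Finset.sum_congr rfl fun k hk => max_eq_left ?_
      have := hb k (N+1) (by have := mem_range.1 hk; omega) le_rfl
      linarith
    rw [Finset.sum_congr rfl h1, ih', h2, chain_identity1, Finset.sum_range_succ (n := N),
      Finset.sum_range_succ (n := N), ← add_assoc, ← Finset.sum_add_distrib]
    congr 1
    · refine Finset.sum_congr rfl fun m _ => ?_
      push_cast; ring
    · push_cast; ring

/-- allowed columns -/
def KK {n : ℕ} (π : Equiv.Perm (Fin n)) (i : Fin n) : Finset (Fin n) :=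
  univ.filter fun k => k ≠ i ∧ π k ≠ i

theorem mem_KK {n : ℕ} (π : Equiv.Perm (Fin n)) (i k : Fin n) : k ∈ KK π i ↔ Al π i k := by
  simp [KK, Al]

theorem KK_eq {n : ℕ} (π : Equiv.Perm (Fin n)) (i : Fin n) :
    KK π i = (univ.erase i).erase (π.symm i) := by
  ext k
  simp only [KK, mem_filter, mem_univ, true_and, mem_erase, and_true]
  rw [and_comm]
  simp only [ne_eq, Equiv.eq_symm_apply]

theorem KK_card {n : ℕ} {π : Equiv.Perm (Fin n)} (hπ : IsDerangement π) (i : Fin n) :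
    (KK π i).card = n - 2 := by
  rw [KK_eq, card_erase_of_mem, card_erase_of_mem (mem_univ _), card_univ, Fintype.card_fin]
  · omega
  · rw [mem_erase]
    refine ⟨fun h => hπ i ?_, mem_univ _⟩
    rw [Equiv.symm_apply_eq] at h; exact h.symm

theorem avg_ineq {n : ℕ} (hn : 0 < n) (d : Fin n → ℝ) (g : Equiv.Perm (Fin n)) :
    ∑ i, max (d i - d (g i)) 0 ≤ 2 / n * ∑ i, ∑ k, max (d i - d k) 0 := by
  have hn' : (0:ℝ) < n := by exact_mod_cast hn
  have h1 : ∀ i k, max (d i - d (g i)) 0 ≤ max (d i - d k) 0 + max (d k - d (g i)) 0 := by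
    intro i k
    apply max_le
    · have := le_max_left (d i - d k) 0
      have := le_max_left (d k - d (g i)) 0
      linarith
    · positivity
  have h2 : ∑ i, ∑ k : Fin n, max (d i - d (g i)) 0 ≤
      ∑ i, ∑ k, (max (d i - d k) 0 + max (d k - d (g i)) 0) :=
    Finset.sum_le_sum fun i _ => Finset.sum_le_sum fun k _ => h1 i k
  simp only [Finset.sum_add_distrib, Finset.sum_const, card_univ, Fintype.card_fin, nsmul_eq_mul,
    ← Finset.mul_sum] at h2
  have h3 : ∑ i, ∑ k, max (d k - d (g i)) 0 = ∑ i, ∑ k, max (d i - d k) 0 := by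
    rw [Equiv.sum_comp g (fun j => ∑ k, max (d k - d j) 0), Finset.sum_comm]
  rw [h3] at h2
  rw [div_mul_eq_mul_div, le_div_iff₀ hn']
  linarith

theorem Psi_prod_le {n : ℕ} (hn : 0 < n) (π : Equiv.Perm (Fin n)) (hπ : IsDerangement π)
    (d : Fin n → ℝ) :
    ∏ i, Psi (KK π i) d (d i) ≤
      ENNReal.ofReal (Real.exp (-((1 - 2 / n) * ∑ i, ∑ k, max (d i - d k) 0))) := by
  calc _ ≤ ∏ i, ENNReal.ofReal (Real.exp (-∑ k ∈ KK π i, max (d i - d k) 0)) :=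
        Finset.prod_le_prod' fun i _ => Psi_le _ _ _
    _ = ENNReal.ofReal (Real.exp (-∑ i, ∑ k ∈ KK π i, max (d i - d k) 0)) := by
        rw [← ENNReal.ofReal_prod_of_nonneg fun _ _ => (Real.exp_pos _).le, ← Real.exp_sum,
          Finset.sum_neg_distrib]
    _ ≤ _ := by
        apply ENNReal.ofReal_le_ofReal
        apply Real.exp_le_exp.2
        have h1 := avg_ineq hn d π.symm
        have h2 : ∀ i, ∑ k ∈ KK π i, max (d i - d k) 0 =
            ∑ k, max (d i - d k) 0 - max (d i - d (π.symm i)) 0 := by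
          intro i
          rw [KK_eq, Finset.sum_erase_eq_sub, Finset.sum_erase_eq_sub (mem_univ _)]
          · simp
          · rw [mem_erase]
            refine ⟨fun h => hπ i ?_, mem_univ _⟩
            rw [Equiv.symm_apply_eq] at h; exact h.symm
        simp only [h2, Finset.sum_sub_distrib]
        linarith

noncomputable def gam (N : ℕ) (m : ℕ) : ℝ :=
  (1 - 2 / ((N:ℝ)+1)) * (((m:ℝ)+1) * (N - m)) - ((N:ℝ)+1) / 8

theorem chamber_pt {N : ℕ} (π : Equiv.Perm (Fin (N+1))) (hπ : IsDerangement π)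
    (σ : Equiv.Perm (Fin (N+1))) (d : Fin (N+1) → ℝ)
    (hd : ∀ m : Fin N, d (σ m.castSucc) ≤ d (σ m.succ)) :
    ∏ i, Psi (KK π i) d (d i) ≤ ENNReal.ofReal (Real.exp (-(Qch N (gam N) (d ∘ σ)) -
      ((N:ℝ)+1)/8 * (d (σ (Fin.last N)) - d (σ 0)))) := by
  refine (Psi_prod_le (by omega) π hπ d).trans ?_
  apply ENNReal.ofReal_le_ofReal
  apply Real.exp_le_exp.2
  have e0 : ∑ i, ∑ k, max (d i - d k) 0 = ∑ i, ∑ k, max (d (σ i) - d (σ k)) 0 := by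
    rw [← Equiv.sum_comp σ]
    refine Finset.sum_congr rfl fun i _ => ?_
    rw [← Equiv.sum_comp σ]
  set b : ℕ → ℝ := fun i => if h : i < N + 1 then d (σ ⟨i, h⟩) else d (σ (Fin.last N)) with hb
  have hbf : ∀ i : Fin (N+1), d (σ i) = b i := by
    intro i; simp only [hb, i.2, dif_pos]
  have hbstep : ∀ i, i < N → b i ≤ b (i+1) := by
    intro i hi
    have := hd ⟨i, hi⟩
    rw [hbf, hbf] at this
    simpa using this
  have hmono : ∀ i j, i ≤ j → j ≤ N → b i ≤ b j := by
    intro i j hij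
    induction j, hij using Nat.le_induction with
    | base => intro _; exact le_rfl
    | succ j hj ih => intro hN; exact (ih (by omega)).trans (hbstep j (by omega))
  have e1 : ∑ i, ∑ k, max (d (σ i) - d (σ k)) 0 =
      ∑ i ∈ range (N+1), ∑ k ∈ range (N+1), max (b i - b k) 0 := by
    simp only [hbf]
    rw [← Fin.sum_univ_eq_sum_range (fun i => ∑ k ∈ range (N+1), max (b i - b k) 0)]
    refine Finset.sum_congr rfl fun i _ => ?_
    rw [← Fin.sum_univ_eq_sum_range (fun k => max (b i - b k) 0)]
  have e2 : Qch N (gam N) (d ∘ σ) = ∑ m ∈ range N, gam N m * (b (m+1) - b m) := by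
    unfold Qch
    rw [← Fin.sum_univ_eq_sum_range (fun m => gam N m * (b (m+1) - b m))]
    refine Finset.sum_congr rfl fun m _ => ?_
    simp only [Function.comp, hbf, Fin.val_succ, Fin.val_castSucc]
  have e3 : d (σ (Fin.last N)) - d (σ 0) = ∑ m ∈ range N, (b (m+1) - b m) := by
    rw [Finset.sum_range_sub, hbf, hbf]; simp
  rw [e0, e1, chain_identity b N hmono, e2, e3]
  apply le_of_eq
  rw [Finset.mul_sum, Finset.mul_sum, ← Finset.sum_neg_distrib, ← Finset.sum_neg_distrib,
    ← Finset.sum_sub_distrib]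
  refine Finset.sum_congr rfl fun m _ => ?_
  unfold gam
  push_cast
  ring

theorem base_ge (N m : ℕ) (hm : m < N) : (N:ℝ) ≤ ((m:ℝ)+1) * (N - m) := by
  have h1 : (m:ℝ) + 1 ≤ N := by exact_mod_cast hm
  have h2 : (0:ℝ) ≤ m := by positivity
  nlinarith

theorem gam_inv (N m : ℕ) (hN : 7 ≤ N) (hm : m < N) :
    0 < gam N m ∧ 1 / gam N m ≤ 1 / (((m:ℝ)+1) * (N - m)) *
      Real.exp (4 / ((N:ℝ)+1) + (1 / ((m:ℝ)+1) + 1 / (N - m)) / 4) := by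
  set A := ((m:ℝ)+1) * (N - m) with hA
  have hA1 := base_ge N m hm
  have hN' : (7:ℝ) ≤ N := by exact_mod_cast hN
  have hA0 : 0 < A := by linarith
  set x := 2 / ((N:ℝ)+1) + ((N:ℝ)+1) / (8 * A) with hx
  have hx1 : 2 / ((N:ℝ)+1) ≤ 1/4 := by rw [div_le_iff₀ (by linarith)]; linarith
  have hx2 : ((N:ℝ)+1) / (8 * A) ≤ 1/4 := by rw [div_le_iff₀ (by linarith)]; linarith
  have hx0 : 0 ≤ x := by positivity
  have hg : gam N m = A * (1 - x) := by
    unfold gam; rw [hx]; field_simp; ring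
  have hexp : Real.exp (-(2 * x)) ≤ 1 - x := by
    have := pow_one_sub_le
    rw [Real.exp_neg, inv_le_comm₀ (Real.exp_pos _) (by linarith)]
    have := Real.quadratic_le_exp_of_nonneg (show (0:ℝ) ≤ 2 * x by linarith)
    refine le_trans ?_ this
    rw [inv_le_iff_one_le_mul₀ (by linarith)]
    nlinarith [mul_nonneg hx0 hx0]
  have e : 4 / ((N:ℝ)+1) + (1 / ((m:ℝ)+1) + 1 / (N - m)) / 4 = 2 * x := by
    have h1 : (m:ℝ) + 1 ≠ 0 := by positivity
    have h2 : (N:ℝ) - m ≠ 0 := by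
      have : (m:ℝ) < N := by exact_mod_cast hm
      linarith
    rw [hx, hA]; field_simp; ring
  rw [e, hg]
  refine ⟨mul_pos hA0 (by linarith), ?_⟩
  rw [one_div_mul_eq_div, div_le_div_iff₀ (mul_pos hA0 (by linarith)) hA0]
  have : Real.exp (2*x) * (1 - x) ≥ 1 := by
    have h3 : Real.exp (2*x) * Real.exp (-(2*x)) = 1 := by rw [← Real.exp_add]; simp
    have := mul_le_mul_of_nonneg_left hexp (Real.exp_pos (2*x)).le
    linarith
  nlinarith

theorem fact_prod (N : ℕ) : ∏ m ∈ range N, (((m:ℝ)+1) * (N - m)) = (N.factorial : ℝ)^2 := by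
  rw [Finset.prod_mul_distrib]
  have h1 : ∏ m ∈ range N, ((m:ℝ)+1) = N.factorial := by
    rw [← Finset.prod_range_add_one_eq_factorial]; push_cast; rfl
  have h2 : ∏ m ∈ range N, ((N:ℝ) - m) = N.factorial := by
    rw [← h1, ← Finset.prod_range_reflect]
    refine Finset.prod_congr rfl fun m hm => ?_
    have := mem_range.1 hm
    rw [Nat.sub_sub, Nat.cast_sub (by omega)]
    push_cast; ring
  rw [h1, h2]; ring

theorem gam_prod (N : ℕ) (hN : 7 ≤ N) :
    (((N+1).factorial : ℕ) : ENNReal)^2 * ∏ m ∈ range N, ENNReal.ofReal (1 / gam N m) ≤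
      ENNReal.ofReal (Real.exp 5 * ((N:ℝ)+1)^3) := by
  have hpos : ∀ m ∈ range N, 0 ≤ 1 / gam N m := fun m hm =>
    (one_div_pos.2 (gam_inv N m hN (mem_range.1 hm)).1).le
  rw [← ENNReal.ofReal_prod_of_nonneg hpos]
  rw [← ENNReal.ofReal_natCast, ← ENNReal.ofReal_pow (by positivity), ← ENNReal.ofReal_mul (by positivity)]
  apply ENNReal.ofReal_le_ofReal
  have h1 : ∏ m ∈ range N, (1 / gam N m) ≤ ∏ m ∈ range N, (1 / (((m:ℝ)+1) * (N - m)) *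
      Real.exp (4 / ((N:ℝ)+1) + (1 / ((m:ℝ)+1) + 1 / (N - m)) / 4)) :=
    Finset.prod_le_prod hpos fun m hm => (gam_inv N m hN (mem_range.1 hm)).2
  have hharm : ∑ m ∈ range N, 1 / ((m:ℝ)+1) ≤ 1 + Real.log ((N:ℝ)+1) := by
    have h := harmonic_le_one_add_log N
    have e : ((harmonic N : ℚ) : ℝ) = ∑ m ∈ range N, 1 / ((m:ℝ)+1) := by
      unfold harmonic; push_cast; simp
    rw [e] at h
    refine h.trans ?_
    have : Real.log N ≤ Real.log ((N:ℝ)+1) := by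
      apply Real.log_le_log
      · have : (7:ℝ) ≤ N := by exact_mod_cast hN
        linarith
      · linarith
    linarith
  have hharm2 : ∑ m ∈ range N, 1 / ((N:ℝ) - m) = ∑ m ∈ range N, 1 / ((m:ℝ)+1) := by
    rw [← Finset.sum_range_reflect]
    refine Finset.sum_congr rfl fun m hm => ?_
    have := mem_range.1 hm
    rw [Nat.sub_sub, Nat.cast_sub (by omega)]
    push_cast; ring
  have hlog : 0 ≤ Real.log ((N:ℝ)+1) := Real.log_nonneg (by linarith [show (0:ℝ) ≤ N by positivity])
  have h2 : ∏ m ∈ range N, Real.exp (4 / ((N:ℝ)+1) + (1 / ((m:ℝ)+1) + 1 / (N - m)) / 4) ≤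
      Real.exp 5 * ((N:ℝ)+1) := by
    rw [← Real.exp_sum, Finset.sum_add_distrib, Finset.sum_const, card_range, nsmul_eq_mul]
    rw [← Finset.sum_div, Finset.sum_add_distrib, hharm2]
    have e : Real.exp 5 * ((N:ℝ)+1) = Real.exp (5 + Real.log ((N:ℝ)+1)) := by
      rw [Real.exp_add, Real.exp_log (by positivity)]
    rw [e]
    apply Real.exp_le_exp.2
    have : (N:ℝ) * (4 / ((N:ℝ)+1)) ≤ 4 := by
      rw [mul_div_assoc', div_le_iff₀ (by positivity)]; linarith
    linarith
  rw [Finset.prod_mul_distrib] at h1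
  have h3 : ∏ m ∈ range N, 1 / (((m:ℝ)+1) * (N - m)) = 1 / (N.factorial : ℝ)^2 := by
    rw [← fact_prod, Finset.prod_div_distrib, Finset.prod_const_one]
  rw [h3] at h1
  have hf : (0:ℝ) < N.factorial := by exact_mod_cast N.factorial_pos
  calc ((N+1).factorial : ℝ)^2 * ∏ m ∈ range N, (1 / gam N m)
      ≤ ((N+1).factorial : ℝ)^2 * (1 / (N.factorial : ℝ)^2 * (Real.exp 5 * ((N:ℝ)+1))) := by
        gcongr
        exact h1.trans (by gcongr)
    _ = _ := by
        rw [Nat.factorial_succ]; push_cast; field_simp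


open Classical in
/-- starts whose path gives a constraint in row `i` -/
noncomputable def Sset {n : ℕ} (π : Equiv.Perm (Fin n)) (ρ : Fin n) (f : Fin n → Fin n)
    (Ls : Finset (Fin n)) (ℓ m : ℕ) (G : Fin m → Fin n × Fin (ℓ+1)) (i : Fin n) :
    Finset (Fin n) :=
  Ls.filter fun p => ∃ t, 1 ≤ t ∧ t ≤ ℓ ∧
    (∀ c, ∀ s ≤ ((G c).2:ℕ), ∀ s' ≤ t, f^[s] (G c).1 ≠ f^[s'] p) ∧
    (∀ s ≤ t, f^[s] p ≠ ρ) ∧ π p ≠ f^[t] p ∧ f^[t] p = i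

theorem Sset_sub {n : ℕ} {π : Equiv.Perm (Fin n)} {ρ : Fin n} {f : Fin n → Fin n}
    (hf : IsTreeMap ρ f) (Ls : Finset (Fin n)) (ℓ m : ℕ) (G : Fin m → Fin n × Fin (ℓ+1))
    (i : Fin n) : Sset π ρ f Ls ℓ m G i ⊆ (KK π i).erase (f i) := by
  classical
  intro p hp
  unfold Sset at hp
  rw [mem_filter] at hp
  obtain ⟨_, t, h1, h2, -, h4, h5, rfl⟩ := hp
  rw [mem_erase, mem_KK]
  refine ⟨fun h => ?_, fun h => ?_, h5⟩
  · have := tree_inj hf p t h4 0 (by omega) (t+1) le_rfl (by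
      rw [Function.iterate_succ_apply']; exact h)
    omega
  · have := tree_inj hf p t h4 0 (by omega) t (by omega) h
    omega

theorem Sset_root {n : ℕ} {π : Equiv.Perm (Fin n)} {ρ : Fin n} {f : Fin n → Fin n}
    (Ls : Finset (Fin n)) (ℓ m : ℕ) (G : Fin m → Fin n × Fin (ℓ+1)) :
    Sset π ρ f Ls ℓ m G ρ = ∅ := by
  classical
  unfold Sset
  rw [filter_eq_empty_iff]
  rintro p - ⟨t, h1, h2, -, h4, h5, h6⟩
  exact h4 t le_rfl h6

open Classical in
theorem Sset_sum {n : ℕ} {π : Equiv.Perm (Fin n)} {ρ : Fin n} {f : Fin n → Fin n}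
    (hf : IsTreeMap ρ f) (Ls : Finset (Fin n)) (ℓ m : ℕ) (hm : 1 ≤ m)
    (G : Fin m → Fin n × Fin (ℓ+1))
    (hBT : ∀ v, 2 * (m * (ℓ+1)) * NN f {v, ρ} ℓ ≤ Ls.card) :
    Ls.card * (ℓ - 1) ≤ 2 * ∑ i, (Sset π ρ f Ls ℓ m G i).card := by
  set V : Finset (Fin n) := univ.image (fun x : Fin m × Fin (ℓ+1) => f^[(x.2:ℕ)] (G x.1).1) with hV
  have hVc : V.card ≤ m * (ℓ+1) := by
    refine card_image_le.trans ?_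
    simp
  have hVne : V.Nonempty := by
    refine ⟨f^[0] (G ⟨0, by omega⟩).1, ?_⟩
    rw [hV, mem_image]
    exact ⟨(⟨0, by omega⟩, 0), mem_univ _, rfl⟩
  set Hs := Ls.filter fun p => Hit f (insert ρ V) ℓ p with hHs
  have hH : 2 * Hs.card ≤ Ls.card := by
    have h1 : Hs ⊆ V.biUnion fun v => univ.filter fun x => Hit f {v, ρ} ℓ x := by
      intro p hp
      rw [hHs, mem_filter] at hp
      obtain ⟨_, s, hs, hsV⟩ := hp
      rw [mem_biUnion]
      rcases mem_insert.1 hsV with h | h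
      · obtain ⟨v, hv⟩ := hVne
        exact ⟨v, hv, mem_filter.2 ⟨mem_univ _, s, hs, by simp [h]⟩⟩
      · exact ⟨_, h, mem_filter.2 ⟨mem_univ _, s, hs, by simp⟩⟩
    have h2 : Hs.card ≤ ∑ v ∈ V, NN f {v, ρ} ℓ := by
      refine (card_le_card h1).trans (card_biUnion_le.trans (le_of_eq ?_))
      refine sum_congr rfl fun v _ => ?_
      unfold NN; congr
    have h3 : (m * (ℓ+1)) * (2 * Hs.card) ≤ (m * (ℓ+1)) * Ls.card := by
      calc (m * (ℓ+1)) * (2 * Hs.card) = 2 * (m * (ℓ+1)) * Hs.card := by ring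
        _ ≤ 2 * (m * (ℓ+1)) * ∑ v ∈ V, NN f {v, ρ} ℓ := Nat.mul_le_mul_left _ h2
        _ = ∑ v ∈ V, 2 * (m * (ℓ+1)) * NN f {v, ρ} ℓ := by rw [mul_sum]
        _ ≤ ∑ v ∈ V, Ls.card := sum_le_sum fun v _ => hBT v
        _ = V.card * Ls.card := by simp
        _ ≤ _ := Nat.mul_le_mul_right _ hVc
    exact Nat.le_of_mul_le_mul_left h3 (by positivity)
  have hgood : ∀ p ∈ Ls \ Hs, ℓ - 1 ≤ (univ.filter fun i => p ∈ Sset π ρ f Ls ℓ m G i).card := by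
    intro p hp
    rw [mem_sdiff] at hp
    have hnh : ¬ Hit f (insert ρ V) ℓ p := fun h => hp.2 (mem_filter.2 ⟨hp.1, h⟩)
    have hnh' : ∀ s ≤ ℓ, f^[s] p ∉ insert ρ V := fun s hs h => hnh ⟨s, hs, h⟩
    have hρ : ∀ s ≤ ℓ, f^[s] p ≠ ρ := fun s hs h => hnh' s hs (by simp [h])
    have hinj : Set.InjOn (fun t => f^[t] p) (Icc 1 ℓ : Finset ℕ) := by
      intro a ha b hb hab
      rw [mem_coe, mem_Icc] at ha hb
      exact tree_inj hf p ℓ hρ a (by omega) b (by omega) hab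
    have hc : ((Icc 1 ℓ).image fun t => f^[t] p).card = ℓ := by
      rw [card_image_of_injOn hinj]; simp
    have hsub : ((Icc 1 ℓ).image fun t => f^[t] p).erase (π p) ⊆
        univ.filter fun i => p ∈ Sset π ρ f Ls ℓ m G i := by
      intro i hi
      rw [mem_erase, mem_image] at hi
      obtain ⟨hi1, t, ht, rfl⟩ := hi
      rw [mem_Icc] at ht
      rw [mem_filter]
      refine ⟨mem_univ _, ?_⟩
      unfold Sset
      rw [mem_filter]
      refine ⟨hp.1, t, ht.1, ht.2, ?_, fun s hs => hρ s (hs.trans ht.2), hi1.symm, rfl⟩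
      intro c s hs s' hs' h
      apply hnh' s' (hs'.trans ht.2)
      rw [mem_insert]; right
      rw [hV, mem_image]
      exact ⟨(c, ⟨s, by have := (G c).2.2; omega⟩), mem_univ _, h⟩
    have h1 := card_le_card hsub
    have h2 := pred_card_le_card_erase (s := (Icc 1 ℓ).image fun t => f^[t] p) (a := π p)
    omega
  have hswap : ∑ i, (Sset π ρ f Ls ℓ m G i).card =
      ∑ p, (univ.filter fun i => p ∈ Sset π ρ f Ls ℓ m G i).card := by
    simp only [card_eq_sum_ones, sum_filter]
    rw [sum_comm]
    refine sum_congr rfl fun i _ => ?_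
    simp
  have h4 : (Ls \ Hs).card * (ℓ - 1) ≤ ∑ i, (Sset π ρ f Ls ℓ m G i).card := by
    rw [hswap, ← smul_eq_mul]
    refine (card_nsmul_le_sum _ _ _ hgood).trans ?_
    exact sum_le_univ_sum_of_nonneg fun _ => Nat.zero_le _
  have h5 : (Ls \ Hs).card = Ls.card - Hs.card := card_sdiff_of_subset (filter_subset _ _)
  calc Ls.card * (ℓ - 1) ≤ (2 * (Ls \ Hs).card) * (ℓ - 1) := Nat.mul_le_mul_right _ (by omega)
    _ = 2 * ((Ls \ Hs).card * (ℓ - 1)) := by ring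
    _ ≤ _ := Nat.mul_le_mul_left _ h4

/-- row penalties -/
noncomputable def eS {n : ℕ} (π : Equiv.Perm (Fin n)) (ρ : Fin n) (f : Fin n → Fin n)
    (Ls : Finset (Fin n)) (ℓ m : ℕ) (δ' : ℝ) (G : Fin m → Fin n × Fin (ℓ+1)) (i : Fin n)
    (k : Fin n) : ℝ := if k ∈ Sset π ρ f Ls ℓ m G i then δ' else 0

/-- the row event -/
def RowC {n : ℕ} (π : Equiv.Perm (Fin n)) (ρ : Fin n) (f : Fin n → Fin n)
    (Ls : Finset (Fin n)) (ℓ m : ℕ) (δ' : ℝ) (G : Fin m → Fin n × Fin (ℓ+1))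
    (d : Fin n → ℝ) (i : Fin n) : Set (Fin n → ℝ) :=
  if i = ρ then {c | ∀ k ∈ KK π ρ, d ρ ≤ c k + d k}
  else RowE (KK π i) d (d i) (f i) (eS π ρ f Ls ℓ m δ' G i)

def CondS {n : ℕ} (π : Equiv.Perm (Fin n)) (ρ : Fin n) (f : Fin n → Fin n)
    (Ls : Finset (Fin n)) (ℓ m : ℕ) (δ' : ℝ) (d : Fin n → ℝ) : Set (Fin n → Fin n → ℝ) :=
  {R | ∃ G : Fin m → Fin n × Fin (ℓ+1), ∀ i, R i ∈ RowC π ρ f Ls ℓ m δ' G d i}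

/-- unnormalised transition weights -/
noncomputable def ZZ {n : ℕ} (π : Equiv.Perm (Fin n)) (ρ : Fin n) (d : Fin n → ℝ)
    (i j : Fin n) : ENNReal :=
  if i = ρ then (if j = ρ then Psi (KK π ρ) d (d ρ) else 0)
  else if j ∈ KK π i then (Measure.pi fun _ => U1) (RowE (KK π i) d (d i) j 0) else 0

theorem ZZ_sum {n : ℕ} (hn : 3 ≤ n) {π : Equiv.Perm (Fin n)} (hπ : IsDerangement π) (ρ : Fin n)
    (d : Fin n → ℝ) (i : Fin n) : ∑ j, ZZ π ρ d i j = Psi (KK π i) d (d i) := by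
  unfold ZZ
  by_cases h : i = ρ
  · subst h; simp
  · simp only [h, if_false]
    rw [← row_sum (KK π i) (by rw [← card_pos, KK_card hπ]; omega)]
    rw [sum_ite_mem, univ_inter]

/-- row law -/
noncomputable def rowM (n : ℕ) : Measure (Fin n → Fin n → ℝ) :=
  Measure.pi fun _ => Measure.pi fun _ => U1

/-- valid trees -/
def VT {n : ℕ} (π : Equiv.Perm (Fin n)) (ρ : Fin n) (f : Fin n → Fin n) : Prop :=
  IsTreeMap ρ f ∧ ∀ i, i ≠ ρ → f i ∈ KK π i

theorem RowC_le {n : ℕ} {π : Equiv.Perm (Fin n)} {ρ : Fin n} {f : Fin n → Fin n}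
    (hf : VT π ρ f) (Ls : Finset (Fin n)) (ℓ m : ℕ) {δ' : ℝ} (hδ : 0 ≤ δ')
    (G : Fin m → Fin n × Fin (ℓ+1)) (d : Fin n → ℝ) (i : Fin n) :
    ∀ x ∈ RowC π ρ f Ls ℓ m δ' G d i, x ∈ (if i = ρ then {c | ∀ k ∈ KK π ρ, d ρ ≤ c k + d k}
      else RowE (KK π i) d (d i) (f i) 0) := by
  intro x hx
  unfold RowC at hx
  split_ifs with h
  · simpa [h] using hx
  · simp only [h, if_false] at hx
    refine ⟨hx.1, fun k hk => ?_⟩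
    have := hx.2 k hk
    have he : 0 ≤ eS π ρ f Ls ℓ m δ' G i k := by unfold eS; split_ifs <;> simp [hδ]
    simp only [Pi.zero_apply, add_zero]
    linarith

theorem CondS_le {n : ℕ} {π : Equiv.Perm (Fin n)} {ρ : Fin n} {f : Fin n → Fin n}
    (hf : VT π ρ f) (Ls : Finset (Fin n)) (ℓ m : ℕ) {δ' : ℝ} (hδ : 0 ≤ δ') (d : Fin n → ℝ) :
    rowM n (CondS π ρ f Ls ℓ m δ' d) ≤ ∏ i, ZZ π ρ d i (f i) := by
  have : CondS π ρ f Ls ℓ m δ' d ⊆ Set.univ.pi fun i =>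
      (if i = ρ then {c | ∀ k ∈ KK π ρ, d ρ ≤ c k + d k}
      else RowE (KK π i) d (d i) (f i) 0) := by
    rintro R ⟨G, hG⟩ i -
    exact RowC_le hf Ls ℓ m hδ G d i _ (hG i)
  refine (measure_mono this).trans ?_
  unfold rowM
  rw [Measure.pi_pi]
  apply le_of_eq
  refine prod_congr rfl fun i _ => ?_
  unfold ZZ
  by_cases h : i = ρ
  · subst h
    simp only [if_true, hf.1.1, Psi_measure]
  · simp only [h, if_false, hf.2 i h, if_true]

open Classical in
theorem CondS_sum {n : ℕ} (hn : 3 ≤ n) {π : Equiv.Perm (Fin n)} (hπ : IsDerangement π)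
    (ρ : Fin n) (Ls : Finset (Fin n)) (ℓ m : ℕ) {δ' : ℝ} (hδ : 0 ≤ δ') (d : Fin n → ℝ) :
    ∑ f ∈ univ.filter (VT π ρ), rowM n (CondS π ρ f Ls ℓ m δ' d) ≤
      ∏ i, Psi (KK π i) d (d i) := by
  calc _ ≤ ∑ f ∈ univ.filter (VT π ρ), ∏ i, ZZ π ρ d i (f i) :=
        sum_le_sum fun f hf => CondS_le (mem_filter.1 hf).2 Ls ℓ m hδ d
    _ ≤ ∑ f : Fin n → Fin n, ∏ i, ZZ π ρ d i (f i) :=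
        sum_le_sum_of_subset (subset_univ _)
    _ = ∏ i, ∑ j, ZZ π ρ d i j := by
        rw [prod_univ_sum]; simp
    _ = _ := prod_congr rfl fun i _ => ZZ_sum hn hπ ρ d i

theorem CondS_small {n : ℕ} (hn : 3 ≤ n) {π : Equiv.Perm (Fin n)} (hπ : IsDerangement π)
    {ρ : Fin n} {f : Fin n → Fin n}
    (hf : VT π ρ f) (Ls : Finset (Fin n)) (ℓ m : ℕ) (hm : 1 ≤ m) {δ' t0 : ℝ} (hδ : 0 ≤ δ')
    (hδn : δ' * n ≤ 1) (ht0 : 0 ≤ t0) (ht1 : t0 ≤ 1/2) (hLt : (Ls.card:ℝ) * t0 ≤ 1/4)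
    (d : Fin n → ℝ) (hr : ∀ i k, d i - d k ≤ t0) (k0 : Fin n) (hL1 : ∀ k ∈ Ls, d k ≤ d k0)
    (hL2 : ∀ k ∉ Ls, d k0 ≤ d k)
    (hBT : ∀ v, 2 * (m * (ℓ+1)) * NN f {v, ρ} ℓ ≤ Ls.card) :
    rowM n (CondS π ρ f Ls ℓ m δ' d) ≤
      ((n * (ℓ+1) : ℕ) : ENNReal)^m * ENNReal.ofReal (Real.exp (-(δ' / (2 * (8 * n * t0 + 1)) *
        ((Ls.card * (ℓ-1) : ℕ) / 2)))) * ∏ i, ZZ π ρ d i (f i) := by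
  have hn1 : (1:ℝ) ≤ n := by exact_mod_cast (by omega : 1 ≤ n)
  have hδ1 : δ' ≤ 1 := by nlinarith
  set κ := δ' / (2 * (8 * n * t0 + 1)) with hκ
  have hκ0 : 0 ≤ κ := by positivity
  have hU : CondS π ρ f Ls ℓ m δ' d ⊆ ⋃ G ∈ (univ : Finset (Fin m → Fin n × Fin (ℓ+1))),
      Set.univ.pi (RowC π ρ f Ls ℓ m δ' G d) := by
    rintro R ⟨G, hG⟩
    simp only [Set.mem_iUnion]
    exact ⟨G, mem_univ _, fun i _ => hG i⟩
  refine (measure_mono hU).trans ((measure_biUnion_finset_le _ _).trans ?_)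
  have hG : ∀ G : Fin m → Fin n × Fin (ℓ+1), rowM n (Set.univ.pi (RowC π ρ f Ls ℓ m δ' G d)) ≤
      ENNReal.ofReal (Real.exp (-(κ * ((Ls.card * (ℓ-1) : ℕ) / 2)))) *
        ∏ i, ZZ π ρ d i (f i) := by
    intro G
    unfold rowM
    rw [Measure.pi_pi]
    have h1 : ∀ i, (Measure.pi fun _ => U1) (RowC π ρ f Ls ℓ m δ' G d i) ≤
        ENNReal.ofReal (Real.exp (-(κ * (Sset π ρ f Ls ℓ m G i).card))) * ZZ π ρ d i (f i) := by
      intro i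
      by_cases h : i = ρ
      · subst h
        unfold RowC ZZ
        rw [Sset_root]
        simp only [if_true, hf.1.1, Psi_measure]
        simp
      · unfold RowC ZZ
        simp only [h, if_false, hf.2 i h, if_true]
        unfold eS
        have hSn : ((Sset π ρ f Ls ℓ m G i).card : ℝ) ≤ n := by
          have := card_le_univ (Sset π ρ f Ls ℓ m G i)
          rw [Fintype.card_fin] at this
          exact_mod_cast this
        have hSL : Sset π ρ f Ls ℓ m G i ⊆ Ls := by
          classical
          unfold Sset; exact filter_subset _ _
        exact row_S (KK π i) d (d i) t0 (d k0) δ' n (by omega) (by rw [KK_card hπ]; omega) ht0 ht1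
          (hr _ _) (fun k => hr _ _) Ls hL2 hLt (f i) _ (Sset_sub hf.1 Ls ℓ m G i)
          (fun k hk => hL1 k (hSL hk)) hδ hδ1 ((mul_le_mul_of_nonneg_left hSn hδ).trans hδn)
    refine (prod_le_prod' fun i _ => h1 i).trans ?_
    rw [prod_mul_distrib, ← ENNReal.ofReal_prod_of_nonneg fun i _ => (Real.exp_pos _).le,
      ← Real.exp_sum]
    gcongr
    rw [sum_neg_distrib, ← mul_sum, neg_le_neg_iff]
    gcongr
    have := Sset_sum (π := π) hf.1 Ls ℓ m hm G hBT
    have h2 : ((Ls.card * (ℓ-1) : ℕ) : ℝ) ≤ ((2 * ∑ i, (Sset π ρ f Ls ℓ m G i).card : ℕ) : ℝ) := by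
      exact_mod_cast this
    rw [div_le_iff₀ (by norm_num)]
    refine h2.trans (le_of_eq ?_)
    push_cast; ring
  refine (sum_le_sum fun G _ => hG G).trans (le_of_eq ?_)
  rw [sum_const, nsmul_eq_mul, card_univ]
  simp [mul_assoc]

/-- the error factor -/
noncomputable def etaB (n ℓ m h r : ℕ) (q : ENNReal) (κ : ℝ) : ENNReal :=
  n * (((2 * (m * (ℓ+1)) : ℕ) : ENNReal) / h *
    (((2 + r * ℓ : ℕ) : ENNReal) * (1 + n * ℓ * q)))^r +
  ((n * (ℓ+1) : ℕ) : ENNReal)^m * ENNReal.ofReal (Real.exp (-(κ * ((h * (ℓ-1) : ℕ) / 2))))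

open Classical in
theorem CondS_sum_small {n : ℕ} (hn : 3 ≤ n) {π : Equiv.Perm (Fin n)} (hπ : IsDerangement π)
    (ρ : Fin n) (Ls : Finset (Fin n)) (ℓ m r : ℕ) (hm : 1 ≤ m) {δ' t0 y0 : ℝ} (hδ : 0 ≤ δ')
    (hδn : δ' * n ≤ 1) (ht0 : 0 ≤ t0) (ht1 : t0 ≤ 1/2) (hy0 : 0 ≤ y0) (hy1 : y0 ≤ 1)
    (hLt : (Ls.card:ℝ) * t0 ≤ 1/4) (hL0 : 0 < Ls.card)
    (d : Fin n → ℝ) (hr : ∀ i k, d i - d k ≤ t0) (k0 : Fin n) (hL1 : ∀ k ∈ Ls, d k ≤ d k0)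
    (hL2 : ∀ k ∉ Ls, d k0 ≤ d k) :
    ∑ f ∈ univ.filter (VT π ρ), rowM n (CondS π ρ f Ls ℓ m δ' d) ≤
      etaB n ℓ m Ls.card r (ENNReal.ofReal (2 * (t0 + y0 + (1 - y0)^(n-3))))
        (δ' / (2 * (8 * n * t0 + 1))) * ∏ i, Psi (KK π i) d (d i) := by
  set q := ENNReal.ofReal (2 * (t0 + y0 + (1 - y0)^(n-3))) with hq
  set A := ((n * (ℓ+1) : ℕ) : ENNReal)^m * ENNReal.ofReal (Real.exp (-(δ' / (2 * (8 * n * t0 + 1)) *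
        ((Ls.card * (ℓ-1) : ℕ) / 2)))) with hA
  have hΨ0 : ∀ i, Psi (KK π i) d (d i) ≠ 0 := by
    intro i
    unfold Psi
    rw [prod_ne_zero_iff]
    intro k _
    rw [phi_eq]
    have h1 := hr i k
    have : max (d i - d k) 0 ≤ t0 := max_le h1 ht0
    rw [Ne, ENNReal.ofReal_eq_zero]
    linarith
  have hΨt : ∀ i, Psi (KK π i) d (d i) ≠ ⊤ := by
    intro i
    refine ne_top_of_le_ne_top ENNReal.ofReal_ne_top (Psi_le _ _ _)
  set p : Fin n → Fin n → ENNReal := fun i j => ZZ π ρ d i j / Psi (KK π i) d (d i) with hp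
  have hp1 : ∀ i, ∑ j, p i j = 1 := by
    intro i
    simp only [hp, div_eq_mul_inv]
    rw [← sum_mul, ZZ_sum hn hπ, ENNReal.mul_inv_cancel (hΨ0 i) (hΨt i)]
  have hpq : ∀ i, i ≠ ρ → ∀ j, p i j ≤ q := by
    intro i hi j
    simp only [hp]
    unfold ZZ
    simp only [hi, if_false]
    split_ifs with hj
    · refine ENNReal.div_le_of_le_mul ?_
      have := row_q (KK π i) d (d i) t0 y0 ht0 ht1 hy0 hy1
        (fun k _ => by rw [abs_le]; constructor <;> linarith [hr i k, hr k i]) j hj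
      rwa [KK_card hπ, Nat.sub_sub] at this
    · simp
  have hpZ : ∀ f : Fin n → Fin n, ∏ i, ZZ π ρ d i (f i) =
      (∏ i, Psi (KK π i) d (d i)) * ∏ i, p i (f i) := by
    intro f
    rw [← prod_mul_distrib]
    refine prod_congr rfl fun i _ => ?_
    simp only [hp]
    rw [ENNReal.mul_div_cancel (hΨ0 i) (hΨt i)]
  set c : ENNReal := ((2 * (m * (ℓ+1)) : ℕ) : ENNReal) / Ls.card with hc
  set BTi : (Fin n → Fin n) → ENNReal := fun f => ∑ v, c^r * (NN f {v, ρ} ℓ : ENNReal)^r with hBTi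
  have hpt : ∀ f ∈ univ.filter (VT π ρ), rowM n (CondS π ρ f Ls ℓ m δ' d) ≤
      (∏ i, ZZ π ρ d i (f i)) * (BTi f + A) := by
    intro f hf
    have hf' := (mem_filter.1 hf).2
    by_cases hBT : ∀ v, 2 * (m * (ℓ+1)) * NN f {v, ρ} ℓ ≤ Ls.card
    · refine (CondS_small hn hπ hf' Ls ℓ m hm hδ hδn ht0 ht1 hLt d hr k0 hL1 hL2 hBT).trans ?_
      rw [mul_comm]
      gcongr
      exact le_add_self
    · push Not at hBT
      obtain ⟨v, hv⟩ := hBT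
      refine (CondS_le hf' Ls ℓ m hδ d).trans ?_
      have h1 : (1:ENNReal) ≤ BTi f := by
        refine le_trans ?_ (single_le_sum (f := fun v => c^r * (NN f {v, ρ} ℓ : ENNReal)^r)
          (fun _ _ => zero_le) (mem_univ v))
        rw [← mul_pow]
        apply one_le_pow₀
        rw [hc, mul_comm, ← mul_div_assoc, ENNReal.le_div_iff_mul_le (Or.inl (by exact_mod_cast hL0.ne')) (Or.inl (ENNReal.natCast_ne_top _)), one_mul]
        rw [mul_comm]
        exact_mod_cast hv.le
      calc _ = (∏ i, ZZ π ρ d i (f i)) * 1 := (mul_one _).symm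
        _ ≤ _ := by gcongr; exact h1.trans le_self_add
  calc _ ≤ ∑ f ∈ univ.filter (VT π ρ), (∏ i, ZZ π ρ d i (f i)) * (BTi f + A) := sum_le_sum hpt
    _ ≤ ∑ f : Fin n → Fin n, (∏ i, ZZ π ρ d i (f i)) * (BTi f + A) :=
        sum_le_sum_of_subset (subset_univ _)
    _ = (∏ i, Psi (KK π i) d (d i)) * EE p (fun f => BTi f + A * 1) := by
        unfold EE
        rw [mul_sum]
        refine sum_congr rfl fun f _ => ?_
        rw [hpZ, mul_assoc, mul_one]
    _ ≤ (∏ i, Psi (KK π i) d (d i)) *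
        (n * (c * (((2 + r * ℓ : ℕ) : ENNReal) * (1 + n * ℓ * q)))^r + A) := by
        gcongr
        rw [EE_add p BTi (fun _ => A * 1), EE_mul p A (fun _ => 1), EE_one p hp1, mul_one]
        gcongr
        rw [hBTi, EE_sum]
        have : ∀ v ∈ (univ : Finset (Fin n)), EE p (fun f => c^r * (NN f {v, ρ} ℓ : ENNReal)^r) ≤
            (c * (((2 + r * ℓ : ℕ) : ENNReal) * (1 + n * ℓ * q)))^r := by
          intro v _
          rw [EE_mul, mul_pow c]
          gcongr
          refine (moment_bound p hp1 ρ q hpq ℓ r {v, ρ} (by simp)).trans ?_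
          rw [Fintype.card_fin]
          gcongr
          exact card_le_two
        refine (sum_le_sum this).trans (le_of_eq ?_)
        simp
    _ = _ := by rw [mul_comm]; rfl


instance instRowProb (n : ℕ) : IsProbabilityMeasure (rowM n) := by
  unfold rowM; infer_instance

/-- matrix assembled from rows and diagonal -/
def Asm {n : ℕ} (π : Equiv.Perm (Fin n)) (z : (Fin n → Fin n → ℝ) × (Fin n → ℝ)) :
    Fin n × Fin n → ℝ :=
  fun e => if π.symm e.2 = e.1 then z.2 e.1 else z.1 e.1 (π.symm e.2)

theorem measurable_Asm {n : ℕ} (π : Equiv.Perm (Fin n)) : Measurable (Asm π) := by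
  rw [measurable_pi_iff]
  intro e
  unfold Asm
  split_ifs <;> fun_prop

theorem Asm_mp {n : ℕ} (π : Equiv.Perm (Fin n)) :
    MeasurePreserving (Asm π) ((rowM n).prod (Measure.pi fun _ => U1)) (costMeasure n) := by
  refine ⟨measurable_Asm π, ?_⟩
  rw [costMeasure_eq]
  symm
  apply Measure.pi_eq
  intro s hs
  rw [Measure.map_apply (measurable_Asm π) (MeasurableSet.univ_pi hs)]
  have e : Asm π ⁻¹' (Set.univ.pi s) =
      (Set.univ.pi fun i => Set.univ.pi fun k => if k = i then Set.univ else s (i, π k)) ×ˢ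
      (Set.univ.pi fun i => s (i, π i)) := by
    ext z
    simp only [Set.mem_preimage, Set.mem_pi, Set.mem_univ, true_implies, Set.mem_prod, Asm]
    constructor
    · intro h
      refine ⟨fun i k => ?_, fun i => ?_⟩
      · by_cases hk : k = i
        · simp [hk]
        · have := h (i, π k)
          simpa [hk] using this
      · have := h (i, π i)
        simpa using this
    · rintro ⟨h1, h2⟩ ⟨i, j⟩
      by_cases hk : π.symm j = i
      · have := h2 i
        have hj : j = π i := by rw [← hk]; simp
        subst hj
        simpa using this
      · obtain ⟨k, rfl⟩ := π.surjective j
        have := h1 i k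
        simp only [Equiv.symm_apply_apply] at hk
        simpa [hk] using this
  rw [e, Measure.prod_prod]
  unfold rowM
  simp only [Measure.pi_pi]
  rw [← prod_mul_distrib, Fintype.prod_prod_type]
  refine prod_congr rfl fun i _ => ?_
  rw [← Equiv.prod_comp π (fun j => U1 (s (i, j)))]
  rw [← mul_prod_erase _ _ (mem_univ i), ← mul_prod_erase (univ : Finset (Fin n)) (fun k => U1 (s (i, π k))) (mem_univ i)]
  simp only [if_true, measure_univ, one_mul]
  rw [mul_comm]
  congr 1
  refine prod_congr rfl fun k hk => ?_
  rw [if_neg (mem_erase.1 hk).1]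

/-- linear part -/
def TM {n : ℕ} (ρ : Fin n) (f : Fin n → Fin n) : Matrix (Fin n) (Fin n) ℝ :=
  fun i j => if i = ρ then (if j = ρ then 1 else 0) else (if j = f i then 1 else 0) -
    (if j = i then 1 else 0)

theorem TM_det {n : ℕ} {ρ : Fin n} {f : Fin n → Fin n} (hf : IsTreeMap ρ f) :
    |(TM ρ f).det| = 1 := by
  obtain ⟨dep, -, hdep⟩ := exists_dist hf (fun _ _ => 1) 0
  have hfi : ∀ i, i ≠ ρ → i ≠ f i := by
    intro i hi h
    have := hdep i hi
    rw [← h] at this; linarith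
  rw [Matrix.det_apply, sum_eq_single 1]
  · simp only [Equiv.Perm.sign_one, one_smul, Equiv.Perm.one_apply]
    rw [abs_prod]
    refine prod_eq_one fun i _ => ?_
    unfold TM
    by_cases h : i = ρ
    · simp [h]
    · simp [h, hfi i h]
  · intro τ _ hτ
    have : ∃ i, τ i ≠ i := by
      by_contra! h
      exact hτ (Equiv.ext h)
    have hne : (univ.filter fun i => τ i ≠ i).Nonempty := by
      obtain ⟨i, hi⟩ := this
      exact ⟨i, by simpa using hi⟩
    obtain ⟨i, hi, hmax⟩ := exists_max_image _ dep hne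
    rw [mem_filter] at hi
    have h0 : TM ρ f (τ i) i = 0 := by
      by_contra h
      have hρ : τ i ≠ ρ ∧ i = f (τ i) := by
        unfold TM at h
        by_cases h1 : τ i = ρ
        · have : i ≠ ρ := fun h2 => hi.2 (by rw [h1, h2])
          simp [h1, this] at h
        · refine ⟨h1, ?_⟩
          by_contra h2
          simp [h1, h2, Ne.symm hi.2] at h
      have h1 := hdep (τ i) hρ.1
      rw [← hρ.2] at h1
      have h2 := hmax (τ i) (by
        rw [mem_filter]
        exact ⟨mem_univ _, fun h => hi.2 (τ.injective h)⟩)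
      linarith
    rw [prod_eq_zero (f := fun i => TM ρ f (τ i) i) (mem_univ i) h0, smul_zero]
  · simp

/-- the change of variables -/
def TT {n : ℕ} (ρ : Fin n) (f : Fin n → Fin n) (R : Fin n → Fin n → ℝ) (d : Fin n → ℝ) :
    Fin n → ℝ := fun i => if i = ρ then d ρ else R i (f i) + d (f i) - d i

theorem TT_image {n : ℕ} {ρ : Fin n} {f : Fin n → Fin n} (hf : IsTreeMap ρ f)
    (R : Fin n → Fin n → ℝ) (A : Set (Fin n → ℝ)) : volume (TT ρ f R '' A) = volume A := by
  set b : Fin n → ℝ := fun i => if i = ρ then 0 else R i (f i) with hb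
  have e : TT ρ f R = (fun x => b + x) ∘ (Matrix.toLin' (TM ρ f)) := by
    funext d i
    simp only [TT, Function.comp, Matrix.toLin'_apply, Pi.add_apply, Matrix.mulVec, dotProduct, TM, hb]
    by_cases h : i = ρ
    · simp [h]
    · simp [h, sub_mul, sum_sub_distrib]; ring
  rw [e, Set.image_comp, Set.image_add_left, measure_preimage_add, Measure.addHaar_image_linearMap,
    LinearMap.det_toLin', TM_det hf]
  simp

/-- the indices of the `h` lowest values -/
def LsS {n : ℕ} (σ : Equiv.Perm (Fin n)) (h : ℕ) : Finset (Fin n) :=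
  (univ.filter fun m : Fin n => m.val < h).map σ.toEmbedding

theorem LsS_card {n : ℕ} (σ : Equiv.Perm (Fin n)) {h : ℕ} (hh : h ≤ n) : (LsS σ h).card = h := by
  unfold LsS
  rw [card_map, Fin.card_filter_val_lt]
  omega

theorem LsS_low {n : ℕ} (σ : Equiv.Perm (Fin n)) {h : ℕ} (hh : h < n) (d : Fin n → ℝ)
    (hd : Monotone (d ∘ σ)) : (∀ k ∈ LsS σ h, d k ≤ d (σ ⟨h, hh⟩)) ∧
      ∀ k ∉ LsS σ h, d (σ ⟨h, hh⟩) ≤ d k := by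
  constructor
  · intro k hk
    unfold LsS at hk
    simp only [mem_map, mem_filter, mem_univ, true_and] at hk
    obtain ⟨m, hm, rfl⟩ := hk
    exact hd (show m ≤ ⟨h, hh⟩ from Fin.le_def.2 hm.le)
  · intro k hk
    unfold LsS at hk
    simp only [mem_map, mem_filter, mem_univ, true_and, not_exists, not_and] at hk
    have : ¬ ((σ.symm k).val < h) := fun h1 => hk _ h1 (by simp)
    have h2 := hd (show (⟨h, hh⟩ : Fin n) ≤ σ.symm k from Fin.le_def.2 (by simpa using this))
    simpa using h2

/-- `π` is optimal and there are few near optimal permutations -/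
def BB {n : ℕ} (π : Equiv.Perm (Fin n)) (m : ℕ) (δ' : ℝ) : Set (Fin n × Fin n → ℝ) :=
  {C | π ∈ NearSet 0 C ∧ (NearSet (m * δ') C).ncard < 2 ^ m}

theorem measurableSet_BB {n : ℕ} (π : Equiv.Perm (Fin n)) (m : ℕ) (δ' : ℝ) :
    MeasurableSet (BB π m δ') :=
  (measurableSet_near 0 π).inter (measurableSet_nearSet (m * δ') fun N => N.ncard < 2 ^ m)

/-- the condition in the new variables -/
def CD {n : ℕ} (π : Equiv.Perm (Fin n)) (ρ : Fin n) (h ℓ m : ℕ) (δ' : ℝ)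
    (σ : Equiv.Perm (Fin n)) (f : Fin n → Fin n) : Set ((Fin n → Fin n → ℝ) × (Fin n → ℝ)) :=
  {z | (z.2 ρ ∈ Set.Icc (0:ℝ) 1 ∧ Monotone (z.2 ∘ σ)) ∧ z.1 ∈ CondS π ρ f (LsS σ h) ℓ m δ' z.2}

theorem measurableSet_mono {n : ℕ} (ρ : Fin n) (σ : Equiv.Perm (Fin n)) :
    MeasurableSet {d : Fin n → ℝ | d ρ ∈ Set.Icc (0:ℝ) 1 ∧ Monotone (d ∘ σ)} := by
  apply MeasurableSet.inter
  · exact measurableSet_Icc.preimage (measurable_pi_apply ρ)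
  · have : {d : Fin n → ℝ | Monotone (d ∘ σ)} = ⋂ i, ⋂ j, ⋂ (_ : i ≤ j), {d | d (σ i) ≤ d (σ j)} := by
      ext d
      simp only [Set.mem_iInter]
      exact ⟨fun h i j hij => h hij, fun h i j hij => h i j hij⟩
    change MeasurableSet {d : Fin n → ℝ | Monotone (d ∘ σ)}
    rw [this]
    refine MeasurableSet.iInter fun i => MeasurableSet.iInter fun j => MeasurableSet.iInter fun _ => ?_
    exact measurableSet_le (by fun_prop) (by fun_prop)

theorem measurableSet_CD {n : ℕ} (π : Equiv.Perm (Fin n)) (ρ : Fin n) (h ℓ m : ℕ) (δ' : ℝ)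
    (σ : Equiv.Perm (Fin n)) (f : Fin n → Fin n) : MeasurableSet (CD π ρ h ℓ m δ' σ f) := by
  apply MeasurableSet.inter
  · exact (measurableSet_mono ρ σ).preimage measurable_snd
  · have : {z : (Fin n → Fin n → ℝ) × (Fin n → ℝ) | z.1 ∈ CondS π ρ f (LsS σ h) ℓ m δ' z.2} =
      ⋃ G : Fin m → Fin n × Fin (ℓ+1), ⋂ i, {z | z.1 i ∈ RowC π ρ f (LsS σ h) ℓ m δ' G z.2 i} := by
      ext z
      simp only [Set.mem_iUnion, Set.mem_iInter]
      rfl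
    change MeasurableSet {z : (Fin n → Fin n → ℝ) × (Fin n → ℝ) | z.1 ∈ CondS π ρ f (LsS σ h) ℓ m δ' z.2}
    rw [this]
    refine MeasurableSet.iUnion fun G => MeasurableSet.iInter fun i => ?_
    unfold RowC
    split_ifs with hi
    · have : {z : (Fin n → Fin n → ℝ) × (Fin n → ℝ) | z.1 i ∈ {c : Fin n → ℝ | ∀ k ∈ KK π ρ, z.2 ρ ≤ c k + z.2 k}}
        = ⋂ k ∈ KK π ρ, {z | z.2 ρ ≤ z.1 i k + z.2 k} := by
        ext z
        simp only [Set.mem_iInter]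
        rfl
      rw [this]
      refine Finset.measurableSet_biInter _ fun k _ => measurableSet_le (by fun_prop) (by fun_prop)
    · apply MeasurableSet.inter
      · exact measurableSet_le (f := fun z : (Fin n → Fin n → ℝ) × (Fin n → ℝ) => z.2 i)
          (g := fun z => z.1 i (f i) + z.2 (f i)) (by fun_prop) (by fun_prop)
      · set K := (KK π i).erase (f i)
        set e := eS π ρ f (LsS σ h) ℓ m δ' G i
        have : {z : (Fin n → Fin n → ℝ) × (Fin n → ℝ) | ∀ k ∈ K, z.1 i (f i) + z.2 (f i) + e k ≤ z.1 i k + z.2 k}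
          = ⋂ k ∈ K, {z | z.1 i (f i) + z.2 (f i) + e k ≤ z.1 i k + z.2 k} := by
          ext z
          simp only [Set.mem_iInter]
          rfl
        change MeasurableSet {z : (Fin n → Fin n → ℝ) × (Fin n → ℝ) | ∀ k ∈ K, z.1 i (f i) + z.2 (f i) + e k ≤ z.1 i k + z.2 k}
        rw [this]
        refine Finset.measurableSet_biInter _ fun k _ => measurableSet_le (by fun_prop) (by fun_prop)

theorem BB_cover {n : ℕ} (hn : 3 ≤ n) {π : Equiv.Perm (Fin n)} (hπ : IsDerangement π)
    (ρ : Fin n) (h ℓ m : ℕ) {δ' : ℝ} (hδ : 0 ≤ δ') (R : Fin n → Fin n → ℝ) (x : Fin n → ℝ)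
    (hx : ∀ i, x i ∈ Set.Icc (0:ℝ) 1) (hB : Asm π (R, x) ∈ BB π m δ') :
    ∃ σ f d, VT π ρ f ∧ (R, d) ∈ CD π ρ h ℓ m δ' σ f ∧ TT ρ f R d = x := by
  set C := Asm π (R, x) with hC
  have hCx : ∀ i, C (i, π i) = x i := by intro i; simp [hC, Asm]
  have hCR : ∀ i k, k ≠ i → C (i, π k) = R i k := by intro i k hk; simp [hC, Asm, hk]
  obtain ⟨hB1, hB2⟩ := hB
  have hopt : ∀ π' : Equiv.Perm (Fin n), IsDerangement π' → permCost C π ≤ permCost C π' := by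
    intro π' h'
    have := hB1.2 π' h'
    rwa [add_zero] at this
  obtain ⟨f, d, hf, hfA, hdρ, hfe, hAl⟩ := lemmaE hn ρ C hπ hopt
  obtain ⟨G, hG⟩ := lemmaMax hπ hopt hf hfA hfe hδ ℓ hB2
  refine ⟨Tuple.sort d, f, d, ⟨hf, fun i hi => (mem_KK _ _ _).2 (hfA i hi)⟩,
    ⟨⟨?_, Tuple.monotone_sort d⟩, G, ?_⟩, ?_⟩
  · change d ρ ∈ _
    rw [hdρ, hCx]; exact hx ρ
  · intro i
    unfold RowC
    split_ifs with hi
    · intro k hk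
      rw [mem_KK] at hk
      subst hi
      have h1 := hAl i k hk
      rw [hCx, hCR _ _ hk.1] at h1
      have h2 := (hx i).1
      change d i ≤ R i k + d k
      linarith
    · have h1 := hfe i hi
      have hne := (hfA i hi).1
      rw [hCx, hCR _ _ hne] at h1
      have h2 := (hx i).1
      refine ⟨show d i ≤ R i (f i) + d (f i) by linarith, fun k hk => ?_⟩
      change R i (f i) + d (f i) + eS _ _ _ _ _ _ _ _ _ _ ≤ R i k + d k
      rw [mem_erase, mem_KK] at hk
      have h3 := hAl i k hk.2
      rw [hCx, hCR _ _ hk.2.1] at h3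
      unfold eS
      split_ifs with hS
      · classical
        unfold Sset at hS
        rw [mem_filter] at hS
        obtain ⟨_, t, t1, t2, t3, t4, t5, t6⟩ := hS
        have h4 := hG k t t2 t3
        unfold Succ at h4
        simp only [not_and] at h4
        have h5 := h4 t1 t4 t5
        rw [t6, hCx, hCR _ _ hk.2.1] at h5
        linarith
      · linarith
  · funext i
    unfold TT
    split_ifs with hi
    · rw [hi, hdρ, hCx]
    · have h1 := hfe i hi
      rw [hCx, hCR _ _ (hfA i hi).1] at h1
      linarith

open Classical in
theorem BB_bound {n : ℕ} (hn : 3 ≤ n) {π : Equiv.Perm (Fin n)} (hπ : IsDerangement π)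
    (ρ : Fin n) (h ℓ m : ℕ) {δ' : ℝ} (hδ : 0 ≤ δ') :
    costMeasure n (BB π m δ') ≤ ∑ σ : Equiv.Perm (Fin n),
      ∫⁻ d, {d : Fin n → ℝ | d ρ ∈ Set.Icc (0:ℝ) 1 ∧ Monotone (d ∘ σ)}.indicator (fun d =>
        ∑ f ∈ univ.filter (VT π ρ), rowM n (CondS π ρ f (LsS σ h) ℓ m δ' d)) d := by
  have hmB : MeasurableSet (Asm π ⁻¹' (BB π m δ')) := measurable_Asm π (measurableSet_BB π m δ')
  rw [← (Asm_mp π).measure_preimage (measurableSet_BB π m δ').nullMeasurableSet,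
    Measure.prod_apply hmB]
  have h1 : ∀ R : Fin n → Fin n → ℝ,
      (Measure.pi fun _ : Fin n => U1) (Prod.mk R ⁻¹' (Asm π ⁻¹' (BB π m δ'))) ≤
      ∑ σ : Equiv.Perm (Fin n), ∑ f ∈ univ.filter (VT π ρ),
        volume (Prod.mk R ⁻¹' (CD π ρ h ℓ m δ' σ f)) := by
    intro R
    have e : (Measure.pi fun _ : Fin n => U1) =
        (volume : Measure (Fin n → ℝ)).restrict (Set.univ.pi fun _ => Set.Icc (0:ℝ) 1) := by
      rw [volume_pi, Measure.restrict_pi_pi]; rfl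
    rw [e, Measure.restrict_apply (measurable_prodMk_left hmB)]
    have hsub : Prod.mk R ⁻¹' (Asm π ⁻¹' (BB π m δ')) ∩ (Set.univ.pi fun _ => Set.Icc (0:ℝ) 1) ⊆
        ⋃ σ ∈ (univ : Finset (Equiv.Perm (Fin n))), ⋃ f ∈ univ.filter (VT π ρ),
          TT ρ f R '' (Prod.mk R ⁻¹' (CD π ρ h ℓ m δ' σ f)) := by
      rintro x ⟨hx1, hx2⟩
      obtain ⟨σ, f, d, hf, hd, hT⟩ := BB_cover hn hπ ρ h ℓ m hδ R x (fun i => hx2 i trivial) hx1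
      simp only [Set.mem_iUnion]
      exact ⟨σ, mem_univ _, f, mem_filter.2 ⟨mem_univ _, hf⟩, d, hd, hT⟩
    refine (measure_mono hsub).trans ((measure_biUnion_finset_le _ _).trans ?_)
    refine sum_le_sum fun σ _ => (measure_biUnion_finset_le _ _).trans ?_
    refine sum_le_sum fun f hf => le_of_eq ?_
    exact TT_image (mem_filter.1 hf).2.1 R _
  refine (lintegral_mono h1).trans (le_of_eq ?_)
  have hme : ∀ σ f, Measurable fun R : Fin n → Fin n → ℝ =>
      (volume : Measure (Fin n → ℝ)) (Prod.mk R ⁻¹' (CD π ρ h ℓ m δ' σ f)) :=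
    fun σ f => measurable_measure_prodMk_left (measurableSet_CD π ρ h ℓ m δ' σ f)
  rw [lintegral_finsetSum _ fun σ _ => Finset.measurable_sum _ fun f _ => hme σ f]
  refine sum_congr rfl fun σ _ => ?_
  rw [lintegral_finsetSum _ fun f _ => hme σ f]
  have h2 : ∀ f, ∫⁻ R, (volume : Measure (Fin n → ℝ)) (Prod.mk R ⁻¹' (CD π ρ h ℓ m δ' σ f)) ∂(rowM n) =
      ∫⁻ d, rowM n ((fun R => (R, d)) ⁻¹' (CD π ρ h ℓ m δ' σ f)) := by
    intro f
    rw [← Measure.prod_apply (measurableSet_CD π ρ h ℓ m δ' σ f),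
      Measure.prod_apply_symm (measurableSet_CD π ρ h ℓ m δ' σ f)]
  simp only [h2]
  rw [← lintegral_finsetSum _ fun f _ => measurable_measure_prodMk_right (measurableSet_CD π ρ h ℓ m δ' σ f)]
  refine lintegral_congr fun d => ?_
  by_cases hd : d ∈ {d : Fin n → ℝ | d ρ ∈ Set.Icc (0:ℝ) 1 ∧ Monotone (d ∘ σ)}
  · rw [Set.indicator_of_mem hd]
    refine sum_congr rfl fun f _ => ?_
    congr 1
    ext R
    exact ⟨fun h => h.2, fun h => ⟨hd, h⟩⟩
  · rw [Set.indicator_of_notMem hd]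
    refine sum_eq_zero fun f _ => ?_
    have : (fun R => (R, d)) ⁻¹' (CD π ρ h ℓ m δ' σ f) = ∅ := by
      ext R
      simp only [Set.mem_empty_iff_false, iff_false]
      exact fun h => hd h.1
    rw [this, measure_empty]


theorem pt_bound {N : ℕ} (hN : 7 ≤ N) {π : Equiv.Perm (Fin (N+1))} (hπ : IsDerangement π)
    (ρ : Fin (N+1)) (h ℓ m r : ℕ) (hm : 1 ≤ m) {δ' t0 y0 : ℝ} (hδ : 0 ≤ δ')
    (hδn : δ' * ((N+1:ℕ):ℝ) ≤ 1) (ht0 : 0 ≤ t0) (ht1 : t0 ≤ 1/2) (hy0 : 0 ≤ y0) (hy1 : y0 ≤ 1)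
    (hLt : (h:ℝ) * t0 ≤ 1/4) (hh0 : 0 < h) (hh : h < N+1)
    (σ : Equiv.Perm (Fin (N+1))) (d : Fin (N+1) → ℝ) (hd : Monotone (d ∘ σ)) :
    haveI : DecidablePred (VT π ρ) := Classical.decPred _
    ∑ f ∈ univ.filter (VT π ρ), rowM (N+1) (CondS π ρ f (LsS σ h) ℓ m δ' d) ≤
      (etaB (N+1) ℓ m h r (ENNReal.ofReal (2 * (t0 + y0 + (1 - y0)^(N+1-3))))
        (δ' / (2 * (8 * ((N+1:ℕ):ℝ) * t0 + 1))) +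
        ENNReal.ofReal (Real.exp (-(((N:ℝ)+1)/8 * t0)))) *
      ENNReal.ofReal (Real.exp (-(Qch N (gam N) (d ∘ σ)))) := by
  have hc := chamber_pt π hπ σ d (fun k => hd (Fin.castSucc_lt_succ).le)
  set rg := d (σ (Fin.last N)) - d (σ 0) with hrg
  have hle : ∀ i k, d i - d k ≤ rg := by
    intro i k
    have h1 := hd (Fin.le_last (σ.symm i))
    have h2 := hd (Fin.zero_le (σ.symm k))
    simp only [Function.comp, Equiv.apply_symm_apply] at h1 h2
    linarith
  have hrg0 : 0 ≤ rg := by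
    have := hle ρ ρ
    linarith
  by_cases hr : rg ≤ t0
  · obtain ⟨hL1, hL2⟩ := LsS_low σ hh d hd
    have hcard := LsS_card σ hh.le
    have h1 := CondS_sum_small (by omega) hπ ρ (LsS σ h) ℓ m r hm hδ hδn ht0 ht1 hy0 hy1
      (by rwa [hcard]) (by rwa [hcard]) d (fun i k => (hle i k).trans hr) _ hL1 hL2
    rw [hcard] at h1
    refine le_trans (le_of_eq ?_) (h1.trans ?_)
    · congr
    · refine mul_le_mul' le_self_add (hc.trans ?_)
      gcongr
      have : 0 ≤ ((N:ℝ)+1)/8 * rg := by positivity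
      linarith
  · push Not at hr
    have h1 := CondS_sum (by omega) hπ ρ (LsS σ h) ℓ m hδ d
    refine le_trans (le_of_eq ?_) (h1.trans (hc.trans ?_))
    · congr
    · refine le_trans ?_ (mul_le_mul' le_add_self le_rfl)
      rw [← ENNReal.ofReal_mul (Real.exp_pos _).le, ← Real.exp_add]
      gcongr
      have : ((N:ℝ)+1)/8 * t0 ≤ ((N:ℝ)+1)/8 * rg := by gcongr
      linarith

theorem bad2_bound {N : ℕ} (hN : 7 ≤ N) (h ℓ m r : ℕ) (hm : 1 ≤ m) {δ' t0 y0 : ℝ} (hδ : 0 ≤ δ')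
    (hδn : δ' * ((N+1:ℕ):ℝ) ≤ 1) (ht0 : 0 ≤ t0) (ht1 : t0 ≤ 1/2) (hy0 : 0 ≤ y0) (hy1 : y0 ≤ 1)
    (hLt : (h:ℝ) * t0 ≤ 1/4) (hh0 : 0 < h) (hh : h < N+1)
    (hne : ∃ π : Equiv.Perm (Fin (N+1)), IsDerangement π) :
    costMeasure (N+1) {C | (NearSet (m * δ') C).ncard < 2 ^ m} ≤
      (etaB (N+1) ℓ m h r (ENNReal.ofReal (2 * (t0 + y0 + (1 - y0)^(N+1-3))))
        (δ' / (2 * (8 * ((N+1:ℕ):ℝ) * t0 + 1))) +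
        ENNReal.ofReal (Real.exp (-(((N:ℝ)+1)/8 * t0)))) *
      ENNReal.ofReal (Real.exp 5 * ((N:ℝ)+1)^3) := by
  classical
  set E := (etaB (N+1) ℓ m h r (ENNReal.ofReal (2 * (t0 + y0 + (1 - y0)^(N+1-3))))
        (δ' / (2 * (8 * ((N+1:ℕ):ℝ) * t0 + 1))) +
        ENNReal.ofReal (Real.exp (-(((N:ℝ)+1)/8 * t0)))) with hE
  set P := ∏ k ∈ range N, ENNReal.ofReal (1 / gam N k) with hP
  have hsub : {C : Fin (N+1) × Fin (N+1) → ℝ | (NearSet (m * δ') C).ncard < 2 ^ m} ⊆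
      ⋃ π ∈ (univ.filter (IsDerangement (n := N+1))), BB π m δ' := by
    intro C hC
    obtain ⟨π, hπ, hopt⟩ := exists_opt C hne
    simp only [Set.mem_iUnion]
    refine ⟨π, mem_filter.2 ⟨mem_univ _, hπ⟩, ⟨hπ, fun π' h' => ?_⟩, hC⟩
    rw [add_zero]; exact hopt π' h'
  have hone : ∀ π ∈ univ.filter (IsDerangement (n := N+1)), costMeasure (N+1) (BB π m δ') ≤
      ((N+1).factorial : ENNReal) * (E * P) := by
    intro π hπ
    have hπ := (mem_filter.1 hπ).2
    refine (BB_bound (by omega) hπ 0 h ℓ m hδ).trans ?_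
    have hσ : ∀ σ ∈ (univ : Finset (Equiv.Perm (Fin (N+1)))),
        ∫⁻ d, {d : Fin (N+1) → ℝ | d 0 ∈ Set.Icc (0:ℝ) 1 ∧ Monotone (d ∘ σ)}.indicator (fun d =>
        ∑ f ∈ univ.filter (VT π 0), rowM (N+1) (CondS π 0 f (LsS σ h) ℓ m δ' d)) d ≤ E * P := by
      intro σ _
      rw [hP, ← chamber_lint (gam N) N (fun k hk => (gam_inv N k hN hk).1) σ 0]
      have hEt : E * ∫⁻ d : Fin (N+1) → ℝ, {d : Fin (N+1) → ℝ | d 0 ∈ Set.Icc (0:ℝ) 1 ∧ ∀ k : Fin N, d (σ k.castSucc) ≤ d (σ k.succ)}.indicator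
          (fun d => ENNReal.ofReal (Real.exp (-(Qch N (gam N) (d ∘ σ))))) d ≥
          ∫⁻ d : Fin (N+1) → ℝ, E * {d : Fin (N+1) → ℝ | d 0 ∈ Set.Icc (0:ℝ) 1 ∧ ∀ k : Fin N, d (σ k.castSucc) ≤ d (σ k.succ)}.indicator
          (fun d => ENNReal.ofReal (Real.exp (-(Qch N (gam N) (d ∘ σ))))) d := by
        apply le_of_eq
        apply lintegral_const_mul
        apply Measurable.indicator
        · unfold Qch; fun_prop
        · apply MeasurableSet.inter
          · exact measurableSet_Icc.preimage (measurable_pi_apply 0)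
          · have : {d : Fin (N+1) → ℝ | ∀ k : Fin N, d (σ k.castSucc) ≤ d (σ k.succ)} =
              ⋂ k : Fin N, {d | d (σ k.castSucc) ≤ d (σ k.succ)} := by
              ext d; simp only [Set.mem_iInter]; rfl
            change MeasurableSet {d : Fin (N+1) → ℝ | ∀ k : Fin N, d (σ k.castSucc) ≤ d (σ k.succ)}
            rw [this]
            exact MeasurableSet.iInter fun k => measurableSet_le (by fun_prop) (by fun_prop)
      refine le_trans (lintegral_mono fun d => ?_) hEt
      by_cases hd : d ∈ {d : Fin (N+1) → ℝ | d 0 ∈ Set.Icc (0:ℝ) 1 ∧ Monotone (d ∘ σ)}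
      · rw [Set.indicator_of_mem hd, Set.indicator_of_mem (show d ∈ {d : Fin (N+1) → ℝ | d 0 ∈ Set.Icc (0:ℝ) 1 ∧ ∀ k : Fin N, d (σ k.castSucc) ≤ d (σ k.succ)} from
          ⟨hd.1, fun k => hd.2 (Fin.castSucc_lt_succ).le⟩)]
        have := pt_bound hN hπ 0 h ℓ m r hm hδ hδn ht0 ht1 hy0 hy1 hLt hh0 hh σ d hd.2
        refine le_trans (le_of_eq ?_) this
        congr
      · rw [Set.indicator_of_notMem hd]; exact zero_le
    refine (le_trans (le_of_eq ?_) (sum_le_sum hσ)).trans (le_of_eq ?_)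
    · congr
    · rw [sum_const, nsmul_eq_mul, card_univ, Fintype.card_perm, Fintype.card_fin]
  refine (measure_mono hsub).trans ((measure_biUnion_finset_le _ _).trans ((sum_le_sum hone).trans ?_))
  rw [sum_const, nsmul_eq_mul]
  have hcard : (univ.filter (IsDerangement (n := N+1))).card ≤ (N+1).factorial := by
    refine (card_le_univ _).trans (le_of_eq ?_)
    rw [Fintype.card_perm, Fintype.card_fin]
  calc _ ≤ (((N+1).factorial : ℕ) : ENNReal) * (((N+1).factorial : ENNReal) * (E * P)) := by
        gcongr
    _ = E * ((((N+1).factorial : ℕ) : ENNReal)^2 * P) := by ring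
    _ ≤ _ := by gcongr; exact gam_prod N hN


theorem etaB_eq (n ℓ m h r : ℕ) (hh : 0 < h) (q κ : ℝ) (hq : 0 ≤ q) :
    etaB n ℓ m h r (ENNReal.ofReal q) κ = ENNReal.ofReal
      (n * ((2 * (m * ((ℓ:ℝ)+1))) / h * ((2 + r * ℓ) * (1 + n * ℓ * q)))^r +
      (n * ((ℓ:ℝ)+1))^m * Real.exp (-(κ * ((h * (ℓ-1) : ℕ) / 2)))) := by
  unfold etaB
  have hh' : (0:ℝ) < h := by exact_mod_cast hh
  have e1 : ((2 * (m * (ℓ+1)) : ℕ) : ENNReal) = ENNReal.ofReal (2 * (m * ((ℓ:ℝ)+1))) := by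
    rw [← ENNReal.ofReal_natCast]; push_cast; rfl
  have e2 : ((2 + r * ℓ : ℕ) : ENNReal) = ENNReal.ofReal (2 + r * ℓ) := by
    rw [← ENNReal.ofReal_natCast]; push_cast; rfl
  have e3 : (1 + n * ℓ * ENNReal.ofReal q : ENNReal) = ENNReal.ofReal (1 + n * ℓ * q) := by
    rw [ENNReal.ofReal_add (by norm_num) (by positivity), ENNReal.ofReal_mul (by positivity),
      ENNReal.ofReal_mul (by positivity)]; simp
  have e4 : ((n * (ℓ+1) : ℕ) : ENNReal) = ENNReal.ofReal (n * ((ℓ:ℝ)+1)) := by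
    rw [← ENNReal.ofReal_natCast]; push_cast; rfl
  rw [e1, e2, e3, e4, ← ENNReal.ofReal_natCast n, ← ENNReal.ofReal_natCast h,
    ← ENNReal.ofReal_div_of_pos hh', ← ENNReal.ofReal_mul (by positivity),
    ← ENNReal.ofReal_mul (by positivity), ← ENNReal.ofReal_pow (by positivity),
    ← ENNReal.ofReal_pow (by positivity),
    ← ENNReal.ofReal_mul (by positivity), ← ENNReal.ofReal_mul (by positivity),
    ← ENNReal.ofReal_add (by positivity) (by positivity)]

theorem real_a (s n h q : ℝ) (hs : 1 ≤ s) (hn : s^100 ≤ n) (hh : n / (8 * s^2) ≤ h)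
    (hq0 : 0 ≤ q) (hq : n * q ≤ 6 * s^2) :
    n^3 * (n * ((2 * (s * (s^10+1))) / h * ((2 + 10 * s^10) * (1 + n * s^10 * q)))^10) ≤
      2688^10 / s := by
  have hn0 : 0 < n := lt_of_lt_of_le (by positivity) hn
  have hh0 : 0 < h := lt_of_lt_of_le (by positivity) hh
  have h10 : 1 ≤ s^10 := one_le_pow₀ hs
  have h12 : 1 ≤ s^12 := one_le_pow₀ hs
  have b1 : (2 * (s * (s^10+1))) / h ≤ 32 * s^13 / n := by
    rw [div_le_div_iff₀ hh0 hn0]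
    have h1 : n ≤ 8 * s^2 * h := by
      rw [div_le_iff₀ (by positivity)] at hh; linarith
    calc 2 * (s * (s^10+1)) * n ≤ 2 * (s * (s^10+s^10)) * (8 * s^2 * h) := by gcongr
      _ = 32 * s^13 * h := by ring
  have b2 : 2 + 10 * s^10 ≤ 12 * s^10 := by linarith
  have b3 : 1 + n * s^10 * q ≤ 7 * s^12 := by
    have : n * s^10 * q ≤ 6 * s^12 := by
      calc n * s^10 * q = s^10 * (n * q) := by ring
        _ ≤ s^10 * (6 * s^2) := by gcongr
        _ = 6 * s^12 := by ring
    linarith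
  have B : (2 * (s * (s^10+1))) / h * ((2 + 10 * s^10) * (1 + n * s^10 * q)) ≤ 2688 * s^35 / n := by
    calc _ ≤ 32 * s^13 / n * (12 * s^10 * (7 * s^12)) := by gcongr
      _ = _ := by ring
  calc _ ≤ n^3 * (n * (2688 * s^35 / n)^10) := by gcongr
    _ = 2688^10 * s^350 / n^6 := by field_simp
    _ ≤ 2688^10 * s^350 / (s^100)^6 := by gcongr
    _ = 2688^10 / s^250 := by
        rw [div_eq_div_iff (by positivity) (by positivity)]; ring
    _ ≤ 2688^10 / s := by
        gcongr
        exact le_self_pow₀ hs (by norm_num)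

theorem n_le_exp (s n : ℝ) (hs : 1 ≤ s) (hn : n ≤ (2*s)^100) : n ≤ Real.exp (200 * s) := by
  refine hn.trans ?_
  have : 2 * s ≤ Real.exp (2*s) := by linarith [Real.add_one_le_exp (2*s)]
  calc (2*s)^100 ≤ (Real.exp (2*s))^100 := by gcongr
    _ = _ := by rw [← Real.exp_nat_mul]; congr 1; push_cast; ring

theorem real_b (s : ℕ) (n x : ℝ) (hs : 100 ≤ s) (hn0 : 0 ≤ n) (hn : n ≤ (2*s)^100)
    (hx : (s:ℝ)^5 / 576 ≤ x) :
    n^3 * ((n * ((s:ℝ)^10+1))^s * Real.exp (-x)) ≤ Real.exp (-s) := by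
  have hs' : (100:ℝ) ≤ s := by exact_mod_cast hs
  have hn' := n_le_exp s n (by linarith) hn
  have h10 : (1:ℝ) ≤ (s:ℝ)^10 := one_le_pow₀ (by linarith)
  have h1 : (s:ℝ)^10 + 1 ≤ Real.exp (20 * s) := by
    have : 2 * (s:ℝ) ≤ Real.exp (2*s) := by linarith [Real.add_one_le_exp (2*(s:ℝ))]
    calc (s:ℝ)^10 + 1 ≤ (2*(s:ℝ))^10 := by rw [mul_pow]; linarith
      _ ≤ (Real.exp (2*s))^10 := by gcongr
      _ = _ := by rw [← Real.exp_nat_mul]; congr 1; push_cast; ring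
  calc _ ≤ (Real.exp (200*s))^3 * ((Real.exp (200 * s) * Real.exp (20*s))^s * Real.exp (-x)) := by
        gcongr
    _ = Real.exp (600 * s + 220 * s^2 - x) := by
        rw [← Real.exp_add, ← Real.exp_nat_mul, ← Real.exp_nat_mul, ← Real.exp_add, ← Real.exp_add]
        congr 1; push_cast; ring
    _ ≤ _ := by
        apply Real.exp_le_exp.2
        have h2 : (1000000:ℝ) ≤ (s:ℝ)^3 := by
          calc (1000000:ℝ) = 100^3 := by norm_num
            _ ≤ _ := by gcongr
        have h3 : (1000000:ℝ) * s^2 ≤ (s:ℝ)^5 := by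
          calc (1000000:ℝ) * s^2 ≤ (s:ℝ)^3 * s^2 := by gcongr
            _ = _ := by ring
        nlinarith

theorem real_q (s n : ℝ) (N : ℕ) (hs : 400 ≤ s) (hn1 : s^100 ≤ n) (hn : n ≤ (2*s)^100)
    (hN : n / 2 ≤ N) : 
    n * (2 * (s / n + s^2/n + (1 - s^2/n)^N)) ≤ 6 * s^2 := by
  have hn0 : 0 < n := lt_of_lt_of_le (by positivity) hn1
  have hle : s^2 / n ≤ 1 := by
    rw [div_le_one hn0]
    exact (pow_le_pow_right₀ (by linarith) (by norm_num)).trans hn1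
  have h1 : (1 - s^2/n)^N ≤ Real.exp (-(s^2/2)) := by
    calc (1 - s^2/n)^N ≤ (Real.exp (-(s^2/n)))^N := by
          refine pow_le_pow_left₀ (by linarith) ?_ _
          linarith [Real.add_one_le_exp (-(s^2/n))]
      _ = Real.exp (-(s^2/n * N)) := by rw [← Real.exp_nat_mul]; congr 1; ring
      _ ≤ _ := by
          apply Real.exp_le_exp.2
          rw [neg_le_neg_iff]
          calc s^2/2 = s^2/n * (n/2) := by field_simp
            _ ≤ _ := by gcongr
  have h2 : n * (1 - s^2/n)^N ≤ 1 := by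
    calc _ ≤ Real.exp (200 * s) * Real.exp (-(s^2/2)) := by
          gcongr
          exact n_le_exp s n (by linarith) hn
      _ = Real.exp (200 * s - s^2/2) := by rw [← Real.exp_add]; rfl
      _ ≤ 1 := by rw [Real.exp_le_one_iff]; nlinarith
  have e : n * (2 * (s / n + s^2/n + (1 - s^2/n)^N)) = 2 * s + 2 * s^2 + 2 * (n * (1 - s^2/n)^N) := by
    field_simp
  rw [e]
  nlinarith


theorem real_x (s n h w : ℝ) (hs : 1 ≤ s) (hn : 0 < n) (hh : n / (8 * s^2) ≤ h)
    (hw : s^10 / 2 ≤ w) :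
    s^5 / 576 ≤ 1/(n * s^2) / (2 * (8 * n * (s/n) + 1)) * (h * w / 2) := by
  have hs0 : 0 < s := by linarith
  have e : 1/(n * s^2) / (2 * (8 * n * (s/n) + 1)) = 1 / (n * s^2 * (2 * (8 * s + 1))) := by
    have : 8 * n * (s / n) = 8 * s := by field_simp
    rw [this, div_div]
  rw [e]
  have h4 : n * s^2 * (2 * (8 * s + 1)) ≤ 18 * n * s^3 := by
    have : (2 * (8 * s + 1)) ≤ 18 * s := by linarith
    calc n * s^2 * (2 * (8 * s + 1)) ≤ n * s^2 * (18 * s) := by gcongr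
      _ = _ := by ring
  have hh0 : 0 < h := lt_of_lt_of_le (by positivity) hh
  calc s^5 / 576 = 1 / (18 * n * s^3) * ((n / (8 * s^2)) * (s^10 / 2) / 2) := by
        field_simp; norm_num
    _ ≤ 1 / (n * s^2 * (2 * (8 * s + 1))) * (h * w / 2) := by gcongr

theorem real_comb (e x a b c A B C : ℝ) (he : 0 ≤ e) (h1 : x * a ≤ A) (h2 : x * b ≤ B)
    (h3 : x * c ≤ C) : (a + b + c) * (e * x) ≤ e * (A + B + C) := by
  calc (a + b + c) * (e * x) = e * (x * a + x * b + x * c) := by ring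
    _ ≤ _ := by gcongr

theorem pow_pred_ge (s : ℕ) (hs : 400 ≤ s) : (s:ℝ)^10 / 2 ≤ ((s^10 - 1 : ℕ) : ℝ) := by
  have hsR : (400:ℝ) ≤ s := by exact_mod_cast hs
  have h5 : 1 ≤ s^10 := Nat.one_le_pow _ _ (by omega)
  have h6 : ((s^10 - 1 : ℕ) : ℝ) = (s:ℝ)^10 - 1 := by
    rw [Nat.cast_sub h5, Nat.cast_pow, Nat.cast_one]
  have : (s:ℝ) ≤ (s:ℝ)^10 := le_self_pow₀ (by linarith) (by norm_num)
  rw [h6]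
  linarith

theorem bad2_real (N s : ℕ) (hs : 400 ≤ s) (h1 : s^100 ≤ N+1) (h2 : N+1 ≤ (2*s)^100)
    (hne : ∃ π : Equiv.Perm (Fin (N+1)), IsDerangement π) :
    costMeasure (N+1) {C | (NearSet (s * (1/(((N+1:ℕ):ℝ) * (s:ℝ)^2))) C).ncard < 2 ^ s} ≤
      ENNReal.ofReal (Real.exp 5 * (2688^10/(s:ℝ) + Real.exp (-(s:ℝ)) +
        (2*(s:ℝ))^300 * Real.exp (-((s:ℝ)/8)))) := by
  have hsR : (400:ℝ) ≤ s := by exact_mod_cast hs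
  have hs0 : (0:ℝ) < s := by linarith
  set n : ℝ := ((N+1:ℕ):ℝ) with hn
  have h1R : (s:ℝ)^100 ≤ n := by rw [hn]; exact_mod_cast h1
  have h2R : n ≤ (2*(s:ℝ))^100 := by rw [hn]; exact_mod_cast h2
  clear h1 h2
  have hpow : ∀ k, k ≤ 100 → (s:ℝ)^k ≤ n := fun k hk =>
    (pow_le_pow_right₀ (by linarith) hk).trans h1R
  have hn0 : 0 < n := lt_of_lt_of_le (by positivity) h1R
  have h8 : 8 * (s:ℝ)^2 ≤ n := by
    calc 8 * (s:ℝ)^2 ≤ s * s^2 := by gcongr; linarith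
      _ = (s:ℝ)^3 := by ring
      _ ≤ n := hpow 3 (by norm_num)
  set h : ℕ := (N+1) / (4 * s^2) with hh
  have hhle : (h:ℝ) ≤ n / (4 * s^2) := by
    have := Nat.cast_div_le (α := ℝ) (m := N+1) (n := 4 * s^2)
    rw [← hh] at this
    refine this.trans (le_of_eq ?_)
    push_cast [hn]; rfl
  have hhge : n / (8 * (s:ℝ)^2) ≤ h := by
    have := Nat.lt_div_mul_add (a := N+1) (b := 4 * s^2) (by positivity)
    rw [← hh] at this
    have h3 : n < h * (4 * s^2) + 4 * s^2 := by rw [hn]; exact_mod_cast this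
    rw [div_le_iff₀ (by positivity)]
    nlinarith
  have hh0 : 0 < h := by
    have : (0:ℝ) < h := lt_of_lt_of_le (by positivity) hhge
    exact_mod_cast this
  have hhn : h < N+1 := by
    have : (h:ℝ) < n := by
      refine hhle.trans_lt (div_lt_self hn0 ?_)
      nlinarith
    rw [hn] at this; exact_mod_cast this
  have hN7 : 7 ≤ N := by
    have : (8:ℝ) ≤ n := by nlinarith
    have : 8 ≤ N+1 := by rw [hn] at this; exact_mod_cast this
    omega
  have hs2n := hpow 2 (by norm_num)
  have hy1 : (s:ℝ)^2 / n ≤ 1 := (div_le_one hn0).2 hs2n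
  have key := bad2_bound hN7 h (s^10) s 10 (by omega) (δ' := 1/(n * (s:ℝ)^2)) (t0 := s/n)
    (y0 := (s:ℝ)^2/n) (by positivity)
    (by
      rw [← hn, div_mul_eq_mul_div, div_le_one (by positivity), mul_comm n]
      exact mul_le_mul_of_nonneg_right (one_le_pow₀ (by linarith)) hn0.le)
    (by positivity)
    (by rw [div_le_div_iff₀ hn0 (by norm_num)]; nlinarith)
    (by positivity) hy1
    (by
      calc (h:ℝ) * (s/n) ≤ n / (4 * s^2) * (s/n) := by gcongr
        _ = 1 / (4 * s) := by field_simp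
        _ ≤ 1/4 := by gcongr; linarith)
    hh0 hhn hne
  refine key.trans ?_
  have hN3 : n / 2 ≤ ((N+1-3 : ℕ):ℝ) := by
    rw [Nat.cast_sub (by omega), ← hn]; push_cast; nlinarith
  have hq0 : 0 ≤ 2 * ((s:ℝ)/n + (s:ℝ)^2/n + (1 - (s:ℝ)^2/n)^(N+1-3)) := by
    have : 0 ≤ 1 - (s:ℝ)^2/n := by linarith
    positivity
  set q := 2 * ((s:ℝ)/n + (s:ℝ)^2/n + (1 - (s:ℝ)^2/n)^(N+1-3)) with hq
  have hqn : n * q ≤ 6 * (s:ℝ)^2 := real_q s n (N+1-3) hsR h1R h2R hN3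
  rw [etaB_eq _ _ _ _ _ hh0 _ _ hq0, ← hn]
  have hN1 : (N:ℝ) + 1 = n := by rw [hn]; push_cast; rfl
  rw [hN1]
  rw [← ENNReal.ofReal_add (by positivity) (by positivity), ← ENNReal.ofReal_mul (by positivity)]
  apply ENNReal.ofReal_le_ofReal
  have ra := real_a s n h q (by linarith) h1R hhge hq0 hqn
  have h6 : (s:ℝ)^10 / 2 ≤ ((s^10 - 1 : ℕ) : ℝ) := pow_pred_ge s (by omega)
  obtain ⟨w, hw⟩ : ∃ w : ℕ, w = s^10 - 1 := ⟨_, rfl⟩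
  rw [← hw] at h6 ⊢
  have hx := real_x s n h w (by linarith) hn0 hhge h6
  rw [← Nat.cast_mul] at hx
  have rb := real_b s n _ (by omega) hn0.le h2R hx
  have rc : n^3 * Real.exp (-(n/8 * (s/n))) ≤ (2*(s:ℝ))^300 * Real.exp (-((s:ℝ)/8)) := by
    have e : n/8 * ((s:ℝ)/n) = s/8 := by field_simp
    rw [e]
    gcongr
    calc n^3 ≤ ((2*(s:ℝ))^100)^3 := by gcongr
      _ = _ := by rw [← pow_mul]
  rw [Nat.cast_pow s 10, Nat.cast_ofNat]
  exact real_comb _ _ _ _ _ _ _ _ (Real.exp_pos 5).le ra rb rc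


/-- the scale `s` -/
noncomputable def sc (n : ℕ) : ℕ := ⌊(n:ℝ)^((1:ℝ)/100)⌋₊

theorem sc_tendsto : Filter.Tendsto sc Filter.atTop Filter.atTop := by
  unfold sc
  exact tendsto_nat_floor_atTop.comp ((tendsto_rpow_atTop (by norm_num)).comp
    tendsto_natCast_atTop_atTop)

theorem sc_le (n : ℕ) : (sc n)^100 ≤ n := by
  have h : ((sc n : ℕ) : ℝ) ≤ (n:ℝ)^((1:ℝ)/100) := Nat.floor_le (by positivity)
  have h2 : ((sc n : ℕ) : ℝ)^100 ≤ ((n:ℝ)^((1:ℝ)/100))^100 := by gcongr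
  rw [← Real.rpow_natCast ((n:ℝ)^((1:ℝ)/100)), ← Real.rpow_mul (by positivity)] at h2
  norm_num at h2
  exact_mod_cast h2

theorem sc_gt (n : ℕ) : (n:ℝ)^((1:ℝ)/100) ≤ sc n + 1 := (Nat.lt_floor_add_one _).le

theorem sc_ge (n : ℕ) (h : 1 ≤ sc n) : n ≤ (2 * sc n)^100 := by
  have h1 := sc_gt n
  have h2 : ((n:ℝ)^((1:ℝ)/100))^100 ≤ (2 * (sc n:ℝ))^100 := by
    gcongr
    have : (1:ℝ) ≤ sc n := by exact_mod_cast h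
    linarith
  rw [← Real.rpow_natCast ((n:ℝ)^((1:ℝ)/100)), ← Real.rpow_mul (by positivity)] at h2
  norm_num only [Nat.cast_ofNat, Real.rpow_one] at h2
  have h3 : (n:ℝ) ≤ (2 * (sc n:ℝ))^100 := by
    simpa using h2
  exact_mod_cast h3

theorem dd_le (n : ℕ) (ε : ℝ) (hε : ε ≤ 1/100) (hn : 1 ≤ n) (hs : 26 ≤ sc n) :
    ⌈(n : ℝ) ^ (ε / 3)⌉₊ ^ ⌈(n : ℝ) ^ (ε / 3)⌉₊ ≤ 2 ^ (sc n) := by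
  set d := ⌈(n : ℝ) ^ (ε / 3)⌉₊ with hd
  have hn1 : (1:ℝ) ≤ n := by exact_mod_cast hn
  set u : ℝ := ((sc n:ℝ) + 1)^((1:ℝ)/3) with hu
  have hsR : (26:ℝ) ≤ sc n := by exact_mod_cast hs
  have hu3 : u^3 = sc n + 1 := by
    rw [hu, ← Real.rpow_natCast, ← Real.rpow_mul (by positivity)]; norm_num
  have hu0 : 0 ≤ u := by positivity
  have hu3' : 3 ≤ u := by
    by_contra h
    push Not at h
    have : u^3 < 3^3 := by gcongr
    linarith
  have h1 : (n:ℝ)^(ε/3) ≤ u := by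
    calc (n:ℝ)^(ε/3) ≤ (n:ℝ)^((1:ℝ)/100 * (1/3)) :=
          Real.rpow_le_rpow_of_exponent_le hn1 (by linarith)
      _ = ((n:ℝ)^((1:ℝ)/100))^((1:ℝ)/3) := Real.rpow_mul (by positivity) _ _
      _ ≤ _ := Real.rpow_le_rpow (by positivity) (sc_gt n) (by norm_num)
  have h2 : (d:ℝ) ≤ u + 1 := by
    have := Nat.ceil_lt_add_one (a := (n:ℝ)^(ε/3)) (by positivity)
    rw [← hd] at this
    linarith
  have h3 : d * d ≤ sc n := by
    have : (d:ℝ) * d ≤ sc n := by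
      calc (d:ℝ) * d ≤ (u+1) * (u+1) := by gcongr
        _ ≤ u^3 - 1 := by nlinarith [mul_nonneg hu0 (sub_nonneg.2 hu3'), mul_nonneg (mul_nonneg hu0 hu0) (sub_nonneg.2 hu3')]
        _ = sc n := by rw [hu3]; ring
    exact_mod_cast this
  calc d^d ≤ (2^d)^d := Nat.pow_le_pow_left (Nat.lt_two_pow_self).le _
    _ = 2^(d*d) := by rw [← pow_mul]
    _ ≤ _ := Nat.pow_le_pow_right (by norm_num) h3

theorem exists_cyclic (n : ℕ) (hn : 2 ≤ n) : ∃ π : Equiv.Perm (Fin n), IsCyclicPerm π := by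
  obtain ⟨k, rfl⟩ : ∃ k, n = k + 2 := ⟨n - 2, by omega⟩
  refine ⟨finRotate (k+2), isCycle_finRotate, fun i => ?_⟩
  rw [finRotate_succ_apply]
  intro h
  have : (1 : Fin (k+2)) = 0 := by simpa using h
  exact absurd this (by simp)

theorem good_incl (n : ℕ) (hn : 2 ≤ n) (δ : ℝ) (C : Fin n × Fin n → ℝ) (h1 : C ∉ Bad1 n δ) :
    NearSet δ C ⊆ {π : Equiv.Perm (Fin n) | (∀ i, π i ≠ i) ∧ permCost C π < ZATSP n C} := by
  have hfin : {x | ∃ π : Equiv.Perm (Fin n), IsCyclicPerm π ∧ x = permCost C π}.Finite := by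
    refine (Set.finite_range (permCost C)).subset ?_
    rintro x ⟨π, -, rfl⟩
    exact ⟨π, rfl⟩
  have hne : {x | ∃ π : Equiv.Perm (Fin n), IsCyclicPerm π ∧ x = permCost C π}.Nonempty := by
    obtain ⟨π, hπ⟩ := exists_cyclic n hn
    exact ⟨_, π, hπ, rfl⟩
  obtain ⟨τ, hτ, hτe⟩ := hne.csInf_mem hfin
  have hτn : τ ∉ NearSet δ C := fun h => h1 ⟨τ, h, hτ⟩
  intro π hπ
  refine ⟨hπ.1, ?_⟩
  unfold ZATSP
  rw [hτe]
  by_contra h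
  push Not at h
  exact hτn ⟨hτ.2, fun π' h' => h.trans (hπ.2 π' h')⟩

theorem bad1_real (n s : ℕ) (hs : 1 ≤ s) (hn : 2 * s < n) :
    costMeasure n (Bad1 n (s * (1/((n:ℝ) * (s:ℝ)^2)))) ≤
      11 / ∑ t ∈ Finset.Icc 2 s, ((t : ENNReal))⁻¹ := by
  have hs0 : (1:ℝ) ≤ s := by exact_mod_cast hs
  have hn0 : (0:ℝ) < n := by exact_mod_cast (by omega : 0 < n)
  have key := bad1_bound (n := n) (L := s) (δ := s * (1/((n:ℝ) * (s:ℝ)^2))) (by positivity) hn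
  set H := ∑ t ∈ Finset.Icc 2 s, ((t : ENNReal))⁻¹ with hH
  have hr : 3 * (n:ENNReal) + (2 + 2 * s) * ((n : ENNReal) ^ 2 * ENNReal.ofReal (2 * (s * (1/((n:ℝ) * (s:ℝ)^2))))) ≤
      n * 11 := by
    have e : 3 * (n:ENNReal) + (2 + 2 * s) * ((n : ENNReal) ^ 2 * ENNReal.ofReal (2 * (s * (1/((n:ℝ) * (s:ℝ)^2))))) =
      ENNReal.ofReal (3 * n + (2 + 2 * s) * ((n:ℝ)^2 * (2 * (s * (1/((n:ℝ) * (s:ℝ)^2)))))) := by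
      rw [ENNReal.ofReal_add (by positivity) (by positivity), ENNReal.ofReal_mul (by norm_num),
        ENNReal.ofReal_mul (by positivity) (p := 2 + 2 * (s:ℝ)), ENNReal.ofReal_mul (by positivity) (p := (n:ℝ)^2),
        ENNReal.ofReal_add (by positivity) (by positivity), ENNReal.ofReal_pow (by positivity),
        ENNReal.ofReal_mul (by norm_num) (p := 2) (q := (s:ℝ))]
      simp
    have e2 : (n:ENNReal) * 11 = ENNReal.ofReal (n * 11) := by
      rw [ENNReal.ofReal_mul (by positivity)]; simp
    rw [e, e2]
    apply ENNReal.ofReal_le_ofReal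
    have e3 : (2 + 2 * (s:ℝ)) * ((n:ℝ)^2 * (2 * (s * (1/((n:ℝ) * (s:ℝ)^2))))) = n * (4 * (1 + s) / s) := by
      field_simp; ring
    rw [e3]
    have : 4 * (1 + (s:ℝ)) / s ≤ 8 := by rw [div_le_iff₀ (by linarith)]; linarith
    nlinarith
  have h2 := key.trans hr
  have h3 : (n:ENNReal) * (costMeasure n (Bad1 n (s * (1/((n:ℝ) * (s:ℝ)^2)))) * H) ≤ n * 11 := by
    rw [mul_left_comm]; exact h2
  have h4 : costMeasure n (Bad1 n (s * (1/((n:ℝ) * (s:ℝ)^2)))) * H ≤ 11 := by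
    rwa [ENNReal.mul_le_mul_iff_right (by simp; omega) (by simp)] at h3
  by_cases hH0 : H = 0
  · rw [hH0, ENNReal.div_zero (by norm_num)]; exact le_top
  · rw [ENNReal.le_div_iff_mul_le (Or.inl hH0) (Or.inr (by norm_num))]
    exact h4

theorem harm_tendsto : Filter.Tendsto (fun s : ℕ => 11 / ∑ t ∈ Finset.Icc 2 s, ((t : ENNReal))⁻¹)
    Filter.atTop (nhds 0) := by
  have h1 : Filter.Tendsto (fun s : ℕ => ∑ t ∈ Finset.Icc 2 s, ((t : ENNReal))⁻¹) Filter.atTop (nhds ⊤) := by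
    have h2 : Filter.Tendsto (fun s : ℕ => ENNReal.ofReal (∑ i ∈ range s, 1 / ((i:ℝ)+1) + (-1))) Filter.atTop (nhds ⊤) :=
      ENNReal.tendsto_ofReal_atTop.comp
        (Filter.tendsto_atTop_add_const_right _ _ Real.tendsto_sum_range_one_div_nat_succ_atTop)
    refine tendsto_of_tendsto_of_tendsto_of_le_of_le' h2 tendsto_const_nhds ?_
      (Filter.Eventually.of_forall fun _ => le_top)
    filter_upwards [Filter.eventually_ge_atTop 1] with s hs
    have e : ∑ t ∈ Finset.Icc 2 s, ((t : ENNReal))⁻¹ = ENNReal.ofReal (∑ t ∈ Finset.Icc 2 s, ((t:ℝ))⁻¹) := by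
      rw [ENNReal.ofReal_sum_of_nonneg (fun _ _ => by positivity)]
      refine sum_congr rfl fun t ht => ?_
      have : 2 ≤ t := (Finset.mem_Icc.1 ht).1
      rw [ENNReal.ofReal_inv_of_pos (by exact_mod_cast (by omega : 0 < t)), ENNReal.ofReal_natCast]
    rw [e]
    apply ENNReal.ofReal_le_ofReal
    have e2 : ∀ k : ℕ, ∑ i ∈ range k, 1 / ((i:ℝ)+1) = ∑ t ∈ Finset.Icc 1 k, ((t:ℝ))⁻¹ := by
      intro k
      induction k with
      | zero => simp
      | succ k ih =>
        rw [sum_range_succ, ih, Finset.sum_Icc_succ_top (by omega)]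
        push_cast
        rw [one_div]
    rw [e2 s, ← Finset.add_sum_Ioc_eq_sum_Icc hs]
    simp only [Nat.cast_one, inv_one]
    have : Finset.Ioc 1 s = Finset.Icc 2 s := by ext; simp [Finset.mem_Ioc, Finset.mem_Icc]; omega
    rw [this]
    linarith
  have := ENNReal.Tendsto.const_div (a := 11) h1 (Or.inr (by norm_num))
  simpa using this

theorem bad2_tendsto : Filter.Tendsto (fun s : ℕ => ENNReal.ofReal (Real.exp 5 * (2688^10/(s:ℝ) + Real.exp (-(s:ℝ)) +
        (2*(s:ℝ))^300 * Real.exp (-((s:ℝ)/8))))) Filter.atTop (nhds 0) := by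
  have hc : Filter.Tendsto (fun s : ℕ => (s:ℝ)) Filter.atTop Filter.atTop := tendsto_natCast_atTop_atTop
  have a : Filter.Tendsto (fun s : ℕ => 2688^10/(s:ℝ)) Filter.atTop (nhds 0) := hc.const_div_atTop _
  have b : Filter.Tendsto (fun s : ℕ => Real.exp (-(s:ℝ))) Filter.atTop (nhds 0) :=
    Real.tendsto_exp_neg_atTop_nhds_zero.comp hc
  have c : Filter.Tendsto (fun s : ℕ => (2*(s:ℝ))^300 * Real.exp (-((s:ℝ)/8))) Filter.atTop (nhds 0) := by
    have h := ((Real.tendsto_pow_mul_exp_neg_atTop_nhds_zero 300).comp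
      (hc.atTop_div_const (show (0:ℝ) < 8 by norm_num))).const_mul ((16:ℝ)^300)
    rw [mul_zero] at h
    refine h.congr fun s => ?_
    simp only [Function.comp]
    rw [← mul_assoc, ← mul_pow]
    congr 2; ring
  have := ((a.add b).add c).const_mul (Real.exp 5)
  rw [add_zero, add_zero, mul_zero] at this
  have h2 := ENNReal.tendsto_ofReal this
  rwa [ENNReal.ofReal_zero] at h2

theorem statement_16 :
    ∃ ε₀ : ℝ, 0 < ε₀ ∧ ∀ ε : ℝ, 0 < ε → ε ≤ ε₀ →
      Filter.Tendsto
        (fun n : ℕ => costMeasure n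
          {C | ⌈(n : ℝ) ^ (ε / 3)⌉₊ ^ ⌈(n : ℝ) ^ (ε / 3)⌉₊ ≤
            {π : Equiv.Perm (Fin n) | (∀ i, π i ≠ i) ∧
              permCost C π < ZATSP n C}.ncard})
        Filter.atTop (nhds 1) := by
  refine ⟨1/100, by norm_num, fun ε _ hε => ?_⟩
  have hg := (harm_tendsto.comp sc_tendsto).add (bad2_tendsto.comp sc_tendsto)
  rw [add_zero] at hg
  have hlow := ENNReal.Tendsto.sub (tendsto_const_nhds (x := (1:ENNReal))) hg (Or.inl (by norm_num))
  rw [tsub_zero] at hlow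
  refine tendsto_of_tendsto_of_tendsto_of_le_of_le' hlow tendsto_const_nhds ?_
    (Filter.Eventually.of_forall fun n => prob_le_one)
  filter_upwards [sc_tendsto.eventually_ge_atTop 400] with n hs
  have h1 := sc_le n
  have h2 := sc_ge n (by omega)
  have h3 : 2 * sc n < n := by
    refine lt_of_lt_of_le ?_ h1
    calc 2 * sc n < sc n * sc n := by nlinarith
      _ = (sc n)^2 := by ring
      _ ≤ (sc n)^100 := Nat.pow_le_pow_right (by omega) (by norm_num)
  have hn : 2 ≤ n := by omega
  obtain ⟨N, rfl⟩ : ∃ N, n = N + 1 := ⟨n - 1, by omega⟩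
  set s := sc (N+1) with hsdef
  set S := {C : Fin (N+1) × Fin (N+1) → ℝ | ⌈((N+1:ℕ) : ℝ) ^ (ε / 3)⌉₊ ^ ⌈((N+1:ℕ) : ℝ) ^ (ε / 3)⌉₊ ≤
            {π : Equiv.Perm (Fin (N+1)) | (∀ i, π i ≠ i) ∧
              permCost C π < ZATSP (N+1) C}.ncard} with hS
  set δ : ℝ := s * (1/(((N+1:ℕ):ℝ) * (s:ℝ)^2)) with hδ
  have hne : ∃ π : Equiv.Perm (Fin (N+1)), IsDerangement π := by
    obtain ⟨π, hπ⟩ := exists_cyclic (N+1) hn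
    exact ⟨π, hπ.2⟩
  have hb1 := bad1_real (N+1) s (by omega) h3
  have hb2 := bad2_real N s hs h1 h2 hne
  have hcov : (Set.univ : Set (Fin (N+1) × Fin (N+1) → ℝ)) ⊆
      S ∪ (Bad1 (N+1) δ ∪ {C | (NearSet δ C).ncard < 2 ^ s}) := by
    intro C _
    by_cases c1 : C ∈ Bad1 (N+1) δ
    · exact Or.inr (Or.inl c1)
    by_cases c2 : (NearSet δ C).ncard < 2 ^ s
    · exact Or.inr (Or.inr c2)
    left
    push Not at c2
    exact (dd_le (N+1) ε hε (by omega) (by omega)).trans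
      (c2.trans (Set.ncard_le_ncard (good_incl (N+1) hn δ C c1) (Set.toFinite _)))
  have hu : (1:ENNReal) ≤ costMeasure (N+1) S +
      (costMeasure (N+1) (Bad1 (N+1) δ) + costMeasure (N+1) {C | (NearSet δ C).ncard < 2 ^ s}) := by
    calc (1:ENNReal) = costMeasure (N+1) Set.univ := measure_univ.symm
      _ ≤ _ := (measure_mono hcov).trans ((measure_union_le _ _).trans
        (add_le_add le_rfl (measure_union_le _ _)))
  rw [tsub_le_iff_right]
  exact hu.trans (add_le_add le_rfl (add_le_add hb1 hb2))
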